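/- (Lusztig; Kashiwara–Saito) Let Q be the double quiver of a simply-laced Dynkin graph (vertices Q_0 the vertices of the graph, arrows Q_1 both orientations of each edge), fix an orientation Ω ⊂ Q_1, and define ε(ρ) = 1 for ρ ∈ Ω and ε(ρ) = −1 otherwise. For ν ∈ Z_{≥0}^{Q_0}, let V = V^ν with V_i = C^{ν_i}, let E_V = ⊕_{ρ∈Q_1} Hom(V_{t(ρ)}, V_{h(ρ)}), and let Λ_{V^ν} ⊂ E_V be the variety of nilpotent elements x satisfying the moment map equations Σ_{ρ∈Q_1, h(ρ)=i} ε(ρ) x_ρ x_{ρ̄} = 0 for all i ∈ Q_0 (where ρ̄ is the arrow ρ with reversed orientation). Let U^+ be the Q-algebra with generators e_i, i ∈ Q_0, subject to the Serre relations Σ_{p=0}^{1−c_{ij}} (−1)^p (1−c_{ij} choose p) e_i^p e_j e_i^{1−c_{ij}−p} = 0 for i ≠ j, graded so that U^+_ν is spanned by monomials containing e_i exactly ν_i times. Then dim_Q U^+_ν equals the number of irreducible components of Λ_{V^ν}. -/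

import Mathlib

noncomputable def gCartan {I E0 : Type} [DecidableEq I] (a b : E0 → I) (i j : I) : ℤ :=
  (if i = j then 2 else 0) -
    (Nat.card {x : E0 // (a x = i ∧ b x = j) ∨ (a x = j ∧ b x = i)} : ℤ)

inductive SerreRelQ {I E0 : Type} [Fintype E0] [DecidableEq I] (a b : E0 → I) :
    FreeAlgebra ℚ I → FreeAlgebra ℚ I → Prop
  | serre (i j : I) (hij : i ≠ j) :
      SerreRelQ a b
        (∑ p ∈ Finset.range ((1 - gCartan a b i j).toNat + 1),
          ((-1 : ℚ) ^ p * ((1 - gCartan a b i j).toNat.choose p : ℚ)) •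
            (FreeAlgebra.ι ℚ i ^ p * FreeAlgebra.ι ℚ j *
              FreeAlgebra.ι ℚ i ^ ((1 - gCartan a b i j).toNat - p)))
        0

abbrev UPlusQ {I : Type} (E0 : Type) [Fintype E0] [DecidableEq I] (a b : E0 → I) : Type :=
  RingQuot (SerreRelQ a b)

noncomputable def eQ {I E0 : Type} [Fintype E0] [DecidableEq I] (a b : E0 → I) (i : I) :
    UPlusQ E0 a b :=
  RingQuot.mkAlgHom ℚ (SerreRelQ a b) (FreeAlgebra.ι ℚ i)

noncomputable def gradeQ {I E0 : Type} [Fintype E0] [DecidableEq I] (a b : E0 → I)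
    (ν : I → ℕ) : Submodule ℚ (UPlusQ E0 a b) :=
  Submodule.span ℚ
    {u | ∃ l : List I, (∀ i, l.count i = ν i) ∧ u = (l.map (eQ a b)).prod}

def dsrc {I E0 : Type} (a b : E0 → I) (ρ : E0 × Bool) : I := if ρ.2 then b ρ.1 else a ρ.1

def dtgt {I E0 : Type} (a b : E0 → I) (ρ : E0 × Bool) : I := if ρ.2 then a ρ.1 else b ρ.1

def dbar {E0 : Type} (ρ : E0 × Bool) : E0 × Bool := (ρ.1, !ρ.2)

def eps {E0 : Type} (ρ : E0 × Bool) : ℤ := if ρ.2 then -1 else 1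

def EVs {I E0 : Type} (a b : E0 → I) (ν : I → ℕ) : Type :=
  ∀ ρ : E0 × Bool, Matrix (Fin (ν (dtgt a b ρ))) (Fin (ν (dsrc a b ρ))) ℂ

def WT {I : Type} (ν : I → ℕ) : Type := ∀ i : I, Fin (ν i) → ℂ

noncomputable instance {I : Type} (ν : I → ℕ) : AddCommGroup (WT ν) :=
  inferInstanceAs (AddCommGroup (∀ i : I, Fin (ν i) → ℂ))

noncomputable instance {I : Type} (ν : I → ℕ) : Module ℂ (WT ν) :=
  inferInstanceAs (Module ℂ (∀ i : I, Fin (ν i) → ℂ))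

noncomputable def gmap {I E0 : Type} [DecidableEq I] (a b : E0 → I) (ν : I → ℕ)
    (x : EVs a b ν) (ρ : E0 × Bool) : WT ν →ₗ[ℂ] WT ν :=
  (LinearMap.single ℂ (fun i => Fin (ν i) → ℂ) (dtgt a b ρ)).comp
    ((x ρ).mulVecLin.comp (LinearMap.proj (dsrc a b ρ)))

def NilEl {I E0 : Type} [DecidableEq I] (a b : E0 → I) (ν : I → ℕ) (x : EVs a b ν) : Prop :=
  ∃ N : ℕ, 1 ≤ N ∧ ∀ l : List (E0 × Bool), l.length = N →
    (l.map (gmap a b ν x)).prod = 0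

def MomentZero {I E0 : Type} [Fintype E0] [DecidableEq I] (a b : E0 → I) (ν : I → ℕ)
    (x : EVs a b ν) : Prop :=
  ∑ ρ : E0 × Bool, (eps ρ : ℂ) • ((gmap a b ν x ρ).comp (gmap a b ν x (dbar ρ))) = 0

noncomputable def zariskiEV {I E0 : Type} (a b : E0 → I) (ν : I → ℕ) :
    TopologicalSpace (EVs a b ν) :=
  TopologicalSpace.generateFrom
    {U | ∃ p : MvPolynomial
        ((ρ : E0 × Bool) × (Fin (ν (dtgt a b ρ)) × Fin (ν (dsrc a b ρ)))) ℂ,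
      U = {x | MvPolynomial.eval (fun c => x c.1 c.2.1 c.2.2) p ≠ 0}}

def LusztigLam {I E0 : Type} [Fintype E0] [DecidableEq I] (a b : E0 → I) (ν : I → ℕ) :
    Type :=
  {x : EVs a b ν // NilEl a b ν x ∧ MomentZero a b ν x}

noncomputable instance {I E0 : Type} [Fintype E0] [DecidableEq I] (a b : E0 → I)
    (ν : I → ℕ) : TopologicalSpace (LusztigLam a b ν) :=
  @instTopologicalSpaceSubtype _ _ (zariskiEV a b ν)

namespace KS
open Finset
set_option linter.unusedSectionVars false
section
variable {I : Type} [Fintype I] [DecidableEq I]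

abbrev al (i : I) : I → ℤ := Pi.single i 1

def pr (C : I → I → ℤ) (i : I) (β : I → ℤ) : ℤ := ∑ j, C i j * β j

lemma pr_add (C : I → I → ℤ) (i : I) (x y : I → ℤ) : pr C i (x + y) = pr C i x + pr C i y := by
  simp [pr, mul_add, sum_add_distrib]
lemma pr_sub (C : I → I → ℤ) (i : I) (x y : I → ℤ) : pr C i (x - y) = pr C i x - pr C i y := by
  simp [pr, mul_sub, sum_sub_distrib]
lemma pr_smul (C : I → I → ℤ) (i : I) (n : ℤ) (x : I → ℤ) : pr C i (n • x) = n * pr C i x := by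
  simp [pr, mul_sum, mul_left_comm]
lemma pr_zero (C : I → I → ℤ) (i : I) : pr C i 0 = 0 := by simp [pr]
lemma pr_al (C : I → I → ℤ) (i j : I) : pr C i (al j) = C i j := by simp [pr, Pi.single_apply]

structure Crys (C : I → I → ℤ) where
  B : Type
  wt : B → I → ℤ
  ep : I → B → ℕ
  es : I → B → ℕ
  em : I → B → B
  ems : I → B → B
  fin : ∀ ν, {b | wt b = ν}.Finite
  nonneg : ∀ b, 0 ≤ wt b
  wt_em : ∀ i b, wt (em i b) + (ep i b : ℤ) • al i = wt b
  wt_ems : ∀ i b, wt (ems i b) + (es i b : ℤ) • al i = wt b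
  em_eq : ∀ i b, ep i b = 0 → em i b = b
  ep_em : ∀ i b, ep i (em i b) = 0
  inj : ∀ i b b', em i b = em i b' → ep i b = ep i b' → b = b'
  surj : ∀ i b, ep i b = 0 → ∀ p, ∃ b', em i b' = b ∧ ep i b' = p
  comm : ∀ i j b, em i (ems j b) = ems j (em i b)
  mx : ∀ i b, (es i b : ℤ) = max (es i (em i b) : ℤ) (ep i b + pr C i (wt (em i b)))
  top : ∀ b, wt b ≠ 0 → ∃ i, 0 < ep i b
  one : B
  wt_one : wt one = 0
  uniq : ∀ b, wt b = 0 → b = one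

namespace Crys
variable {C : I → I → ℤ} (K : Crys C)

lemma em_em (i : I) (b : K.B) : K.em i (K.em i b) = K.em i b := K.em_eq _ _ (K.ep_em _ _)

lemma wt_ap (i j : I) (b : K.B) : K.wt b j = K.wt (K.em i b) j + K.ep i b * al i j := by
  rw [← K.wt_em i b]; simp
lemma wt_aps (i j : I) (b : K.B) : K.wt b j = K.wt (K.ems i b) j + K.es i b * al i j := by
  rw [← K.wt_ems i b]; simp

lemma es_le (i : I) (b : K.B) : (K.es i b : ℤ) ≤ K.wt b i := by
  have h1 := K.wt_aps i i b
  have h2 := K.nonneg (K.ems i b) i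
  simp at h1 h2; omega
lemma ep_le (i : I) (b : K.B) : (K.ep i b : ℤ) ≤ K.wt b i := by
  have h1 := K.wt_ap i i b
  have h2 := K.nonneg (K.em i b) i
  simp at h1 h2; omega

lemma square (i j l : I) (b : K.B) : K.ep i (K.ems j b) * al i l + K.es j b * al j l =
    K.es j (K.em i b) * al j l + K.ep i b * al i l := by
  have h1 := K.wt_aps j l b
  have h2 := K.wt_ap i l (K.ems j b)
  have h3 := K.wt_ap i l b
  have h4 := K.wt_aps j l (K.em i b)
  rw [K.comm] at h2
  linarith

lemma ep_ems {i j : I} (h : i ≠ j) (b : K.B) : K.ep i (K.ems j b) = K.ep i b := by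
  have := K.square i j i b
  simpa [Pi.single_apply, h] using this
lemma es_em {i j : I} (h : i ≠ j) (b : K.B) : K.es j (K.em i b) = K.es j b := by
  have := K.square i j j b
  simpa [Pi.single_apply, h.symm] using this.symm

lemma em_one (i : I) : K.em i K.one = K.one := by
  apply K.uniq
  have h1 := K.wt_em i K.one
  have h2 := K.ep_le i K.one
  have : K.ep i K.one = 0 := by
    rw [K.wt_one] at h2; simp at h2; exact h2
  rw [K.em_eq _ _ this, K.wt_one]

lemma em_of_wt (j : I) (b : K.B) (h : ∀ l, l ≠ j → K.wt b l = 0) : K.em j b = K.one := by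
  apply K.uniq
  by_contra hne
  obtain ⟨i, hi⟩ := K.top _ hne
  by_cases hij : i = j
  · subst hij; simp [K.ep_em] at hi
  · have h1 := K.ep_le i (K.em j b)
    have h2 := K.wt_ap j i b
    rw [h i hij] at h2
    simp [hij] at h2
    omega

lemma em_iff (j : I) (b : K.B) : K.em j b = K.one ↔ K.ems j b = K.one := by
  constructor
  · intro h
    have h1 := K.mx j b
    have h2 := K.es_le j K.one
    rw [h, K.wt_one, pr_zero] at h1
    rw [K.wt_one] at h2
    simp at h2
    rw [h2] at h1
    apply K.uniq
    have h3 := K.wt_em j b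
    have h4 := K.wt_ems j b
    rw [h, K.wt_one, zero_add] at h3
    have : (K.es j b : ℤ) = K.ep j b := by rw [h1]; simp
    rw [this, h3] at h4
    simpa using h4
  · intro h
    apply K.em_of_wt
    intro l hl
    rw [K.wt_aps j l b, h, K.wt_one]
    simp [hl]

def emL : List I → K.B → K.B
  | [], b => b
  | i :: l, b => emL l (K.em i b)

def X (l : List I) : Set K.B := {b | K.emL l b = K.one}

lemma emL_app (l m : List I) (b : K.B) : K.emL (l ++ m) b = K.emL m (K.emL l b) := by
  induction l generalizing b with
  | nil => rfl
  | cons i l ih => simp [emL, ih]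
lemma emL_ems (l : List I) (j : I) (b : K.B) : K.emL l (K.ems j b) = K.ems j (K.emL l b) := by
  induction l generalizing b with
  | nil => rfl
  | cons i l ih => simp [emL, ← ih, K.comm]
lemma emL_one (l : List I) : K.emL l K.one = K.one := by
  induction l with
  | nil => rfl
  | cons i l ih => simp [emL, em_one, ih]
lemma X_snoc (l : List I) (j : I) (b : K.B) : b ∈ K.X (l ++ [j]) ↔ K.ems j b ∈ K.X l := by
  simp only [X, Set.mem_ofPred_eq, emL_app, emL_ems]
  exact K.em_iff _ _

lemma ems_lo (hC : ∀ i, C i i = 2) (i : I) (b : K.B) : (K.ep i (K.ems i b) : ℤ) =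
    min (K.ep i b : ℤ) (-(pr C i (K.wt (K.em i b))) + K.es i (K.em i b)) := by
  have h := K.square i i i b
  have h2 := K.mx i b
  simp at h
  omega

lemma X_string (hC : ∀ i, C i i = 2) (l : List I) : ∀ i b b', b ∈ K.X l → 0 < K.ep i b →
    K.em i b' = K.em i b → b' ∈ K.X l := by
  induction l using List.reverseRecOn with
  | nil =>
    intro i b b' hb hp
    have := K.ep_le i b
    simp only [X, emL, Set.mem_ofPred_eq] at hb
    subst hb
    rw [K.wt_one] at this; simp at this; omega
  | append_singleton l j ih =>
    intro i b b' hb hp he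
    rw [X_snoc] at hb ⊢
    by_cases hp' : 0 < K.ep i (K.ems j b)
    · exact ih i _ _ hb hp' (by rw [K.comm, K.comm, he])
    · by_cases hij : i = j
      · subst hij
        have h1 := K.ems_lo hC i b
        have h2 := K.ems_lo hC i b'
        rw [he] at h2
        have : K.ems i b' = K.ems i b := K.inj i _ _ (by rw [K.comm, K.comm, he]) (by omega)
        rwa [this]
      · rw [K.ep_ems hij] at hp'; omega

lemma X_cons (hC : ∀ i, C i i = 2) (i : I) (l : List I) : K.X l ⊆ K.X (i :: l) := by
  intro b hb
  change K.em i b ∈ K.X l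
  by_cases h : K.ep i b = 0
  · rwa [K.em_eq _ _ h]
  · exact K.X_string hC l i b _ hb (by omega) (K.em_em i b)

lemma X_app (hC : ∀ i, C i i = 2) (l m : List I) : K.X l ∪ K.X m ⊆ K.X (l ++ m) := by
  rintro b (hb | hb)
  · simp only [X, Set.mem_ofPred_eq] at *
    rw [emL_app, hb, emL_one]
  · induction l with
    | nil => exact hb
    | cons i l ih => exact K.X_cons hC i _ ih

lemma X_all (b : K.B) : ∃ l, b ∈ K.X l := by
  generalize hn : (∑ i, K.wt b i).toNat = n
  induction n using Nat.strong_induction_on generalizing b with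
  | _ n ih =>
    by_cases h : K.wt b = 0
    · exact ⟨[], K.uniq b h⟩
    · obtain ⟨i, hi⟩ := K.top b h
      have h1 : ∑ j, K.wt b j = ∑ j, K.wt (K.em i b) j + K.ep i b := by
        rw [sum_congr rfl (fun j _ => K.wt_ap i j b), sum_add_distrib, ← mul_sum]; simp
      have h2 : 0 ≤ ∑ j, K.wt (K.em i b) j := sum_nonneg fun j _ => K.nonneg _ j
      obtain ⟨l, hl⟩ := ih _ (by omega) (K.em i b) rfl
      exact ⟨i :: l, hl⟩

lemma X_fin (hC : ∀ i, C i i = 2) (s : Set K.B) (hs : s.Finite) : ∃ l, s ⊆ K.X l := by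
  induction s, hs using Set.Finite.induction_on with
  | empty => exact ⟨[], by simp⟩
  | insert _ _ ih =>
    rename_i b s _ _
    obtain ⟨l, hl⟩ := ih
    obtain ⟨m, hm⟩ := K.X_all b
    exact ⟨m ++ l, Set.insert_subset (K.X_app hC m l (Or.inl hm))
      fun x hx => K.X_app hC m l (Or.inr (hl hx))⟩

def Bl (la : I → ℤ) : Set K.B := {b | ∀ i, (K.es i b : ℤ) ≤ la i}

lemma Bl_em (la : I → ℤ) (i : I) (b : K.B) : b ∈ K.Bl la ↔ K.em i b ∈ K.Bl la ∧
    (K.ep i b : ℤ) ≤ la i - pr C i (K.wt (K.em i b)) := by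
  have hm := K.mx i b
  constructor
  · intro h
    refine ⟨fun j => ?_, ?_⟩
    · by_cases hij : i = j
      · subst hij; have := h i; omega
      · rw [K.es_em hij]; exact h j
    · have := h i; omega
  · rintro ⟨h, h1⟩ j
    by_cases hij : i = j
    · subst hij; have := h i; omega
    · rw [← K.es_em hij]; exact h j

noncomputable def mv (i : I) (b : K.B) (p : ℕ) : K.B :=
  (K.surj i (K.em i b) (K.ep_em i b) p).choose
lemma em_mv (i : I) (b : K.B) (p : ℕ) : K.em i (K.mv i b p) = K.em i b :=
  (K.surj i (K.em i b) (K.ep_em i b) p).choose_spec.1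
lemma ep_mv (i : I) (b : K.B) (p : ℕ) : K.ep i (K.mv i b p) = p :=
  (K.surj i (K.em i b) (K.ep_em i b) p).choose_spec.2

def rf (C : I → I → ℤ) (i : I) (κ β : I → ℤ) : I → ℤ := β + (κ i - pr C i β) • al i

lemma rf_rf (hC : ∀ i, C i i = 2) (i : I) (κ β : I → ℤ) : rf C i κ (rf C i κ β) = β := by
  simp only [rf, pr_add, pr_smul, pr_al, hC]
  module

lemma mv_wt (hC : ∀ i, C i i = 2) (κ : I → ℤ) (i : I) (b : K.B) (p : ℕ)
    (hp : (K.ep i b : ℤ) + p = κ i - pr C i (K.wt (K.em i b))) :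
    K.wt (K.mv i b p) = rf C i κ (K.wt b) := by
  have h1 := K.wt_em i (K.mv i b p)
  rw [K.em_mv, K.ep_mv] at h1
  rw [← h1, ← K.wt_em i b]
  simp only [rf, pr_add, pr_smul, pr_al, hC]
  have : (p : ℤ) = κ i - pr C i (K.wt (K.em i b)) - K.ep i b := by omega
  rw [this]; module

noncomputable def cnt (S : Set K.B) (ν : I → ℤ) : ℕ := {b | b ∈ S ∧ K.wt b = ν}.ncard

lemma fin' (S : Set K.B) (ν : I → ℤ) : {b | b ∈ S ∧ K.wt b = ν}.Finite :=
  (K.fin ν).subset fun _ h => h.2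

lemma cnt_le (hC : ∀ i, C i i = 2) (S : Set K.B) (κ : I → ℤ) (i : I) (q : ℕ → ℤ → ℕ)
    (hS : ∀ b ∈ S, K.mv i b (q (K.ep i b) (κ i - pr C i (K.wt (K.em i b)))) ∈ S ∧
     (K.ep i b : ℤ) + q (K.ep i b) (κ i - pr C i (K.wt (K.em i b))) =
       κ i - pr C i (K.wt (K.em i b))) (ν : I → ℤ) :
    K.cnt S ν ≤ K.cnt S (rf C i κ ν) := by
  refine Set.ncard_le_ncard_of_injOn
    (fun b => K.mv i b (q (K.ep i b) (κ i - pr C i (K.wt (K.em i b))))) ?_ ?_ (K.fin' _ _)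
  · rintro b ⟨hb, rfl⟩
    exact ⟨(hS b hb).1, K.mv_wt hC κ i b _ (hS b hb).2⟩
  · rintro b ⟨hb, h1⟩ b' ⟨hb', h2⟩ h
    have e1 := congrArg (K.em i) h
    have e2 := congrArg (K.ep i) h
    simp only [em_mv, ep_mv] at e1 e2
    refine K.inj i _ _ e1 ?_
    have := (hS b hb).2
    have := (hS b' hb').2
    rw [e1] at *
    omega

lemma cnt_eq (hC : ∀ i, C i i = 2) (S : Set K.B) (κ : I → ℤ) (i : I)
    (hS : ∀ b ∈ S, ∃ p : ℕ, K.mv i b p ∈ S ∧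
     (K.ep i b : ℤ) + p = κ i - pr C i (K.wt (K.em i b))) (ν : I → ℤ) :
    K.cnt S (rf C i κ ν) = K.cnt S ν := by
  have key := K.cnt_le hC S κ i (fun e L => (L - e).toNat) (by
    intro b hb
    obtain ⟨p, h1, h2⟩ := hS b hb
    have : (κ i - pr C i (K.wt (K.em i b)) - (K.ep i b : ℤ)).toNat = p := by omega
    simp only [this]
    exact ⟨h1, h2⟩)
  refine le_antisymm ?_ (key ν)
  have := key (rf C i κ ν)
  rwa [rf_rf hC] at this

lemma cnt_Bl (hC : ∀ i, C i i = 2) (la : I → ℤ) (i : I) (ν : I → ℤ) :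
    K.cnt (K.Bl la) (rf C i la ν) = K.cnt (K.Bl la) ν := by
  apply K.cnt_eq hC
  intro b hb
  rw [K.Bl_em la i] at hb
  obtain ⟨p, hp⟩ := Int.eq_ofNat_of_zero_le (sub_nonneg.2 hb.2)
  refine ⟨p, ?_, by omega⟩
  rw [K.Bl_em la i, em_mv, ep_mv]
  exact ⟨hb.1, by omega⟩

def Z (la : I → ℤ) (i : I) (l : List I) : Set K.B := {b | b ∈ K.Bl la ∧ b ∈ K.X (i :: l) ∧ b ∉ K.X l}

lemma cnt_Z (hC : ∀ i, C i i = 2) (la : I → ℤ) (i : I) (l : List I) (ν : I → ℤ) :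
    K.cnt (K.Z la i l) (rf C i (la + 1) ν) = K.cnt (K.Z la i l) ν := by
  apply K.cnt_eq hC
  rintro b ⟨hb, hX, hn⟩
  rw [K.Bl_em la i] at hb
  have hX' : K.em i b ∈ K.X l := hX
  have hpos : 0 < K.ep i b := by
    by_contra h
    rw [K.em_eq i b (by omega)] at hX'
    exact hn hX'
  obtain ⟨p, hp⟩ := Int.eq_ofNat_of_zero_le (sub_nonneg.2 hb.2)
  refine ⟨p + 1, ⟨?_, ?_, ?_⟩, by push_cast; simp only [Pi.add_apply, Pi.one_apply]; omega⟩
  · rw [K.Bl_em la i, em_mv, ep_mv]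
    exact ⟨hb.1, by push_cast; omega⟩
  · change K.em i _ ∈ K.X l
    rwa [em_mv]
  · intro h
    exact hn (K.X_string hC l i _ b h (by rw [ep_mv]; omega) (by rw [em_mv]))

lemma cnt_cons (hC : ∀ i, C i i = 2) (la : I → ℤ) (i : I) (l : List I) (ν : I → ℤ) :
    K.cnt (K.Bl la ∩ K.X (i :: l)) ν = K.cnt (K.Bl la ∩ K.X l) ν + K.cnt (K.Z la i l) ν := by
  unfold cnt
  rw [← Set.ncard_union_eq _ (K.fin' _ _) (K.fin' _ _)]
  · congr 1
    ext b
    have := @X_cons I _ _ C K hC i l b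
    simp only [Set.mem_inter_iff, Set.mem_ofPred_eq, Set.mem_union, Z]
    tauto
  · rw [Set.disjoint_left]
    rintro b ⟨h, _⟩ ⟨h', _⟩
    exact h'.2.2 h.2

end Crys
end
end KS

namespace KS
open Finset
set_option linter.unusedSectionVars false
section
variable {I : Type} [Fintype I] [DecidableEq I]
namespace Crys

def sr (C : I → I → ℤ) (hC : ∀ i, C i i = 2) (i : I) :
    ((I → ℤ) × (I → ℤ)) ≃ₗ[ℤ] ((I → ℤ) × (I → ℤ)) where
  toFun x := (x.1, rf C i x.1 x.2)
  invFun x := (x.1, rf C i x.1 x.2)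
  left_inv x := by simp [rf_rf hC]
  right_inv x := by simp [rf_rf hC]
  map_add' x y := by
    simp only [rf, Prod.fst_add, Prod.snd_add, pr_add, Pi.add_apply, Prod.mk_add_mk]
    congr 1; module
  map_smul' n x := by
    simp only [rf, pr_smul, Pi.smul_apply, Prod.smul_def, RingHom.id_apply, smul_eq_mul]
    congr 1; module

variable {C : I → I → ℤ} (hC : ∀ i, C i i = 2)

abbrev Wy : Subgroup (((I → ℤ) × (I → ℤ)) ≃ₗ[ℤ] ((I → ℤ) × (I → ℤ))) := Subgroup.closure (Set.range (sr C hC))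

lemma W_ind (P : (I → ℤ) × (I → ℤ) → Prop) (h : ∀ i x, P (sr C hC i x) ↔ P x) (w : Wy hC) (x) :
    P (w.1 x) ↔ P x := by
  obtain ⟨w, hw⟩ := w
  revert x
  refine Subgroup.closure_induction (p := fun w _ => ∀ x, P (w x) ↔ P x) ?_ ?_ ?_ ?_ hw
  · rintro _ ⟨i, rfl⟩ x; exact h i x
  · intro x; rfl
  · intro u v _ _ hu hv x; rw [LinearEquiv.mul_apply, hu, hv]
  · intro u _ hu x
    rw [← hu (u⁻¹ x), ← LinearEquiv.mul_apply, mul_inv_cancel]; rfl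

lemma W_fst (w : Wy hC) (x) : (w.1 x).1 = x.1 :=
  (W_ind hC (fun y => y.1 = x.1) (fun i y => by simp [sr]) w x).2 rfl

lemma W_fix (w : Wy hC) (β : I → ℤ) : w.1 (fun i => pr C i β, β) = (fun i => pr C i β, β) :=
  (W_ind hC (fun y => y = (fun i => pr C i β, β)) (fun i y => by
    have : sr C hC i (fun i => pr C i β, β) = (fun i => pr C i β, β) := by simp [sr, rf]
    nth_rw 1 [← this]
    exact (sr C hC i).injective.eq_iff) w _).2 rfl

variable (K : Crys C)

lemma W_cnt (w : Wy hC) (x) : K.cnt (K.Bl x.1) (w.1 x).2 = K.cnt (K.Bl x.1) x.2 := by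
  have := (W_ind hC (fun y => K.cnt (K.Bl y.1) y.2 = K.cnt (K.Bl x.1) x.2)
    (fun i y => by simp [sr, K.cnt_Bl hC]) w x).2 rfl
  simpa only [W_fst] using this

lemma es_one (i : I) : K.es i K.one = 0 := by
  have := K.es_le i K.one
  rw [K.wt_one] at this; simp at this; exact this

lemma cnt_pos {S : Set K.B} {ν : I → ℤ} (h : K.cnt S ν ≠ 0) : 0 ≤ ν := by
  obtain ⟨b, _, rfl⟩ := Set.nonempty_of_ncard_ne_zero h
  exact K.nonneg b

include K in
lemma W_nonneg (w : Wy hC) (κ : I → ℤ) (hκ : 0 ≤ κ) : 0 ≤ (w.1 (κ, 0)).2 := by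
  apply K.cnt_pos (S := K.Bl κ)
  rw [K.W_cnt hC w (κ, 0)]
  exact (Set.ncard_pos (K.fin' _ _)).2 ⟨K.one, fun i => by simpa [es_one] using hκ i, K.wt_one⟩ |>.ne'

include K in
lemma W_ge (w : Wy hC) (κ β : I → ℤ) (h : ∀ i, pr C i β ≤ κ i) : β ≤ (w.1 (κ, β)).2 := by
  have h1 : ((κ, β) : (I → ℤ) × (I → ℤ)) = (κ - fun i => pr C i β, 0) + (fun i => pr C i β, β) := by
    simp
  rw [h1, map_add, W_fix]
  have := K.W_nonneg hC w (κ - fun i => pr C i β) (fun i => by simpa using h i)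
  simpa using this

include K in
lemma W_free (w : Wy hC) (h : (w.1 (1, 0)).2 = 0) : w = 1 := by
  have e : ∀ κ : I → ℤ, ((κ, 0) : (I → ℤ) × (I → ℤ)) = ∑ i, κ i • ((Pi.single i 1, 0) : (I → ℤ) × (I → ℤ)) := by
    intro κ
    ext j <;> simp [Prod.fst_sum, Prod.snd_sum, Pi.single_apply]
  have h1 : ∑ i, (w.1 (Pi.single i 1, 0)).2 = 0 := by
    rw [e 1, map_sum] at h
    simpa [Prod.snd_sum] using h
  have h2 := (sum_eq_zero_iff_of_nonneg (fun i _ => K.W_nonneg hC w (Pi.single i 1)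
    (by intro j; by_cases hj : j = i <;> simp [Pi.single_apply, hj]))).1 h1
  have h3 : ∀ κ, w.1 (κ, 0) = (κ, 0) := by
    intro κ
    ext1
    · simp [W_fst]
    · rw [e, map_sum]
      simp only [map_zsmul, Prod.snd_sum, Prod.smul_snd]
      exact sum_congr rfl fun i hi => by rw [h2 i hi]
  ext1; ext1 ⟨κ, β⟩
  have h4 : ((κ, β) : (I → ℤ) × (I → ℤ)) = (κ - fun i => pr C i β, 0) + (fun i => pr C i β, β) := by
    simp
  rw [h4, map_add, W_fix, h3]
  rfl

variable (c : (I → ℤ) → ℚ) (c0 : c 0 = 1) (cp : ∀ β, c β ≠ 0 → 0 ≤ β)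
  (cs : ∀ i β, c (rf C i 1 β) = - c β) (ca : ∀ β, β ≠ 0 → (∀ i, pr C i β ≤ 0) → c β = 0)

include cs c0 in
lemma sgn_mul (u v : Wy hC) : c ((u * v).1 (1, 0)).2 = c (u.1 (1, 0)).2 * c (v.1 (1, 0)).2 := by
  obtain ⟨u, hu⟩ := u
  revert v
  refine Subgroup.closure_induction (p := fun u _ => ∀ v : Wy hC, c ((u * v.1) (1, 0)).2 =
    c (u (1, 0)).2 * c (v.1 (1, 0)).2) ?_ ?_ ?_ ?_ hu
  · rintro _ ⟨i, rfl⟩ v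
    have := W_fst hC v (1, 0)
    simp only [LinearEquiv.mul_apply]
    change c (rf C i (v.1 (1, 0)).1 (v.1 (1, 0)).2) = c (rf C i 1 0) * _
    rw [this, cs, cs, c0]; ring
  · intro v; simp [c0]
  · intro x y hx hy h1 h2 v
    have := h1 (⟨y, hy⟩ * v)
    rw [mul_assoc]
    erw [this, h2, h1 ⟨y, hy⟩]; ring
  · intro x hx h v
    have h1 := h ⟨x⁻¹, inv_mem hx⟩
    have h2 := h (⟨x⁻¹, inv_mem hx⟩ * v)
    simp [c0] at h1 h2
    have hx0 : c (x (1, 0)).2 ≠ 0 := by intro h0; simp [h0] at h1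
    apply mul_left_cancel₀ hx0
    change c (x (1, 0)).2 * c (x.symm (v.1 (1, 0))).2 = c (x (1, 0)).2 * (c (x.symm (1, 0)).2 * c (v.1 (1, 0)).2)
    rw [← h2, ← mul_assoc, ← h1, one_mul]

include c0 cp cs ca in
lemma W_surj (β : I → ℤ) (h : c β ≠ 0) : ∃ w : Wy hC, (w.1 (1, 0)).2 = β := by
  generalize hn : (∑ i, β i).toNat = n
  induction n using Nat.strong_induction_on generalizing β with
  | _ n ih =>
    by_cases hb : β = 0
    · exact ⟨1, by simp [hb]⟩
    obtain ⟨i, hi⟩ : ∃ i, 0 < pr C i β := by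
      by_contra! hh; exact h (ca β hb hh)
    have h1 : c (rf C i 1 β) ≠ 0 := by rw [cs]; exact neg_ne_zero.2 h
    have h2 : pr C i β ≠ 1 := by
      intro h2
      have := cs i β
      simp [rf, h2] at this; exact h (by linarith)
    have h3 : ∑ j, rf C i 1 β j = ∑ j, β j + (1 - pr C i β) := by
      simp only [rf, Pi.add_apply, Pi.smul_apply, sum_add_distrib, ← smul_sum]; simp
    have h4 : 0 ≤ ∑ j, rf C i 1 β j := sum_nonneg fun j _ => cp _ h1 j
    obtain ⟨w, hw⟩ := ih _ (by omega) _ h1 rfl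
    refine ⟨⟨sr C hC i, Subgroup.subset_closure ⟨i, rfl⟩⟩ * w, ?_⟩
    change rf C i (w.1 (1, 0)).1 (w.1 (1, 0)).2 = β
    rw [W_fst, hw, rf_rf hC]

include hC c0 cp cs ca in
theorem conv (ν : I → ℤ) (hν : 0 ≤ ν) :
    ∑ β ∈ Icc 0 ν, c β * K.cnt Set.univ (ν - β) = if ν = 0 then 1 else 0 := by
  split_ifs with h0
  · subst h0
    simp only [Icc_self, sum_singleton, c0, one_mul, sub_zero]
    have : {b | b ∈ (Set.univ : Set K.B) ∧ K.wt b = 0} = {K.one} := by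
      ext b; constructor
      · rintro ⟨_, h⟩; exact K.uniq b h
      · rintro rfl; exact ⟨trivial, K.wt_one⟩
    rw [cnt, this, Set.ncard_singleton]; simp
  set la : I → ℤ := fun i => max (ν i) (pr C i ν) with hla
  have hla1 : ∀ i, ν i ≤ la i := fun i => le_max_left _ _
  have hla2 : ∀ i, pr C i ν ≤ la i := fun i => le_max_right _ _

  let g : (S : Set K.B) → Wy hC → ℚ := fun S w => c (w.1 (1, 0)).2 * K.cnt S (w⁻¹.1 (la + 1, ν)).2
  have hW : ∀ w : Wy hC, K.cnt (K.Bl la) (w⁻¹.1 (la + 1, ν)).2 =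
      K.cnt (K.Bl la) (ν - (w.1 (1, 0)).2) := by
    intro w
    have e : w.1 (la, (w⁻¹.1 (la + 1, ν)).2) = (la, ν - (w.1 (1, 0)).2) := by
      have : ((la, (w⁻¹.1 (la + 1, ν)).2) : (I → ℤ) × (I → ℤ)) = w⁻¹.1 (la + 1, ν) - (1, 0) := by
        ext1
        · rw [Prod.fst_sub, W_fst]; simp
        · simp
      rw [this, map_sub]
      ext1 <;> simp [W_fst]
    have := K.W_cnt hC w (la, (w⁻¹.1 (la + 1, ν)).2)
    rw [← this, e]
  have inj : Function.Injective fun w : Wy hC => (w.1 (1, 0)).2 := by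
    intro u v huv
    have : u.1 (1, 0) = v.1 (1, 0) := Prod.ext (by simp [W_fst]) huv
    have h2 : v⁻¹ * u = 1 := K.W_free hC _ (by
      change (v.1⁻¹ (u.1 (1, 0))).2 = 0
      rw [this, ← LinearEquiv.mul_apply, inv_mul_cancel]; rfl)
    exact (inv_mul_eq_one.1 h2).symm
  have mono : ∀ S T : Set K.B, S ⊆ T → ∀ β, K.cnt S β ≤ K.cnt T β := fun S T h β =>
    Set.ncard_le_ncard (fun b hb => ⟨h hb.1, hb.2⟩) (K.fin' _ _)
  have fs : ∀ S ⊆ K.Bl la, (Function.support (g S)).Finite := by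
    intro S hS
    refine ((Icc 0 ν).finite_toSet.preimage inj.injOn).subset fun w hw => ?_
    have h1 : K.cnt S (w⁻¹.1 (la + 1, ν)).2 ≠ 0 := fun h => hw (by simp only [g, h]; simp)
    have h2 := mono _ _ hS (w⁻¹.1 (la + 1, ν)).2
    rw [hW] at h2
    have h3 := K.cnt_pos (show K.cnt (K.Bl la) (ν - (w.1 (1, 0)).2) ≠ 0 by omega)
    simp only [Set.mem_preimage, coe_Icc, Set.mem_Icc]
    exact ⟨K.W_nonneg hC w 1 (by intro i; simp), sub_nonneg.1 h3⟩

  have s1 : ∑ β ∈ Icc 0 ν, c β * K.cnt Set.univ (ν - β) = ∑ᶠ w, g (K.Bl la) w := by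
    have e1 : ∀ w, g (K.Bl la) w = (fun β => c β * (K.cnt (K.Bl la) (ν - β) : ℚ)) (w.1 (1, 0)).2 := by
      intro w; simp only [g, hW]
    rw [finsum_congr e1, ← finsum_mem_range (f := fun β => c β * (K.cnt (K.Bl la) (ν - β) : ℚ)) inj]
    rw [finsum_mem_eq_sum_of_inter_support_eq (t := Icc 0 ν)]
    · refine sum_congr rfl fun β hβ => ?_
      congr 2
      unfold cnt
      congr 1
      ext b
      simp only [Set.mem_univ, true_and, Set.mem_ofPred_eq]
      refine ⟨fun h => ⟨fun i => ?_, h⟩, fun h => h.2⟩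
      have h1 := K.es_le i b
      rw [h] at h1
      have := hla1 i
      have := (mem_Icc.1 hβ).1 i
      simp at *; omega
    · ext β
      simp only [Set.mem_inter_iff, Set.mem_range, Function.mem_support, coe_Icc, Set.mem_Icc, and_congr_left_iff]
      intro h
      refine ⟨fun _ => ⟨cp β (left_ne_zero_of_mul h), sub_nonneg.1 (K.cnt_pos (S := K.Bl la) ?_)⟩,
        fun _ => W_surj hC c c0 cp cs ca β (left_ne_zero_of_mul h)⟩
      exact_mod_cast right_ne_zero_of_mul h

  have s2 : ∀ l, ∑ᶠ w, g (K.Bl la ∩ K.X l) w = 0 := by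
    intro l
    induction l with
    | nil =>
      refine (finsum_congr fun w => ?_).trans finsum_zero
      have h1 := K.W_ge hC w⁻¹ (la + 1) ν (fun i => by have := hla2 i; simp; omega)
      have : K.cnt (K.Bl la ∩ K.X []) (w⁻¹.1 (la + 1, ν)).2 = 0 := by
        by_contra hne
        obtain ⟨b, ⟨_, hb⟩, h2⟩ := Set.nonempty_of_ncard_ne_zero hne
        have hb : b = K.one := hb
        rw [hb, K.wt_one] at h2
        rw [← h2] at h1
        exact h0 (le_antisymm h1 hν)
      simp only [g, this]; simp
    | cons i l ih =>
      have e1 : ∀ w, g (K.Bl la ∩ K.X (i :: l)) w = g (K.Bl la ∩ K.X l) w + g (K.Z la i l) w := by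
        intro w; simp only [g, K.cnt_cons hC]; push_cast; ring
      rw [finsum_congr e1, finsum_add_distrib (fs _ Set.inter_subset_left) (fs _ fun b hb => hb.1), ih,
        zero_add]
      have e2 : ∑ᶠ w, g (K.Z la i l) w = - ∑ᶠ w, g (K.Z la i l) w := by
        let si : Wy hC := ⟨sr C hC i, Subgroup.subset_closure ⟨i, rfl⟩⟩
        nth_rw 1 [← finsum_comp_equiv (Equiv.mulRight si)]
        rw [← finsum_neg_distrib]
        refine finsum_congr fun w => ?_
        simp only [g, Equiv.coe_mulRight, mul_inv_rev]
        rw [sgn_mul hC c c0 cs]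
        have h1 : c (si.1 (1, 0)).2 = -1 := by
          change c (rf C i 1 0) = -1
          rw [cs, c0]
        have h2 : si⁻¹ = si := by
          rw [inv_eq_iff_mul_eq_one]
          ext1; ext1 x
          exact (sr C hC i).left_inv x
        have h3 : ((si * w⁻¹).1 (la + 1, ν)).2 = rf C i (la + 1) (w⁻¹.1 (la + 1, ν)).2 := by
          change rf C i (w⁻¹.1 (la + 1, ν)).1 (w⁻¹.1 (la + 1, ν)).2 = _
          rw [W_fst]
        rw [h1, h2, h3, K.cnt_Z hC]; ring
      linarith

  have fT : {b | b ∈ K.Bl la ∧ K.wt b ∈ ((fun w : Wy hC => (w⁻¹.1 (la + 1, ν)).2) ''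
      Function.support (g (K.Bl la)))}.Finite := by
    refine (((fs _ subset_rfl).image fun w : Wy hC => (w⁻¹.1 (la + 1, ν)).2).biUnion fun β _ => K.fin β).subset fun b hb => ?_
    exact Set.mem_biUnion hb.2 rfl
  obtain ⟨l, hl⟩ := K.X_fin hC _ fT
  rw [s1, ← s2 l]
  refine finsum_congr fun w => ?_
  by_cases hw : w ∈ Function.support (g (K.Bl la))
  · simp only [g]
    congr 2
    unfold cnt
    congr 1
    ext b
    refine ⟨fun h => ⟨⟨h.1, hl ⟨h.1, ⟨w, hw, h.2.symm⟩⟩⟩, h.2⟩, fun h => ⟨h.1.1, h.2⟩⟩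
  · have h1 : g (K.Bl la) w = 0 := by simpa using hw
    rw [h1]
    simp only [g] at h1 ⊢
    rcases mul_eq_zero.1 h1 with h | h
    · rw [h]; simp
    · have := mono (K.Bl la ∩ K.X l) _ Set.inter_subset_left (w⁻¹.1 (la + 1, ν)).2
      have h' : K.cnt (K.Bl la) (w⁻¹.1 (la + 1, ν)).2 = 0 := by exact_mod_cast h
      rw [show K.cnt (K.Bl la ∩ K.X l) (w⁻¹.1 (la + 1, ν)).2 = 0 by omega]; simp

end Crys
end
end KS

namespace KS
open Finset
set_option linter.unusedSectionVars false
section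

def adp {A : Type} [Ring A] (x : A) (n : ℕ) (y : A) : A := (fun z => x * z - z * x)^[n] y

lemma adp_succ {A : Type} [Ring A] (x : A) (n : ℕ) (y : A) :
    adp x (n + 1) y = x * adp x n y - adp x n y * x := Function.iterate_succ_apply' _ _ _
lemma adp_zero {A : Type} [Ring A] (x : A) (y : A) : adp x 0 y = y := rfl

lemma adp_serre {A : Type} [Ring A] [Algebra ℚ A] (x y : A) (n : ℕ) :
    ∑ p ∈ range (n + 1), ((-1 : ℚ) ^ p * (n.choose p : ℚ)) • (x ^ p * y * x ^ (n - p)) =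
      (-1 : ℚ) ^ n • adp x n y := by
  let L : Module.End ℚ A := LinearMap.mulLeft ℚ (-x)
  let R : Module.End ℚ A := LinearMap.mulRight ℚ x
  have h1 : ∀ m, ((L + R) ^ m) y = (-1 : ℚ) ^ m • adp x m y := by
    intro m
    induction m with
    | zero => simp [adp_zero]
    | succ m ih =>
      rw [pow_succ', Module.End.mul_apply, ih, adp_succ, pow_succ, mul_smul]
      simp [L, R, neg_add_eq_sub]
  have hc : Commute L R := LinearMap.ext fun z => by simp [L, R, mul_assoc]
  rw [← h1, hc.add_pow]
  simp only [LinearMap.sum_apply]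
  refine sum_congr rfl fun p _ => ?_
  have : ((n.choose p : Module.End ℚ A)) y = (n.choose p : ℚ) • y := by
    rw [← nsmul_one, LinearMap.smul_apply]; simp [Nat.cast_smul_eq_nsmul]
  simp only [Module.End.mul_apply, this, map_smul]
  simp only [L, R, LinearMap.pow_mulLeft, LinearMap.pow_mulRight, LinearMap.mulLeft_apply,
    LinearMap.mulRight_apply]
  rw [← neg_one_smul ℚ x, smul_pow, smul_mul_assoc, smul_smul, mul_comm, mul_assoc]

lemma adp_wt {A : Type} [Ring A] [Algebra ℚ A] (P Q H : A) (a c : ℚ) (hP : H * P = P * H - a • P)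
    (hQ : H * Q = Q * H - c • Q) (m : ℕ) :
    H * adp P m Q - adp P m Q * H = - (c + a * m) • adp P m Q := by
  induction m with
  | zero => simp [adp_zero, hQ]
  | succ m ih =>
    rw [adp_succ]
    generalize adp P m Q = x at ih ⊢
    have e : H * (P * x - x * P) - (P * x - x * P) * H = (H * P - P * H) * x - x * (H * P - P * H) +
      (P * (H * x - x * H) - (H * x - x * H) * P) := by noncomm_ring
    rw [e, ih, hP]
    simp only [sub_sub_cancel_left, neg_mul, mul_neg, smul_mul_assoc, mul_smul_comm]
    push_cast; module

variable {I : Type} [Fintype I] [DecidableEq I]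

structure SAlg (C : I → I → ℤ) (U : Type) [Ring U] [Algebra ℚ U] where
  f : I → U
  serre : ∀ i j, i ≠ j → adp (f i) (1 - C i j).toNat (f j) = 0
  lift : ∀ (A : Type) [Ring A] [Algebra ℚ A] (g : I → A),
    (∀ i j, i ≠ j → adp (g i) (1 - C i j).toNat (g j) = 0) → ∃ φ : U →ₐ[ℚ] A, ∀ i, φ (f i) = g i
  gen : ∀ u, u ∈ Submodule.span ℚ (Set.range fun l : List I => (l.map f).prod)

namespace SAlg
variable {C : I → I → ℤ} {U : Type} [Ring U] [Algebra ℚ U] (S : SAlg C U)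

lemma ext {M : Type} [AddCommGroup M] [Module ℚ M] (T T' : U →ₗ[ℚ] M) (h1 : T 1 = T' 1)
    (h : ∀ j u, T u = T' u → T (S.f j * u) = T' (S.f j * u)) : T = T' := by
  refine LinearMap.ext fun u => ?_
  have hu := S.gen u
  induction hu using Submodule.span_induction with
  | mem x hx =>
    obtain ⟨l, rfl⟩ := hx
    induction l with
    | nil => simpa using h1
    | cons i l ih => simpa using h i _ ih
  | zero => simp
  | add x y _ _ hx hy => simp [hx, hy]
  | smul a x _ hx => simp [hx]

lemma der {A : Type} [Ring A] [Algebra ℚ A] (ρ : U →ₐ[ℚ] A) (t : I → A)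
    (h : ∀ i j, i ≠ j → ∃ z : ℕ → A, z 0 = t j ∧ z (1 - C i j).toNat = 0 ∧
      ∀ m, z (m + 1) = ρ (S.f i) * z m - z m * ρ (S.f i) +
        (t i * adp (ρ (S.f i)) m (ρ (S.f j)) - adp (ρ (S.f i)) m (ρ (S.f j)) * t i)) :
    ∃ D : U →ₗ[ℚ] A, (∀ j, D (S.f j) = t j) ∧ ∀ u v, D (u * v) = ρ u * D v + D u * ρ v := by
  have adρ : ∀ i j m, adp (ρ (S.f i)) m (ρ (S.f j)) = ρ (adp (S.f i) m (S.f j)) := by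
    intro i j m
    induction m with
    | zero => rfl
    | succ m ih => simp [adp_succ, ih]
  obtain ⟨φ, hφ⟩ := S.lift (TrivSqZeroExt A A)
    (fun j => TrivSqZeroExt.inl (ρ (S.f j)) + TrivSqZeroExt.inr (t j)) (by
    intro i j hij
    obtain ⟨z, z0, zn, hz⟩ := h i j hij
    have key : ∀ m, adp (TrivSqZeroExt.inl (ρ (S.f i)) + TrivSqZeroExt.inr (t i)) m
        (TrivSqZeroExt.inl (ρ (S.f j)) + TrivSqZeroExt.inr (t j)) =
        (TrivSqZeroExt.inl (adp (ρ (S.f i)) m (ρ (S.f j))) + TrivSqZeroExt.inr (z m) :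
          TrivSqZeroExt A A) := by
      intro m
      induction m with
      | zero => simp [adp_zero, z0]
      | succ m ih =>
        rw [adp_succ, ih, adp_succ, hz]
        ext
        · simp
        · simp; abel
    rw [key, zn, adρ, S.serre i j hij]; simp)
  have h1 : ∀ u, (φ u).fst = ρ u := by
    intro u
    have := S.ext ((TrivSqZeroExt.fstHom ℚ A A).toLinearMap ∘ₗ φ.toLinearMap) ρ.toLinearMap
      (by simp) (fun j u hu => by
        simp at hu ⊢
        rw [hu, hφ]; simp)
    exact LinearMap.congr_fun this u
  refine ⟨(TrivSqZeroExt.sndHom A A).restrictScalars ℚ ∘ₗ φ.toLinearMap, fun j => by simp [hφ], fun u v => ?_⟩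
  simp [h1]

lemma exK : ∃ K : I → Module.End ℚ U, (∀ i, K i 1 = 0) ∧
    ∀ i j u, K i (S.f j * u) = S.f j * K i u + (C i j : ℚ) • (S.f j * u) := by
  have h : ∀ i, ∃ D : Module.End ℚ U, D 1 = 0 ∧
      ∀ j u, D (S.f j * u) = S.f j * D u + (C i j : ℚ) • (S.f j * u) := by
    intro i
    obtain ⟨D, h1, h2⟩ := S.der (AlgHom.id ℚ U) (fun j => (C i j : ℚ) • S.f j) (by
      intro p q hpq
      refine ⟨fun m => (m * C i p + C i q : ℚ) • adp (S.f p) m (S.f q), by simp [adp_zero], ?_, ?_⟩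
      · simp only [S.serre p q hpq, smul_zero]
      · intro m
        simp only [adp_succ, AlgHom.id_apply, mul_smul_comm, smul_mul_assoc, ← smul_sub, ← add_smul]
        push_cast; congr 1; ring)
    refine ⟨D, ?_, fun j u => ?_⟩
    · have := h2 1 1; simpa using this
    · have := h2 (S.f j) u; simpa [h1] using this
  choose K hK using h
  exact ⟨K, fun i => (hK i).1, fun i => (hK i).2⟩

noncomputable def Kd : I → Module.End ℚ U := S.exK.choose
lemma Kd_one (i : I) : S.Kd i 1 = 0 := S.exK.choose_spec.1 i
lemma Kd_f (i j : I) (u : U) : S.Kd i (S.f j * u) = S.f j * S.Kd i u + (C i j : ℚ) • (S.f j * u) :=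
  S.exK.choose_spec.2 i j u

noncomputable def h (i : I) (la : I → ℚ) : Module.End ℚ U := la i • 1 - S.Kd i

noncomputable def L (u : U) (_ : I → ℚ) : Module.End ℚ U := LinearMap.mulLeft ℚ u

lemma h_one (i : I) (la : I → ℚ) : S.h i la 1 = la i • 1 := by simp [h, Kd_one]
lemma h_f (i j : I) (la : I → ℚ) (u : U) :
    S.h i la (S.f j * u) = S.f j * S.h i la u - (C i j : ℚ) • (S.f j * u) := by
  simp only [h, LinearMap.sub_apply, LinearMap.smul_apply, Module.End.one_apply, Kd_f, mul_sub,
    mul_smul_comm]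
  abel

variable (hC : ∀ i, C i i = 2) (hs : ∀ i j, C i j = C j i) (ho : ∀ i j, i ≠ j → C i j ≤ 0)

include hC hs ho in
lemma exe (i : I) (la : I → ℚ) : ∃ e : Module.End ℚ U, e 1 = 0 ∧
    ∀ j u, e (S.f j * u) = S.f j * e u + if j = i then S.h i la u else 0 := by
  obtain ⟨ρ, hL⟩ : ∃ ρ : U →ₐ[ℚ] Module.End ℚ U, ∀ u v, ρ u v = u * v := ⟨Algebra.lmul ℚ U, fun _ _ => rfl⟩
  have hLL : ∀ j, S.h i la * ρ (S.f j) = ρ (S.f j) * S.h i la - (C i j : ℚ) • ρ (S.f j) := by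
    intro j; ext u; simp [hL, h_f]
  obtain ⟨D, h1, h2⟩ := S.der ρ (fun j => if j = i then S.h i la else 0) (by
    intro p q hpq
    by_cases hp : p = i
    · subst hp
      have hx := fun m => adp_wt _ _ _ _ _ (hLL p) (hLL q) m
      refine ⟨fun m => - (m * (C p q + m - 1) : ℚ) •
        adp (ρ (S.f p)) (m - 1) (ρ (S.f q)), by simp [hpq.symm], ?_, ?_⟩
      · have h3 := ho p q hpq
        have : ((1 - C p q).toNat : ℚ) = 1 - C p q := by
          have : ((1 - C p q).toNat : ℤ) = 1 - C p q := Int.toNat_of_nonneg (by omega)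
          exact_mod_cast this
        simp only [this]; simp
      · intro m
        simp only [if_true, hx, hC]
        rcases m with _ | m
        · simp; module
        · simp only [Nat.add_sub_cancel, adp_succ, mul_smul_comm, smul_mul_assoc]
          push_cast; module
    · by_cases hq : q = i
      · subst hq
        refine ⟨fun m => if m = 0 then S.h q la else if m = 1 then (C q p : ℚ) • ρ (S.f p) else 0,
          by simp, ?_, ?_⟩
        · have h3 := ho p q hpq
          have h4 := hs p q
          by_cases h5 : C p q = 0
          · simp [← h4, h5]
          · have : (1 - C p q).toNat ≠ 0 ∧ (1 - C p q).toNat ≠ 1 := by omega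
            simp [this]
        · intro m
          rcases m with _ | _ | m
          · simp [hp, hLL]
          · simp [hp]
          · simp [hp]
      · exact ⟨fun _ => 0, by simp [hq], rfl, fun m => by simp [hp]⟩)
  refine ⟨LinearMap.applyₗ (1 : U) ∘ₗ D, ?_, fun j u => ?_⟩
  · have := h2 1 1; simp at this; simp [this]
  · simp only [LinearMap.comp_apply, h2, h1]
    by_cases hj : j = i <;> simp [hj, hL]

end SAlg
end
end KS

namespace KS
open Finset
set_option linter.unusedSectionVars false
section
variable {I : Type} [Fintype I] [DecidableEq I]

structure Chev (C : I → I → ℤ) (G : Type) [LieRing G] [LieAlgebra ℚ G] where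
  e : I → G
  f : I → G
  h : I → G
  ψ : G →ₗ[ℚ] ℚ
  ef : ∀ i j, ⁅e i, f j⁆ = if i = j then h i else 0
  he : ∀ i j, ⁅h i, e j⁆ = (C i j : ℚ) • e j
  hf : ∀ i j, ⁅h i, f j⁆ = -(C i j : ℚ) • f j
  ψh : ∀ i, ψ (h i) = 1
  inj : ∀ s : I → ℚ, ∑ i, s i • h i = 0 → s = 0

namespace Chev
variable {C : I → I → ℤ} {G : Type} [LieRing G] [LieAlgebra ℚ G]

def swap (K : Chev C G) : Chev C G where
  e := K.f
  f := K.e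
  h := fun i => - K.h i
  ψ := - K.ψ
  ef i j := by
    rw [← lie_skew, K.ef]; by_cases h : i = j <;> simp [h, eq_comm]
  he i j := by simp [K.hf]
  hf i j := by simp [K.he]
  ψh i := by simp [K.ψh]
  inj s hs := K.inj s (by simpa using hs)

noncomputable def n (K : Chev C G) : ℕ → (I → ℤ) → Submodule ℚ G
  | 0, γ => ⨆ i, if γ = al i then Submodule.span ℚ {K.e i} else ⊥
  | k + 1, γ => ⨆ i, (n K k (γ - al i)).map (LieAlgebra.ad ℚ G (K.e i) : G →ₗ[ℚ] G)

noncomputable def sh (K : Chev C G) (γ : I → ℤ) : G := ∑ i, (γ i : ℚ) • K.h i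

variable (K : Chev C G)

lemma sh_sub (γ δ : I → ℤ) : K.sh (γ - δ) = K.sh γ - K.sh δ := by
  simp [sh, sub_smul, sum_sub_distrib]
lemma sh_al (i : I) : K.sh (al i) = K.h i := by
  simp [sh, al, Pi.single_apply]
lemma swap_swap : K.swap.swap = K := by
  cases K; simp [swap]
lemma ψsh (γ : I → ℤ) : K.ψ (K.sh γ) = ∑ i, (γ i : ℚ) := by simp [sh, K.ψh]

lemma n_zero_mem {γ : I → ℤ} {x : G} (hx : x ∈ K.n 0 γ) : x = 0 ∨
    ∃ i, ∃ a : ℚ, γ = al i ∧ x = a • K.e i := by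
  by_cases h : ∃ i, γ = al i
  · obtain ⟨i, rfl⟩ := h
    right
    have : K.n 0 (al i) ≤ Submodule.span ℚ {K.e i} := by
      refine iSup_le fun j => ?_
      split_ifs with h
      · have : i = j := by
          by_contra hij
          have := congrFun h i
          simp [al, hij] at this
        rw [this]
      · exact bot_le
    obtain ⟨a, ha⟩ := Submodule.mem_span_singleton.1 (this hx)
    exact ⟨i, a, rfl, ha.symm⟩
  · left
    have : K.n 0 γ ≤ ⊥ := iSup_le fun j => by
      rw [if_neg fun h' => h ⟨j, h'⟩]
    simpa using this hx

lemma n_al {i : I} {x : G} (hx : x ∈ K.n 0 (al i)) : ∃ a : ℚ, x = a • K.e i := by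
  rcases K.n_zero_mem hx with rfl | ⟨j, a, hj, rfl⟩
  · exact ⟨0, by simp⟩
  · have : i = j := by
      by_contra hij
      have := congrFun hj i
      simp [al, hij] at this
    exact ⟨a, by rw [this]⟩

lemma e_mem (i : I) : K.e i ∈ K.n 0 (al i) := by
  refine Submodule.mem_iSup_of_mem i ?_
  simp [Submodule.mem_span_singleton_self]

lemma br_mem {k : ℕ} {γ δ : I → ℤ} (i : I) {x : G} (hx : x ∈ K.n k γ) (h : γ + al i = δ) :
    ⁅K.e i, x⁆ ∈ K.n (k + 1) δ := by
  subst h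
  refine Submodule.mem_iSup_of_mem i ⟨x, by simpa using hx, by simp⟩

lemma n_ind {k : ℕ} {γ : I → ℤ} {p : G → Prop} {x : G} (hx : x ∈ K.n (k + 1) γ) (h0 : p 0)
    (ha : ∀ x y, p x → p y → p (x + y)) (h : ∀ i, ∀ y ∈ K.n k (γ - al i), p ⁅K.e i, y⁆) : p x := by
  refine Submodule.iSup_induction _ (motive := p) hx ?_ h0 ha
  rintro i _ ⟨y, hy, rfl⟩
  exact h i y hy

lemma n_ht (k : ℕ) : ∀ (γ : I → ℤ) (x : G), x ∈ K.n k γ → x ≠ 0 → 0 ≤ γ ∧ ∑ i, γ i = k + 1 := by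
  induction k with
  | zero =>
    intro γ x hx h0
    rcases K.n_zero_mem hx with rfl | ⟨j, a, rfl, rfl⟩
    · exact absurd rfl h0
    · exact ⟨Pi.single_nonneg.2 zero_le_one, by simp [al]⟩
  | succ k ih =>
    intro γ x hx
    refine K.n_ind (p := fun x => x ≠ 0 → 0 ≤ γ ∧ ∑ i, γ i = (k + 1 : ℕ) + 1) hx (by simp) ?_ ?_
    · intro x y h1 h2 h
      by_cases hx : x = 0
      · subst hx; simp at h; exact h2 h
      · exact h1 hx
    · intro i y hy h
      have := ih _ y hy (by rintro rfl; simp at h)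
      constructor
      · have h3 : (0 : I → ℤ) ≤ al i := Pi.single_nonneg.2 zero_le_one
        have := add_nonneg this.1 h3; simpa using this
      · have := this.2
        simp [sum_sub_distrib, al] at this
        push_cast; linarith

lemma h_n (k : ℕ) : ∀ (γ : I → ℤ) (x : G), x ∈ K.n k γ → ∀ i, ⁅K.h i, x⁆ = (pr C i γ : ℚ) • x := by
  induction k with
  | zero =>
    intro γ x hx i
    rcases K.n_zero_mem hx with rfl | ⟨j, a, rfl, rfl⟩
    · simp
    · rw [lie_smul, K.he, pr_al, smul_comm]
  | succ k ih =>
    intro γ x hx i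
    refine K.n_ind (p := fun x => ⁅K.h i, x⁆ = (pr C i γ : ℚ) • x) hx (by simp) ?_ ?_
    · intro x y h1 h2; simp [h1, h2]
    · intro j y hy
      rw [leibniz_lie, K.he, ih _ y hy, pr_sub, pr_al, lie_smul, smul_lie, ← add_smul]
      push_cast; congr 1; ring

lemma br_f (k : ℕ) : ∀ (γ : I → ℤ) (x : G), x ∈ K.n (k + 1) γ → ∀ j, ⁅x, K.f j⁆ ∈ K.n k (γ - al j) := by
  induction k with
  | zero =>
    intro γ x hx j
    refine K.n_ind (p := fun x => ⁅x, K.f j⁆ ∈ K.n 0 (γ - al j)) hx (by simp) ?_ ?_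
    · intro x y h1 h2; rw [add_lie]; exact add_mem h1 h2
    · intro i y hy
      rw [lie_lie, K.ef]
      refine sub_mem ?_ ?_
      · rcases K.n_zero_mem hy with rfl | ⟨m, a, hm, rfl⟩
        · simp
        · rw [smul_lie, K.ef]
          split_ifs with hmj
          · subst hmj
            rw [lie_smul, ← lie_skew, K.he, eq_add_of_sub_eq hm, add_sub_cancel_left]
            exact Submodule.smul_mem _ _ (neg_mem (Submodule.smul_mem _ _ (K.e_mem i)))
          · simp
      · split_ifs with hij
        · subst hij
          rw [← lie_skew, K.h_n _ _ _ hy]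
          exact neg_mem (Submodule.smul_mem _ _ hy)
        · simp
  | succ k ih =>
    intro γ x hx j
    refine K.n_ind (p := fun x => ⁅x, K.f j⁆ ∈ K.n (k + 1) (γ - al j)) hx (by simp) ?_ ?_
    · intro x y h1 h2; rw [add_lie]; exact add_mem h1 h2
    · intro i y hy
      rw [lie_lie, K.ef]
      refine sub_mem (K.br_mem i (ih _ _ hy j) (by abel)) ?_
      split_ifs with hij
      · subst hij
        rw [← lie_skew, K.h_n _ _ _ hy]
        exact neg_mem (Submodule.smul_mem _ _ hy)
      · simp

lemma br_e {k : ℕ} {γ : I → ℤ} {y : G} (hy : y ∈ K.swap.n (k + 1) γ) (j : I) :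
    ⁅K.e j, y⁆ ∈ K.swap.n k (γ - al j) := by
  rw [← lie_skew]; exact neg_mem (K.swap.br_f k γ y hy j)

lemma br_low (k : ℕ) : ∀ (m : ℕ) (γ δ : I → ℤ) (x y : G), x ∈ K.n k γ → y ∈ K.swap.n (k + m + 1) δ →
    ⁅x, y⁆ ∈ K.swap.n m (δ - γ) := by
  induction k with
  | zero =>
    intro m γ δ x y hx hy
    rcases K.n_zero_mem hx with rfl | ⟨j, a, rfl, rfl⟩
    · simp
    · rw [smul_lie]; rw [Nat.zero_add] at hy; exact Submodule.smul_mem _ _ (K.br_e hy j)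
  | succ k ih =>
    intro m γ δ x y hx hy
    refine K.n_ind (p := fun x => ⁅x, y⁆ ∈ K.swap.n m (δ - γ)) hx (by simp) ?_ ?_
    · intro x y h1 h2; rw [add_lie]; exact add_mem h1 h2
    · intro i x' hx'
      rw [lie_lie]
      rw [show k + 1 + m + 1 = k + m + 1 + 1 by ring] at hy
      have h1 := K.br_e (ih (m + 1) _ δ x' y hx' hy) i
      have h2 := ih m _ _ x' _ hx' (K.br_e hy i)
      rw [show δ - (γ - al i) - al i = δ - γ by abel] at h1
      rw [show δ - al i - (γ - al i) = δ - γ by abel] at h2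
      exact sub_mem h1 h2

lemma br_ne (k : ℕ) : ∀ (γ δ : I → ℤ) (x y : G), γ ≠ δ → x ∈ K.n k γ → y ∈ K.swap.n k δ →
    ⁅x, y⁆ = 0 := by
  induction k with
  | zero =>
    intro γ δ x y hn hx hy
    rcases K.n_zero_mem hx with rfl | ⟨i, a, rfl, rfl⟩
    · simp
    rcases K.swap.n_zero_mem hy with rfl | ⟨j, b, rfl, rfl⟩
    · simp
    have : ⁅K.e i, K.swap.e j⁆ = 0 := (K.ef i j).trans (if_neg (by rintro rfl; exact hn rfl))
    simp [this]
  | succ k ih =>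
    intro γ δ x y hn hx hy
    refine K.n_ind (p := fun x => ⁅x, y⁆ = 0) hx (by simp) ?_ ?_
    · intro x y h1 h2; rw [add_lie, h1, h2, add_zero]
    · intro i x' hx'
      rw [lie_lie, ih _ _ x' _ _ hx' (K.br_e hy i), sub_zero]
      · rcases K.swap.n_zero_mem (K.br_low k 0 _ δ x' y hx' hy) with h | ⟨j, b, hj, h⟩
        · simp [h]
        · have : ⁅K.e i, K.swap.e j⁆ = 0 := (K.ef i j).trans (if_neg (by
            rintro rfl; apply hn; rw [sub_eq_iff_eq_add] at hj; rw [hj]; abel))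
          rw [h, lie_smul, this, smul_zero]
      · exact fun h => hn (sub_left_injective h)

def P (k : ℕ) : Prop := ∀ γ x y, x ∈ K.n k γ → y ∈ K.swap.n k γ → ∃ s : ℚ, ⁅x, y⁆ = s • K.sh γ
def R (k : ℕ) : Prop := ∀ γ i x y, x ∈ K.n k γ → y ∈ K.swap.n (k + 1) (γ + al i) →
  ∃ s : ℚ, ⁅x, y⁆ = -s • K.f i ∧ ⁅x, ⁅K.e i, y⁆⁆ = s • K.sh γ

lemma P0 : K.P 0 := by
  intro γ x y hx hy
  rcases K.n_zero_mem hx with rfl | ⟨i, a, rfl, rfl⟩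
  · exact ⟨0, by simp⟩
  obtain ⟨b, rfl⟩ := K.swap.n_al hy
  refine ⟨a * b, ?_⟩
  have : ⁅K.e i, K.swap.e i⁆ = K.h i := (K.ef i i).trans (if_pos rfl)
  rw [sh_al, smul_lie, lie_smul, this, smul_smul]

lemma P_of_R {k : ℕ} (h : K.R k) : K.P (k + 1) := by
  intro γ x y hx hy
  refine K.n_ind (p := fun x => ∃ s : ℚ, ⁅x, y⁆ = s • K.sh γ) hx ⟨0, by simp⟩ ?_ ?_
  · rintro x y ⟨s, hs⟩ ⟨t, ht⟩; exact ⟨s + t, by rw [add_lie, hs, ht, add_smul]⟩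
  · intro i x' hx'
    obtain ⟨s, h1, h2⟩ := h _ i x' y hx' (by simpa using hy)
    refine ⟨-s, ?_⟩
    rw [lie_lie, h1, h2, lie_smul, K.ef, if_pos rfl, sh_sub, sh_al]
    module

lemma R0 (hs : ∀ i j, C i j = C j i) : K.R 0 := by
  intro γ i x y hx hy
  rcases K.n_zero_mem hx with rfl | ⟨k, a, rfl, rfl⟩
  · exact ⟨0, by simp⟩
  refine K.swap.n_ind (p := fun y => ∃ s : ℚ, ⁅a • K.e k, y⁆ = -s • K.f i ∧
    ⁅a • K.e k, ⁅K.e i, y⁆⁆ = s • K.sh (al k)) hy ⟨0, by simp⟩ ?_ ?_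
  · rintro x y ⟨s, h1, h2⟩ ⟨t, h3, h4⟩
    refine ⟨s + t, ?_, ?_⟩
    · rw [lie_add, h1, h3]; module
    · rw [lie_add, lie_add, h2, h4]; module
  intro j z hz
  rcases K.swap.n_zero_mem hz with rfl | ⟨m, b, hm, rfl⟩
  · exact ⟨0, by simp⟩
  have key : ∀ p q : I, p ≠ q → ⁅K.e p, ⁅K.f p, K.f q⁆⁆ = -(C p q : ℚ) • K.f q := by
    intro p q hpq
    rw [leibniz_lie, K.ef, K.ef, if_pos rfl, if_neg hpq, K.hf]; simp
  change ∃ s : ℚ, ⁅a • K.e k, ⁅K.f j, b • K.f m⁆⁆ = -s • K.f i ∧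
    ⁅a • K.e k, ⁅K.e i, ⁅K.f j, b • K.f m⁆⁆⁆ = s • K.sh (al k)
  by_cases hjm : j = m
  · subst hjm; exact ⟨0, by simp⟩
  rw [sub_eq_iff_eq_add] at hm
  have hjk : (j = k ∧ m = i) ∨ (j = i ∧ m = k) := by
    have h1 := congrFun hm j
    have h2 := congrFun hm m
    simp [al, Pi.single_apply, hjm, Ne.symm hjm] at h1 h2
    split_ifs at h1 h2 <;> simp_all <;> omega
  rcases hjk with ⟨rfl, rfl⟩ | ⟨rfl, rfl⟩
  · refine ⟨a * b * C j m, ?_, ?_⟩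
    · rw [lie_smul, smul_lie, lie_smul, key _ _ hjm]; module
    · rw [← lie_skew (K.f j), lie_neg, lie_neg, smul_lie, smul_lie, lie_smul, lie_smul, key _ _ (Ne.symm hjm),
        lie_smul, K.ef, if_pos rfl, sh_al, hs m j]; module
  · refine ⟨-(a * b * C j m), ?_, ?_⟩
    · rw [← lie_skew (K.f j), lie_neg, smul_lie, smul_lie, lie_smul, key _ _ (Ne.symm hjm), hs m j]; module
    · rw [smul_lie, lie_smul, lie_smul, lie_smul, key _ _ hjm, lie_smul, K.ef, if_pos rfl, sh_al]; module

lemma cmp {k : ℕ} (h0 : K.P k) (h1 : K.P (k + 1)) {γ : I → ℤ} {j : I} {x z : G} (hx : x ∈ K.n (k + 1) γ)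
    (hz : z ∈ K.swap.n k (γ - al j)) :
    ∃ s : ℚ, ⁅x, ⁅K.f j, z⁆⁆ = s • K.sh γ ∧ ⁅⁅x, K.f j⁆, z⁆ = s • K.sh (γ - al j) := by
  by_cases hx0 : x = 0
  · exact ⟨0, by simp [hx0]⟩
  obtain ⟨hγ, hht⟩ := K.n_ht _ _ _ hx hx0
  obtain ⟨s, hs⟩ := h1 γ x ⁅K.f j, z⁆ hx (K.swap.br_mem j hz (by abel))
  obtain ⟨t, ht⟩ := h0 _ _ z (K.br_f k γ x hx j) hz
  have hxz : ∃ c : ℚ, ⁅x, z⁆ = c • K.e j := by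
    have hx2 : x ∈ K.swap.swap.n (k + 0 + 1) γ := by rw [swap_swap]; exact hx
    have := K.swap.br_low k 0 _ _ z x hz hx2
    rw [swap_swap, sub_sub_cancel] at this
    obtain ⟨c, hc⟩ := K.n_al this
    exact ⟨-c, by rw [← lie_skew, hc]; module⟩
  obtain ⟨c, hc⟩ := hxz
  have e : s • K.sh γ = t • K.sh (γ - al j) - c • K.h j := by
    rw [← hs, leibniz_lie, ht, hc, lie_smul, ← lie_skew, K.ef, if_pos rfl, smul_neg]; abel
  by_cases hm : ∃ m, m ≠ j ∧ γ m ≠ 0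
  · obtain ⟨m, hmj, hm⟩ := hm
    have e2 := K.inj (fun i => s * γ i - t * ((γ - al j) i : ℤ) + c * (al j i : ℤ)) (by
      rw [← sub_eq_zero, ← K.sh_al j] at e
      rw [← e]
      simp only [sh, smul_sum, ← sum_sub_distrib]
      refine sum_congr rfl fun i _ => ?_
      module)
    have e3 := congrFun e2 m
    simp [al, hmj] at e3
    have : s = t := by
      have h4 : (γ m : ℚ) ≠ 0 := by exact_mod_cast hm
      apply mul_right_cancel₀ h4; linarith
    subst this
    exact ⟨s, hs, ht⟩
  · exfalso
    push Not at hm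

    have hbot : ∀ (k : ℕ) (γ : I → ℤ) x, (∀ m, m ≠ j → γ m = 0) → x ∈ K.n (k + 1) γ → x = 0 := by
      intro k
      induction k with
      | zero =>
        intro γ x hm hx
        refine K.n_ind (p := fun x => x = 0) hx rfl (by rintro x y rfl rfl; simp) ?_
        intro i y hy
        rcases K.n_zero_mem hy with rfl | ⟨m, a, hm', rfl⟩
        · simp
        · have hi : i = j := by
            by_contra hcon
            have h1 := congrFun hm' i
            simp [al, Pi.single_apply, hm i hcon] at h1
            split_ifs at h1 <;> omega
          have hi2 : m = j := by
            by_contra hcon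
            have h1 := congrFun hm' m
            simp [al, Pi.single_apply, hm m hcon, hi, hcon] at h1
          rw [hi, hi2, lie_smul, lie_self, smul_zero]
      | succ k ih =>
        intro γ x hm hx
        refine K.n_ind (p := fun x => x = 0) hx rfl (by rintro x y rfl rfl; simp) ?_
        intro i y hy
        by_cases hij : i = j
        · rw [ih _ y _ hy, lie_zero]
          subst hij
          intro m hmi; simp [hm m hmi, al, hmi]
        · by_cases hy0 : y = 0
          · simp [hy0]
          have h1 := (K.n_ht _ _ _ hy hy0).1 i
          have h2 := hm i hij
          simp [al, h2] at h1
    exact hx0 (hbot k γ x hm hx)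

lemma sh_inj {k : ℕ} {γ : I → ℤ} (hh : ∑ i, γ i = k + 1) {s t : ℚ} (h : s • K.sh γ = t • K.sh γ) : s = t := by
  have := congrArg K.ψ h
  simp only [map_smul, ψsh, smul_eq_mul] at this
  have h2 : (∑ i, (γ i : ℚ)) = k + 1 := by exact_mod_cast hh
  rw [h2] at this
  have : (s - t) * ((k : ℚ) + 1) = 0 := by linarith
  rcases mul_eq_zero.1 this with h | h
  · linarith
  · exact absurd h (by positivity)

lemma R_succ (hs : ∀ i j, C i j = C j i) {k : ℕ} (h0 : K.P k) (h1 : K.P (k + 1)) (h2 : K.R k) : K.R (k + 1) := by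
  intro γ i x y hx hy
  refine K.swap.n_ind (p := fun y => ∃ s : ℚ, ⁅x, y⁆ = -s • K.f i ∧
    ⁅x, ⁅K.e i, y⁆⁆ = s • K.sh γ) hy ⟨0, by simp⟩ ?_ ?_
  · rintro y y' ⟨s, h1, h2⟩ ⟨t, h3, h4⟩
    refine ⟨s + t, ?_, ?_⟩
    · rw [lie_add, h1, h3]; module
    · rw [lie_add, lie_add, h2, h4]; module
  intro j y' hy'
  change ∃ s : ℚ, ⁅x, ⁅K.f j, y'⁆⁆ = -s • K.f i ∧ ⁅x, ⁅K.e i, ⁅K.f j, y'⁆⁆⁆ = s • K.sh γ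
  by_cases hx0 : x = 0
  · exact ⟨0, by simp [hx0]⟩
  obtain ⟨hγ, hht⟩ := K.n_ht _ _ _ hx hx0
  have hz := K.br_e hy' i
  rw [show γ + al i - al j - al i = γ - al j by abel] at hz
  obtain ⟨s, hs1, hs2⟩ := K.cmp h0 h1 hx hz
  obtain ⟨t, ht1, ht2⟩ := h2 _ i _ y' (K.br_f k γ x hx j) (by
    rwa [show γ - al j + al i = γ + al i - al j by abel])
  have hst : s = t := K.sh_inj (γ := γ - al j) (k := k) (by
    simp [sum_sub_distrib, al]; push_cast at hht; linarith) (hs2.symm.trans ht2)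
  subst hst
  by_cases hij : i = j
  · subst hij
    rw [add_sub_cancel_right] at hy'
    obtain ⟨q, hq⟩ := h1 γ x y' hx hy'
    have e1 : ⁅K.sh γ, K.f i⁆ = -(∑ m, (γ m : ℚ) * C m i) • K.f i := by
      simp only [sh, sum_lie, smul_lie, K.hf, neg_smul, ← sum_neg_distrib, sum_smul, mul_smul, smul_neg]
    have e2 : ⁅K.h i, y'⁆ = -(pr C i γ : ℚ) • y' := by
      have := K.swap.h_n _ _ _ hy' i
      change ⁅-K.h i, y'⁆ = _ at this
      rw [neg_lie, neg_eq_iff_eq_neg] at this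
      rw [this, neg_smul]
    refine ⟨s - q * ∑ m, (γ m : ℚ) * C m i, ?_, ?_⟩
    · rw [leibniz_lie, ht1, hq, lie_smul, ← lie_skew, e1]; module
    · rw [leibniz_lie (K.e i), K.ef, if_pos rfl, e2, lie_add, hs1, lie_smul, hq]
      have : (pr C i γ : ℚ) = ∑ m, (γ m : ℚ) * C m i := by
        simp only [pr, hs i]; push_cast; exact sum_congr rfl fun _ _ => mul_comm _ _
      rw [this]; module
  · refine ⟨s, ?_, ?_⟩
    · rw [leibniz_lie, ht1, K.br_ne _ γ _ x y' _ hx hy', lie_zero, add_zero]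
      intro h
      have := congrFun h i
      simp [al, hij] at this
    · rw [leibniz_lie (K.e i), K.ef, if_neg hij, zero_lie, zero_add, hs1]

lemma allP (hs : ∀ i j, C i j = C j i) (k : ℕ) : K.P k ∧ K.R k := by
  induction k with
  | zero => exact ⟨K.P0, K.R0 hs⟩
  | succ k ih => exact ⟨K.P_of_R ih.2, K.R_succ hs ih.1 (K.P_of_R ih.2) ih.2⟩

noncomputable def bf (k : ℕ) (x y : G) : ℚ := K.ψ ⁅x, y⁆ / (k + 1)

lemma lie_eq (hs : ∀ i j, C i j = C j i) {k : ℕ} {γ : I → ℤ} {x y : G} (hx : x ∈ K.n k γ)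
    (hy : y ∈ K.swap.n k γ) : ⁅x, y⁆ = K.bf k x y • K.sh γ := by
  by_cases hx0 : x = 0
  · simp [hx0, bf]
  obtain ⟨hγ, hht⟩ := K.n_ht _ _ _ hx hx0
  obtain ⟨s, h⟩ := (K.allP hs k).1 γ x y hx hy
  have h2 : (∑ i, (γ i : ℚ)) = k + 1 := by exact_mod_cast hht
  have : ((k : ℚ) + 1) ≠ 0 := by positivity
  rw [h, bf, h, map_smul, ψsh, h2, smul_eq_mul, mul_div_cancel_right₀ _ this]

lemma bf_inv (hs : ∀ i j, C i j = C j i) {k : ℕ} {γ : I → ℤ} {j : I} {x z : G} (hx : x ∈ K.n (k + 1) γ)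
    (hz : z ∈ K.swap.n k (γ - al j)) : K.bf (k + 1) x ⁅K.f j, z⁆ = K.bf k ⁅x, K.f j⁆ z := by
  by_cases hx0 : x = 0
  · simp [hx0, bf]
  obtain ⟨hγ, hht⟩ := K.n_ht _ _ _ hx hx0
  obtain ⟨s, h1, h2⟩ := K.cmp (K.allP hs k).1 (K.allP hs (k + 1)).1 hx hz
  have e1 := K.lie_eq hs hx (K.swap.br_mem j hz (by abel))
  have e2 := K.lie_eq hs (K.br_f k γ x hx j) hz
  have a1 := K.sh_inj hht (e1.symm.trans h1)
  have a2 := K.sh_inj (k := k) (by simp [sum_sub_distrib, al]; push_cast at hht; linarith) (e2.symm.trans h2)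
  exact a1.trans a2.symm

end Chev
end
end KS

namespace KS
open Finset
set_option linter.unusedSectionVars false
section
variable {I : Type} [Fintype I] [DecidableEq I]

structure GCM (C : I → I → ℤ) : Prop where
  d : ∀ i, C i i = 2
  s : ∀ i j, C i j = C j i
  o : ∀ i j, i ≠ j → C i j ≤ 0

def cnt (l : List I) (i : I) : ℤ := l.count i
lemma cnt_nil : cnt ([] : List I) = 0 := by ext; simp [cnt]
lemma cnt_cons (j : I) (l : List I) : cnt (j :: l) = cnt l + al j := by
  ext i; by_cases h : j = i
  · simp [cnt, al, h]
  · simp [cnt, al, h, Ne.symm h]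

abbrev EE (I U : Type) [Ring U] [Algebra ℚ U] := (I → ℚ) → Module.End ℚ U
instance (I U : Type) [Ring U] [Algebra ℚ U] : LieRing (EE I U) := LieRing.ofAssociativeRing
instance (I U : Type) [Ring U] [Algebra ℚ U] : LieAlgebra ℚ (EE I U) := LieAlgebra.ofAssociativeAlgebra

namespace SAlg
variable {C : I → I → ℤ} {U : Type} [Ring U] [Algebra ℚ U] (S : SAlg C U) (hG : GCM C)

lemma lie_app (x y : EE I U) (la : I → ℚ) (u : U) : ⁅x, y⁆ la u = x la (y la u) - y la (x la u) := rfl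

noncomputable def e (i : I) (la : I → ℚ) : Module.End ℚ U := (S.exe hG.d hG.s hG.o i la).choose
lemma e_one (i : I) (la : I → ℚ) : S.e hG i la 1 = 0 := (S.exe hG.d hG.s hG.o i la).choose_spec.1
lemma e_f (i : I) (la : I → ℚ) (j : I) (u : U) :
    S.e hG i la (S.f j * u) = S.f j * S.e hG i la u + if j = i then S.h i la u else 0 :=
  (S.exe hG.d hG.s hG.o i la).choose_spec.2 j u

include hG in
lemma exaug : ∃ φ : U →ₐ[ℚ] ℚ, ∀ i, φ (S.f i) = 0 := S.lift ℚ (fun _ => 0) (by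
  intro i j hij
  generalize (1 - C i j).toNat = n
  induction n with
  | zero => rfl
  | succ n ih => rw [adp_succ, ih]; simp)
noncomputable def aug : U →ₐ[ℚ] ℚ := (S.exaug hG).choose
lemma hh (i j : I) (la : I → ℚ) (u : U) : S.h i la (S.h j la u) = S.h j la (S.h i la u) := by
  have := S.ext (S.h i la * S.h j la) (S.h j la * S.h i la) (by simp only [Module.End.mul_apply, h_one, map_smul]; rw [smul_comm]) (by
    intro k u hu
    simp only [Module.End.mul_apply, h_f, map_sub, map_smul] at hu ⊢
    rw [hu]; module)
  exact LinearMap.congr_fun this u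

noncomputable def K : Chev C (EE I U) where
  e := S.e hG
  f := fun i => L (S.f i)
  h := S.h
  ψ := (S.aug hG).toLinearMap ∘ₗ LinearMap.applyₗ (1 : U) ∘ₗ LinearMap.proj (fun _ => (1 : ℚ))
  ef i j := by
    funext la; ext u
    rw [lie_app]
    simp only [L, LinearMap.mulLeft_apply, e_f]
    by_cases hij : j = i
    · subst hij; simp
    · simp [hij, Ne.symm hij]
  he i j := by
    funext la
    refine S.ext _ _ ?_ ?_
    · rw [lie_app]; simp [e_one, h_one]
    · intro k u hu
      rw [lie_app] at hu ⊢
      simp only [Pi.smul_apply, LinearMap.smul_apply, e_f, map_add, h_f, map_sub, map_smul] at hu ⊢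
      have hu' := eq_add_of_sub_eq hu
      rw [hu', mul_add, smul_add]
      by_cases hk : k = j
      · subst hk
        simp only [if_true, S.hh i k]; rw [mul_smul_comm]; module
      · simp only [hk, if_false, map_zero]; rw [mul_smul_comm]; module
  hf i j := by
    funext la; ext u
    rw [lie_app]
    simp [L, h_f]
  ψh i := by
    simp [h_one]
  inj s hs := by
    ext k
    have := congrArg (fun a : EE I U => S.aug hG (a (Pi.single k 1) 1)) hs
    simpa [h_one, Pi.single_apply] using this

noncomputable def F (l : List I) : U := (l.map S.f).prod
lemma F_nil : S.F [] = 1 := rfl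
lemma F_cons (i : I) (l : List I) : S.F (i :: l) = S.f i * S.F l := by simp [F]

noncomputable def G (ν : I → ℤ) : Submodule ℚ U := Submodule.span ℚ {u | ∃ l, cnt l = ν ∧ u = S.F l}

instance (ν : I → ℤ) : FiniteDimensional ℚ (S.G ν) := by
  refine FiniteDimensional.span_of_finite ℚ (Set.Finite.subset
    ((List.finite_length_eq I (∑ i, ν i).toNat).image S.F) ?_)
  rintro u ⟨l, rfl, rfl⟩
  refine ⟨l, ?_, rfl⟩
  have : (∑ i, l.count i) = l.length := by
    rw [← Multiset.coe_card, ← Multiset.sum_count_eq_card (s := univ) (by simp)]; simp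
  simp [cnt, ← Nat.cast_sum, this]

lemma G_ind {p : U → Prop} {ν : I → ℤ} {u : U} (hu : u ∈ S.G ν) (h0 : p 0) (ha : ∀ x y, p x → p y → p (x + y))
    (hs : ∀ (a : ℚ) x, p x → p (a • x)) (hl : ∀ l, cnt l = ν → p (S.F l)) : p u := by
  induction hu using Submodule.span_induction with
  | mem x hx => obtain ⟨l, h1, rfl⟩ := hx; exact hl l h1
  | zero => exact h0
  | add x y _ _ hx hy => exact ha x y hx hy
  | smul a x _ hx => exact hs a x hx

lemma F_mem (l : List I) : S.F l ∈ S.G (cnt l) := Submodule.subset_span ⟨l, rfl, rfl⟩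
lemma G_f {ν : I → ℤ} {u : U} (hu : u ∈ S.G ν) (j : I) : S.f j * u ∈ S.G (ν + al j) := by
  refine S.G_ind (p := fun u => S.f j * u ∈ S.G (ν + al j)) hu (by simp) ?_ ?_ ?_
  · intro x y hx hy; rw [mul_add]; exact add_mem hx hy
  · intro a x hx; rw [mul_smul_comm]; exact Submodule.smul_mem _ _ hx
  · rintro l rfl; rw [← F_cons, ← cnt_cons]; exact S.F_mem _

lemma G_bot {ν : I → ℤ} (h : ¬ 0 ≤ ν) : S.G ν = ⊥ := by
  refine Submodule.span_eq_bot.2 ?_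
  rintro u ⟨l, rfl, rfl⟩
  exact absurd (fun i => by simp [cnt]) h

lemma Kd_G (i : I) {ν : I → ℤ} {u : U} (hu : u ∈ S.G ν) : S.Kd i u = (pr C i ν : ℚ) • u := by
  refine S.G_ind (p := fun u => S.Kd i u = (pr C i ν : ℚ) • u) hu (by simp) ?_ ?_ ?_
  · intro x y hx hy; rw [map_add, hx, hy, smul_add]
  · intro a x hx; rw [map_smul, hx, smul_comm]
  · rintro l rfl
    clear hu
    induction l with
    | nil => simp [F_nil, Kd_one, cnt_nil, pr_zero]
    | cons j l ih =>
      rw [F_cons, Kd_f, ih, cnt_cons, pr_add, pr_al, mul_smul_comm, ← add_smul]; push_cast; rfl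

lemma h_G (i : I) (la : I → ℚ) {ν : I → ℤ} {u : U} (hu : u ∈ S.G ν) :
    S.h i la u = (la i - pr C i ν : ℚ) • u := by
  simp [h, S.Kd_G i hu, sub_smul]

lemma e_G (i : I) (la : I → ℚ) {ν : I → ℤ} {u : U} (hu : u ∈ S.G ν) : S.e hG i la u ∈ S.G (ν - al i) := by
  refine S.G_ind (p := fun u => S.e hG i la u ∈ S.G (ν - al i)) hu (by simp) ?_ ?_ ?_
  · intro x y hx hy; rw [map_add]; exact add_mem hx hy
  · intro a x hx; rw [map_smul]; exact Submodule.smul_mem _ _ hx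
  · rintro l rfl
    clear hu
    induction l with
    | nil => simp [F_nil, e_one]
    | cons j l ih =>
      rw [F_cons, e_f, cnt_cons]
      refine add_mem ?_ ?_
      · rw [add_sub_right_comm]; exact S.G_f (ih) j
      · split_ifs with hj
        · subst hj; rw [S.h_G _ _ (S.F_mem l), add_sub_cancel_right]; exact Submodule.smul_mem _ _ (S.F_mem l)
        · exact zero_mem _

lemma G_zero : S.G 0 = Submodule.span ℚ {1} := by
  refine le_antisymm (Submodule.span_le.2 ?_) (Submodule.span_le.2 ?_)
  · rintro u ⟨l, hl, rfl⟩
    rcases l with _ | ⟨i, l⟩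
    · exact Submodule.mem_span_singleton_self _
    · have := congrFun hl i; simp [cnt] at this; omega
  · rintro u rfl
    have := S.F_mem []; rwa [cnt_nil, F_nil] at this

include S hG in
lemma one_ne : (1 : U) ≠ 0 := fun h => by
  have := congrArg (S.aug hG) h; simp at this

lemma n_G (k : ℕ) : ∀ (γ : I → ℤ) (x : EE I U), x ∈ (S.K hG).n k γ → ∀ la ν u, u ∈ S.G ν → x la u ∈ S.G (ν - γ) := by
  induction k with
  | zero =>
    intro γ x hx la ν u hu
    rcases (S.K hG).n_zero_mem hx with rfl | ⟨i, a, rfl, rfl⟩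
    · simp
    · exact Submodule.smul_mem _ _ (S.e_G hG i la hu)
  | succ k ih =>
    intro γ x hx la ν u hu
    refine (S.K hG).n_ind (p := fun x => x la u ∈ S.G (ν - γ)) hx (by simp) (fun x y h1 h2 => add_mem h1 h2) ?_
    intro i y hy
    rw [lie_app]
    have h1 := S.e_G hG i la (ih _ y hy la _ u hu)
    have h2 := ih _ y hy la _ _ (S.e_G hG i la hu)
    rw [show ν - (γ - al i) - al i = ν - γ by abel] at h1
    rw [show ν - al i - (γ - al i) = ν - γ by abel] at h2
    exact sub_mem h1 h2

lemma n'_G (k : ℕ) : ∀ (γ : I → ℤ) (x : EE I U), x ∈ (S.K hG).swap.n k γ →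
    (∀ la ν u, u ∈ S.G ν → x la u ∈ S.G (ν + γ)) ∧ ∀ la u, x la u = x 0 1 * u := by
  induction k with
  | zero =>
    intro γ x hx
    rcases (S.K hG).swap.n_zero_mem hx with rfl | ⟨i, a, rfl, rfl⟩
    · simp
    · refine ⟨fun la ν u hu => Submodule.smul_mem _ _ (S.G_f hu i), fun la u => ?_⟩
      change a • (S.f i * u) = (a • (S.f i * 1)) * u
      simp
  | succ k ih =>
    intro γ x hx
    refine (S.K hG).swap.n_ind (p := fun x => (∀ la ν u, u ∈ S.G ν → x la u ∈ S.G (ν + γ)) ∧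
      ∀ la u, x la u = x 0 1 * u) hx (by simp) (fun x y h1 h2 => ⟨fun la ν u hu => add_mem (h1.1 la ν u hu) (h2.1 la ν u hu), fun la u => ?_⟩) ?_
    · simp only [Pi.add_apply, LinearMap.add_apply, h1.2 la u, h2.2 la u, add_mul]
    intro i y hy
    obtain ⟨a1, a2⟩ := ih _ y hy
    have hf : ∀ la u, (S.K hG).swap.e i la u = S.f i * u := fun _ _ => rfl
    refine ⟨fun la ν u hu => ?_, fun la u => ?_⟩
    · rw [lie_app, hf, hf]
      have h1 := S.G_f (a1 la _ u hu) i
      have h2 := a1 la _ _ (S.G_f hu i)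
      rw [show ν + (γ - al i) + al i = ν + γ by abel] at h1
      rw [show ν + al i + (γ - al i) = ν + γ by abel] at h2
      exact sub_mem h1 h2
    · simp only [lie_app, hf, a2 la, a2 0 (S.f i * 1)]; noncomm_ring

end SAlg
end
end KS

namespace KS
open Finset
set_option linter.unusedSectionVars false
section

lemma dual_ex {V : Type} [AddCommGroup V] [Module ℚ V] (X Y : Submodule ℚ V) [FiniteDimensional ℚ X]
    [FiniteDimensional ℚ Y] (B : V →ₗ[ℚ] V →ₗ[ℚ] ℚ) (hl : ∀ x ∈ X, (∀ y ∈ Y, B x y = 0) → x = 0)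
    (hr : ∀ y ∈ Y, (∀ x ∈ X, B x y = 0) → y = 0) :
    ∃ (m : ℕ) (x y : Fin m → V), (∀ a, x a ∈ X) ∧ (∀ a, y a ∈ Y) ∧ (∀ z ∈ X, z = ∑ a, B z (y a) • x a) ∧
      ∀ z ∈ Y, z = ∑ a, B (x a) z • y a := by
  let Φ : Y →ₗ[ℚ] Module.Dual ℚ X := (B.flip.domRestrict₁₂ Y X)
  let Ψ : X →ₗ[ℚ] Module.Dual ℚ Y := (B.domRestrict₁₂ X Y)
  have hΦ : Function.Injective Φ := by
    rw [injective_iff_map_eq_zero]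
    intro y hy
    exact Subtype.ext (hr y y.2 fun x hx => LinearMap.congr_fun hy ⟨x, hx⟩)
  have hΨ : Function.Injective Ψ := by
    rw [injective_iff_map_eq_zero]
    intro y hy
    exact Subtype.ext (hl y y.2 fun x hx => LinearMap.congr_fun hy ⟨x, hx⟩)
  have h1 := LinearMap.finrank_le_finrank_of_injective hΦ
  have h2 := LinearMap.finrank_le_finrank_of_injective hΨ
  rw [Subspace.dual_finrank_eq] at h1 h2
  have hs : Function.Surjective Φ := (LinearMap.injective_iff_surjective_of_finrank_eq_finrank
    (by rw [Subspace.dual_finrank_eq]; omega)).1 hΦ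
  let b := Module.finBasis ℚ X
  choose y hy using fun a => hs (b.coord a)
  have hy' : ∀ a (x : X), B x (y a) = b.repr x a := fun a x => LinearMap.congr_fun (hy a) x
  refine ⟨_, fun a => b a, fun a => y a, fun a => (b a).2, fun a => (y a).2, fun z hz => ?_, fun z hz => ?_⟩
  · have := congrArg Subtype.val (b.sum_repr ⟨z, hz⟩)
    simp only [Submodule.coe_sum, Submodule.coe_smul] at this
    rw [← this]
    refine sum_congr rfl fun a _ => ?_
    rw [this]; rw [hy' a ⟨z, hz⟩]
  · have : (⟨z, hz⟩ : Y) = ∑ a, B (b a) z • y a := by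
      apply hΦ
      refine b.ext fun c => ?_
      rw [map_sum, LinearMap.sum_apply]
      simp only [map_smul, LinearMap.smul_apply]
      have : ∀ a, Φ (y a) (b c) = if c = a then 1 else 0 := by
        intro a; rw [hy]; simp [Finsupp.single_apply]
      simp [this]; rfl
    have := congrArg Subtype.val this
    simpa using this

variable {I : Type} [Fintype I] [DecidableEq I]

namespace Chev
variable {C : I → I → ℤ} {G : Type} [LieRing G] [LieAlgebra ℚ G] (K : Chev C G)

instance n_fd (k : ℕ) : ∀ γ, FiniteDimensional ℚ (K.n k γ) := by
  induction k with
  | zero =>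
    intro γ
    have : ∀ i, FiniteDimensional ℚ (if γ = al i then Submodule.span ℚ {K.e i} else ⊥ : Submodule ℚ G) := by
      intro i; by_cases h : γ = al i
      · rw [if_pos h]; infer_instance
      · rw [if_neg h]; infer_instance
    exact Submodule.finite_iSup _
  | succ k ih => intro γ; exact Submodule.finite_iSup _

noncomputable def bfL (k : ℕ) : G →ₗ[ℚ] G →ₗ[ℚ] ℚ := LinearMap.mk₂ ℚ (K.bf k)
  (by intros; simp [bf, add_div]) (by intros; simp [bf, mul_div_assoc]) (by intros; simp [bf, add_div])
  (by intros; simp [bf, mul_div_assoc])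
lemma swap_bf (k : ℕ) (x y : G) : K.swap.bf k y x = K.bf k x y := by
  simp only [bf]
  change -K.ψ ⁅y, x⁆ / _ = _
  rw [← map_neg, lie_skew]

def RND (k : ℕ) : Prop := ∀ γ, ∀ y ∈ K.swap.n k γ, (∀ x ∈ K.n k γ, K.bf k x y = 0) → y = 0
def LND (k : ℕ) : Prop := ∀ γ, ∀ x ∈ K.n k γ, (∀ y ∈ K.swap.n k γ, K.bf k x y = 0) → x = 0

end Chev

structure DD (I G : Type) where
  ι : Type
  fin : Fintype ι
  w : ι → I → ℤ
  x : ι → G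
  y : ι → G
attribute [instance] DD.fin
namespace Chev
variable {C : I → I → ℤ} {G : Type} [LieRing G] [LieAlgebra ℚ G] (K : Chev C G)
structure DB (k : ℕ) (D : DD I G) : Prop where
  hx : ∀ a, D.x a ∈ K.n k (D.w a)
  hy : ∀ a, D.y a ∈ K.swap.n k (D.w a)
  ex : ∀ γ, ∀ z ∈ K.n k γ, z = ∑ a, K.bf k z (D.y a) • D.x a
  ey : ∀ γ, ∀ z ∈ K.swap.n k γ, z = ∑ a, K.bf k (D.x a) z • D.y a

lemma n_Icc {k : ℕ} {γ : I → ℤ} {x : G} (hx : x ∈ K.n k γ) (h0 : x ≠ 0) : γ ∈ Icc (0 : I → ℤ) (fun _ => k + 1) := by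
  obtain ⟨h1, h2⟩ := K.n_ht _ _ _ hx h0
  refine mem_Icc.2 ⟨h1, fun i => ?_⟩
  rw [← h2]
  exact single_le_sum (fun j _ => h1 j) (mem_univ i)

lemma exDB {k : ℕ} (hl : K.LND k) (hr : K.RND k) : ∃ D, K.DB k D := by
  choose m x y h1 h2 h3 h4 using fun γ => dual_ex (K.n k γ) (K.swap.n k γ) (K.bfL k) (hl γ) (hr γ)
  have h0 : ∀ γ δ, γ ≠ δ → ∀ x ∈ K.n k γ, ∀ y ∈ K.swap.n k δ, K.bf k x y = 0 := by
    intro γ δ h x hx y hy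
    simp [bf, K.br_ne k γ δ x y h hx hy]
  refine ⟨⟨Σ γ : Icc (0 : I → ℤ) (fun _ => k + 1), Fin (m γ), inferInstance, fun a => a.1,
    fun a => x a.1 a.2, fun a => y a.1 a.2⟩, fun a => h1 _ _, fun a => h2 _ _, ?_, ?_⟩
  · intro γ z hz
    by_cases hz0 : z = 0
    · simp [hz0, bf]
    rw [Fintype.sum_sigma, Fintype.sum_eq_single ⟨γ, K.n_Icc hz hz0⟩]
    · exact h3 γ z hz
    · intro δ hδ
      refine sum_eq_zero fun a _ => ?_
      rw [h0 γ δ (fun h => hδ (Subtype.ext h.symm)) z hz _ (h2 _ _), zero_smul]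
  · intro γ z hz
    by_cases hz0 : z = 0
    · simp [hz0, bf]
    rw [Fintype.sum_sigma, Fintype.sum_eq_single ⟨γ, K.swap.n_Icc hz hz0⟩]
    · exact h4 γ z hz
    · intro δ hδ
      refine sum_eq_zero fun a _ => ?_
      rw [h0 δ γ (fun h => hδ (Subtype.ext h)) _ (h1 _ _) z hz, zero_smul]
end Chev

namespace SAlg
variable {C : I → I → ℤ} {U : Type} [Ring U] [Algebra ℚ U] (S : SAlg C U) (hG : GCM C)

lemma kill (la : I → ℚ) (w : U) (hw : ∀ i, S.e hG i la w = 0) (k : ℕ) : ∀ γ, ∀ x ∈ (S.K hG).n k γ, ∀ l : List I,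
    l.length ≤ k → x la (S.F l * w) = 0 := by
  have h0 : ∀ k γ, ∀ x ∈ (S.K hG).n k γ, x la w = 0 := by
    intro k
    induction k with
    | zero =>
      intro γ x hx
      rcases (S.K hG).n_zero_mem hx with rfl | ⟨i, a, rfl, rfl⟩
      · rfl
      · change a • S.e hG i la w = 0
        rw [hw, smul_zero]
    | succ k ih =>
      intro γ x hx
      refine (S.K hG).n_ind (p := fun x => x la w = 0) hx rfl (fun x y h1 h2 => ?_) ?_
      · change x la w + y la w = 0
        rw [h1, h2, add_zero]
      · intro i y hy
        rw [lie_app, ih _ y hy, map_zero]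
        change 0 - y la (S.e hG i la w) = 0
        rw [hw, map_zero, sub_zero]
  have hx : ∀ (x : EE I U) j u, x la (S.f j * u) = S.f j * x la u + ⁅x, (S.K hG).f j⁆ la u := by
    intro x j u
    rw [lie_app]
    change _ = S.f j * x la u + (x la (S.f j * u) - S.f j * x la u)
    abel
  induction k with
  | zero =>
    intro γ x hx l hl
    have : l = [] := List.eq_nil_of_length_eq_zero (by omega)
    subst this
    simpa [F_nil] using h0 _ _ _ hx
  | succ k ih =>
    intro γ x hxn l
    induction l with
    | nil => intro _; simpa [F_nil] using h0 _ _ _ hxn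
    | cons j l ihl =>
      intro hl
      simp at hl
      rw [F_cons, mul_assoc, hx, ihl (by omega), ih _ _ ((S.K hG).br_f k γ x hxn j) l hl]; simp

lemma lnd (k : ℕ) : (S.K hG).LND k := by
  induction k with
  | zero =>
    intro γ x hx h
    rcases (S.K hG).n_zero_mem hx with rfl | ⟨i, a, rfl, rfl⟩
    · rfl
    · have := h _ ((S.K hG).swap.e_mem i)
      change (S.K hG).bf 0 (a • (S.K hG).e i) ((S.K hG).f i) = 0 at this
      simp [Chev.bf, (S.K hG).ef, (S.K hG).ψh] at this
      simp [this]
  | succ k ih =>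
    intro γ x hx h
    have h1 : ∀ j, ⁅x, (S.K hG).f j⁆ = 0 := fun j => ih _ _ ((S.K hG).br_f k γ x hx j) fun z hz => by
      rw [← (S.K hG).bf_inv hG.s hx hz]
      exact h _ ((S.K hG).swap.br_mem j hz (by abel))
    funext la
    refine S.ext _ _ ?_ fun j u hu => ?_
    · have := S.kill hG la 1 (fun i => S.e_one hG i la) (k + 1) γ x hx [] (by simp)
      simpa [F_nil] using this
    · have := congrArg (fun a : EE I U => a la u) (h1 j)
      simp only [lie_app] at this
      change x la (S.f j * u) - S.f j * x la u = 0 at this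
      rw [sub_eq_zero.1 this, hu]; simp

lemma rnd_comm {k : ℕ} (hk : (S.K hG).RND k) {γ : I → ℤ} {y : EE I U} (hy : y ∈ (S.K hG).swap.n (k + 1) γ)
    (h : ∀ x ∈ (S.K hG).n (k + 1) γ, (S.K hG).bf (k + 1) x y = 0) (j : I) : ⁅(S.K hG).e j, y⁆ = 0 := by
  rw [← lie_skew, neg_eq_zero]
  refine hk _ _ ((S.K hG).swap.br_f k γ y hy j) fun x hx => ?_
  have hx' : x ∈ (S.K hG).swap.swap.n k (γ - al j) := by rw [Chev.swap_swap]; exact hx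
  have := (S.K hG).swap.bf_inv hG.s hy hx'
  rw [Chev.swap_bf] at this
  rw [← (S.K hG).swap_bf]
  change (S.K hG).swap.bf k ⁅y, (S.K hG).swap.f j⁆ x = 0
  rw [← this]
  exact h _ ((S.K hG).br_mem j hx (by abel))

noncomputable def Om (D : ℕ → DD I (EE I U)) (N : ℕ) : EE I U := ∑ k ∈ range N, ∑ a, (D k).y a * (D k).x a

lemma lie_def (x y : EE I U) : ⁅x, y⁆ = x * y - y * x := rfl

lemma Om_f (D : ℕ → DD I (EE I U)) (N : ℕ) (hD : ∀ k ≤ N, (S.K hG).DB k (D k)) (j : I) :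
    ⁅Om D (N + 1), (S.K hG).f j⁆ = (S.K hG).f j * (S.K hG).h j + ∑ a, ⁅(D N).y a, (S.K hG).f j⁆ * (D N).x a := by
  have lm : ∀ a b c : EE I U, ⁅a * b, c⁆ = a * ⁅b, c⁆ + ⁅a, c⁆ * b := by
    intro a b c; simp only [lie_def, mul_sub, sub_mul, mul_assoc]; abel
  have hs : ∀ N, Om D (N + 1) = Om D N + ∑ a, (D N).y a * (D N).x a := fun N => sum_range_succ _ _
  induction N with
  | zero =>
    rw [hs]
    simp only [Om, range_zero, sum_empty, zero_add, sum_lie, lm, sum_add_distrib, add_left_inj]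
    have h1 : ∀ a, ⁅(D 0).x a, (S.K hG).f j⁆ = (S.K hG).bf 0 ((D 0).x a) ((S.K hG).f j) • (S.K hG).h j := by
      intro a
      by_cases h : (D 0).w a = al j
      · have hx := (hD 0 le_rfl).hx a
        rw [h] at hx
        have := (S.K hG).lie_eq hG.s hx ((S.K hG).swap.e_mem j)
        rw [Chev.sh_al] at this
        exact this
      · have := (S.K hG).br_ne 0 _ _ _ _ h ((hD 0 le_rfl).hx a) ((S.K hG).swap.e_mem j)
        change ⁅(D 0).x a, (S.K hG).f j⁆ = 0 at this
        simp [this, Chev.bf]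
    have h2 := (hD 0 le_rfl).ey _ _ ((S.K hG).swap.e_mem j)
    change (S.K hG).f j = ∑ a, (S.K hG).bf 0 ((D 0).x a) ((S.K hG).f j) • (D 0).y a at h2
    conv_rhs => rw [h2]
    rw [sum_mul]
    refine sum_congr rfl fun a _ => ?_
    rw [h1, mul_smul_comm, smul_mul_assoc]
  | succ N ih =>
    rw [hs, add_lie, ih fun k hk => hD k (by omega), sum_lie]
    simp only [lm, sum_add_distrib]
    have h1 := hD N (by omega)
    have h2 := hD (N + 1) le_rfl
    have : ∑ a, (D (N + 1)).y a * ⁅(D (N + 1)).x a, (S.K hG).f j⁆ = ∑ a, ⁅(S.K hG).f j, (D N).y a⁆ * (D N).x a := by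
      have e1 : ∀ a, ⁅(D (N + 1)).x a, (S.K hG).f j⁆ =
          ∑ b, (S.K hG).bf (N + 1) ((D (N + 1)).x a) ⁅(S.K hG).f j, (D N).y b⁆ • (D N).x b := by
        intro a
        have hb := (S.K hG).br_f N _ _ (h2.hx a) j
        refine (h1.ex _ _ hb).trans ?_
        refine sum_congr rfl fun b _ => ?_
        congr 1
        by_cases h : (D N).w b = (D (N + 1)).w a - al j
        · have hy := h1.hy b
          rw [h] at hy
          rw [(S.K hG).bf_inv hG.s (h2.hx a) hy]
        · have h5 : ⁅(D (N + 1)).x a, ⁅(S.K hG).f j, (D N).y b⁆⁆ = 0 := (S.K hG).br_ne _ _ _ _ _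
            (by intro h'; exact h (by rw [h']; abel)) (h2.hx a) ((S.K hG).swap.br_mem j (h1.hy b) rfl)
          rw [Chev.bf, Chev.bf, (S.K hG).br_ne _ _ _ _ _ (Ne.symm h) hb (h1.hy b), h5]
          simp
      have e2 : ∀ b, ⁅(S.K hG).f j, (D N).y b⁆ =
          ∑ a, (S.K hG).bf (N + 1) ((D (N + 1)).x a) ⁅(S.K hG).f j, (D N).y b⁆ • (D (N + 1)).y a :=
        fun b => h2.ey _ _ ((S.K hG).swap.br_mem j (h1.hy b) rfl)
      simp only [e1, mul_sum]
      rw [sum_comm]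
      refine sum_congr rfl fun b _ => ?_
      rw [e2 b, sum_mul]
      refine sum_congr rfl fun a _ => ?_
      rw [← e2 b, mul_smul_comm, smul_mul_assoc]
    have h3 : ∑ a, ⁅(S.K hG).f j, (D N).y a⁆ * (D N).x a + ∑ a, ⁅(D N).y a, (S.K hG).f j⁆ * (D N).x a = 0 := by
      rw [← sum_add_distrib]
      refine sum_eq_zero fun a _ => ?_
      rw [← add_mul, lie_def, lie_def, sub_add_sub_cancel, sub_self, zero_mul]
    rw [this, add_assoc, add_left_cancel_iff, ← add_assoc, add_comm (∑ a, ⁅(D N).y a, (S.K hG).f j⁆ * (D N).x a), h3, zero_add]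

noncomputable def kap (C : I → I → ℤ) (mu : I → ℚ) (ν : I → ℤ) : ℚ :=
  ∑ i, (ν i : ℚ) * mu i + ∑ i, (ν i : ℚ) - (∑ i, (ν i : ℚ) * pr C i ν) / 2

include hG in
lemma kap_add (mu : I → ℚ) (ν : I → ℤ) (j : I) : kap C mu (ν + al j) = kap C mu ν + (mu j - pr C j ν) := by
  have h1 : ∑ i, (ν i : ℚ) * C i j = pr C j ν := by
    simp only [pr, hG.s j]; push_cast; exact sum_congr rfl fun _ _ => mul_comm _ _
  simp only [kap, pr_add, pr_al, Pi.add_apply, Int.cast_add, add_mul, sum_add_distrib, mul_add, h1]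
  simp [al, Pi.single_apply, hG.d]
  ring

lemma Om_word (D : ℕ → DD I (EE I U)) (N : ℕ) (hD : ∀ k < N, (S.K hG).DB k (D k)) (la mu : I → ℚ) (w : U)
    (hw : ∀ i, S.e hG i la w = 0) (hh : ∀ i, S.h i la w = mu i • w) (l : List I) (hl : l.length ≤ N) :
    Om D N la (S.F l * w) = kap C mu (cnt l) • (S.F l * w) := by
  have hhl : ∀ (l : List I) j, S.h j la (S.F l * w) = (mu j - pr C j (cnt l) : ℚ) • (S.F l * w) := by
    intro l j
    induction l with
    | nil => simp [F_nil, hh, cnt_nil, pr_zero]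
    | cons i l ih => rw [F_cons, mul_assoc, h_f, ih, cnt_cons, pr_add, pr_al, mul_smul_comm]; push_cast; module
  induction l with
  | nil =>
    have : Om D N la (S.F [] * w) = 0 := by
      simp only [Om, Finset.sum_apply, LinearMap.sum_apply, Pi.mul_apply, Module.End.mul_apply]
      refine sum_eq_zero fun k hk => sum_eq_zero fun a _ => ?_
      rw [S.kill hG la w hw k _ _ ((hD k (mem_range.1 hk)).hx a) [] (by simp), map_zero]
    rw [this, cnt_nil]; simp [kap]
  | cons j l ih =>
    obtain ⟨M, rfl⟩ : ∃ M, N = M + 1 := ⟨N - 1, by simp at hl; omega⟩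
    have h1 := congrArg (fun a : EE I U => a la (S.F l * w)) (S.Om_f hG D M (fun k hk => hD k (by omega)) j)
    simp only [lie_app] at h1
    have h2 : (∑ a, ⁅(D M).y a, (S.K hG).f j⁆ * (D M).x a) la (S.F l * w) = 0 := by
      simp only [Finset.sum_apply, LinearMap.sum_apply, Pi.mul_apply, Module.End.mul_apply]
      refine sum_eq_zero fun a _ => ?_
      rw [S.kill hG la w hw M _ _ ((hD M (by omega)).hx a) l (by simpa using hl), map_zero]
    rw [Pi.add_apply, LinearMap.add_apply, h2, add_zero] at h1
    change Om D (M + 1) la (S.f j * (S.F l * w)) - S.f j * Om D (M + 1) la (S.F l * w) = S.f j * S.h j la (S.F l * w) at h1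
    rw [F_cons, mul_assoc, eq_add_of_sub_eq h1, hhl, ih (by simp at hl; omega), cnt_cons, kap_add hG, mul_smul_comm,
      mul_smul_comm]
    module

end SAlg
end
end KS

namespace KS
open Finset
set_option linter.unusedSectionVars false
section
lemma adp_add {A : Type} [Ring A] (x : A) (n : ℕ) (y z : A) : adp x n (y + z) = adp x n y + adp x n z := by
  induction n with
  | zero => rfl
  | succ n ih => rw [adp_succ, adp_succ, adp_succ, ih]; noncomm_ring
lemma adp_z {A : Type} [Ring A] (x : A) (n : ℕ) : adp x n 0 = 0 := by
  induction n with
  | zero => rfl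
  | succ n ih => rw [adp_succ, ih]; simp
lemma adp_succ' {A : Type} [Ring A] (x : A) (n : ℕ) (y : A) :
    adp x (n + 1) y = adp x n (x * y - y * x) := Function.iterate_succ_apply _ _ _
lemma adp_smul {A : Type} [Ring A] [Algebra ℚ A] (x : A) (n : ℕ) (a : ℚ) (y : A) : adp x n (a • y) = a • adp x n y := by
  induction n with
  | zero => rfl
  | succ n ih => rw [adp_succ, adp_succ, ih, mul_smul_comm, smul_mul_assoc, smul_sub]

lemma adp_mul {A : Type} [Ring A] (x : A) (s : ℕ) : ∀ (n m : ℕ) (u v : A), n + m = s → adp x n u = 0 →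
    adp x m v = 0 → adp x s (u * v) = 0 := by
  induction s with
  | zero =>
    intro n m u v h h1 _
    obtain rfl : n = 0 := by omega
    rw [adp_zero] at h1; rw [h1, zero_mul, adp_z]
  | succ s ih =>
    intro n m u v h h1 h2
    rw [adp_succ', show x * (u * v) - u * v * x = (x * u - u * x) * v + u * (x * v - v * x) by noncomm_ring, adp_add]
    rcases n with _ | n
    · rw [adp_zero] at h1; simp [h1, adp_z]
    rcases m with _ | m
    · rw [adp_zero] at h2; simp [h2, adp_z]
    rw [ih n (m + 1) _ _ (by omega) (by rw [← adp_succ', h1]) h2,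
      ih (n + 1) m _ _ (by omega) h1 (by rw [← adp_succ', h2]), add_zero]
lemma adp_mono {A : Type} [Ring A] (x : A) {n m : ℕ} (h : n ≤ m) {y : A} (hy : adp x n y = 0) : adp x m y = 0 := by
  induction h with
  | refl => exact hy
  | step _ ih => rw [adp_succ, ih]; simp

variable {I : Type} [Fintype I] [DecidableEq I]
namespace SAlg
variable {C : I → I → ℤ} {U : Type} [Ring U] [Algebra ℚ U] (S : SAlg C U) (hG : GCM C)

lemma loc_nilp (i : I) (u : U) : ∃ n, adp (S.f i) n u = 0 := by
  have hu := S.gen u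
  induction hu using Submodule.span_induction with
  | mem x hx =>
    obtain ⟨l, rfl⟩ := hx
    induction l with
    | nil => exact ⟨1, by simp [adp_succ, adp_zero]⟩
    | cons j l ih =>
      obtain ⟨n, hn⟩ := ih
      obtain ⟨m, hm⟩ : ∃ m, adp (S.f i) m (S.f j) = 0 := by
        by_cases h : i = j
        · exact ⟨1, by simp [adp_succ, adp_zero, h]⟩
        · exact ⟨_, S.serre i j h⟩
      exact ⟨_, by simpa using adp_mul _ _ m n _ _ rfl hm hn⟩
  | zero => exact ⟨0, rfl⟩
  | add x y _ _ hx hy =>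
    obtain ⟨n, hn⟩ := hx
    obtain ⟨m, hm⟩ := hy
    exact ⟨n + m, by rw [adp_add, adp_mono _ (by omega) hn, adp_mono _ (by omega) hm, add_zero]⟩
  | smul a x _ hx =>
    obtain ⟨n, hn⟩ := hx
    exact ⟨n, by rw [adp_smul, hn, smul_zero]⟩

lemma rnd_sl2 {k : ℕ} {γ : I → ℤ} {y : EE I U} (hy : y ∈ (S.K hG).swap.n k γ) (i : I) (hi : 0 < pr C i γ)
    (h : ⁅(S.K hG).e i, y⁆ = 0) : y = 0 := by
  let Y : ℕ → EE I U := fun n => (fun z => ⁅(S.K hG).f i, z⁆)^[n] y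
  have Ys : ∀ n, Y (n + 1) = ⁅(S.K hG).f i, Y n⁆ := fun n => Function.iterate_succ_apply' _ _ _
  have hh : ∀ n : ℕ, ⁅(S.K hG).h i, Y n⁆ = (-(pr C i γ + 2 * n) : ℚ) • Y n := by
    intro n
    induction n with
    | zero =>
      have := (S.K hG).swap.h_n k γ y hy i
      change ⁅-(S.K hG).h i, y⁆ = _ at this
      rw [neg_lie, neg_eq_iff_eq_neg] at this
      change ⁅(S.K hG).h i, y⁆ = _ • y
      rw [this]; simp
    | succ n ih =>
      rw [Ys, leibniz_lie, (S.K hG).hf, ih, lie_smul, smul_lie, hG.d]; push_cast; module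
  have he : ∀ n : ℕ, ⁅(S.K hG).e i, Y (n + 1)⁆ = (-((n + 1) * (pr C i γ + n)) : ℚ) • Y n := by
    intro n
    induction n with
    | zero =>
      rw [Ys, leibniz_lie, (S.K hG).ef, if_pos rfl, hh]
      change _ + ⁅_, ⁅_, y⁆⁆ = _
      rw [h]; simp
    | succ n ih =>
      rw [Ys, leibniz_lie, (S.K hG).ef, if_pos rfl, hh, ih, lie_smul, ← Ys]; push_cast; module
  have hn : ∀ n, Y n = 0 → y = 0 := by
    intro n
    induction n with
    | zero => exact id
    | succ n ih =>
      intro hn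
      refine ih ?_
      have h1 := he n
      rw [hn, lie_zero] at h1
      refine (smul_eq_zero.1 h1.symm).resolve_left ?_
      have : (0 : ℚ) < pr C i γ := by exact_mod_cast hi
      have : (0 : ℚ) < (n + 1) * (pr C i γ + n) := by positivity
      linarith
  obtain ⟨n, h0⟩ := S.loc_nilp i (y 0 1)
  refine hn n ?_
  have : ∀ n la u, Y n la u = adp (S.f i) n (y 0 1) * u := by
    intro n
    induction n with
    | zero => exact ((S.n'_G hG k γ y hy).2)
    | succ n ih =>
      intro la u
      rw [Ys, lie_app, adp_succ, ih]
      change S.f i * _ - Y n la (S.f i * u) = _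
      rw [ih]; noncomm_ring
  funext la; ext u
  rw [this, h0, zero_mul]; rfl

lemma Om_G (D : ℕ → DD I (EE I U)) (N : ℕ) (hD : ∀ k < N, (S.K hG).DB k (D k)) {γ : I → ℤ} (hγ : ∑ i, γ i = N + 1)
    {v : U} (hv : v ∈ S.G γ) : Om D N 0 v = kap C 0 γ • v := by
  refine S.G_ind (p := fun v => Om D N 0 v = kap C 0 γ • v) hv (by simp) ?_ ?_ ?_
  · intro x y hx hy; rw [map_add, hx, hy, smul_add]
  · intro a x hx; rw [map_smul, hx, smul_comm]
  · rintro l rfl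
    have hl : ∀ l : List I, ∑ i, cnt l i = l.length := by
      intro l
      induction l with
      | nil => simp [cnt_nil]
      | cons j l ih => simp [cnt_cons, sum_add_distrib, ih, al]
    rw [hl] at hγ
    rcases List.eq_nil_or_concat l with rfl | ⟨l', i, rfl⟩
    · simp at hγ; omega
    have e1 : S.F (l'.concat i) = S.F l' * S.f i := by simp [F]
    have e2 : cnt (l'.concat i) = cnt l' + al i := by
      have := cnt_cons i l'
      rw [← this]; funext j; simp only [cnt]; norm_cast
      exact List.Perm.count_eq (by simp [List.perm_append_singleton]) j
    have hm : ∀ j, S.h j 0 (S.f i) = (-C j i : ℚ) • S.f i := by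
      intro j
      have := S.h_f j i 0 1
      simpa [h_one] using this
    rw [e1, S.Om_word hG D N hD 0 (fun j => -C j i) (S.f i) (fun j => ?_) hm l' (by simp at hγ; omega), e2, kap_add hG]
    · congr 1
      have h1 : ∑ j, (cnt l' j : ℚ) * C j i = pr C i (cnt l') := by
        simp only [pr, hG.s i]; push_cast; exact sum_congr rfl fun _ _ => mul_comm _ _
      simp only [kap, mul_neg, sum_neg_distrib, h1]
      simp; ring
    · have := S.e_f hG j 0 i 1
      rw [mul_one, e_one] at this
      rw [this]; split_ifs <;> simp [h_one]

lemma rnd (k : ℕ) : (S.K hG).RND k := by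
  induction k using Nat.strong_induction_on with
  | _ k ih =>
    rcases k with _ | k
    · intro γ y hy h
      rcases (S.K hG).swap.n_zero_mem hy with rfl | ⟨i, a, rfl, rfl⟩
      · rfl
      · have := h _ ((S.K hG).e_mem i)
        change (S.K hG).bf 0 ((S.K hG).e i) (a • (S.K hG).f i) = 0 at this
        simp [Chev.bf, (S.K hG).ef, (S.K hG).ψh] at this
        simp [this]
    · intro γ y hy h
      have hc := S.rnd_comm hG (ih k (by omega)) hy h
      by_contra hy0
      obtain ⟨g0, g1⟩ := (S.K hG).swap.n_ht _ _ _ hy hy0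
      by_cases hp : ∃ i, 0 < pr C i γ
      · obtain ⟨i, hi⟩ := hp
        exact hy0 (S.rnd_sl2 hG hy i hi (hc i))
      · push Not at hp
        have : ∃ D : ℕ → DD I (EE I U), ∀ j < k + 1, (S.K hG).DB j (D j) := by
          have : ∀ j, ∃ D, j < k + 1 → (S.K hG).DB j D := fun j => by
            by_cases hj : j < k + 1
            · obtain ⟨D, hD⟩ := (S.K hG).exDB (S.lnd hG j) (ih j hj); exact ⟨D, fun _ => hD⟩
            · exact ⟨⟨Empty, inferInstance, nofun, nofun, nofun⟩, fun h => absurd h hj⟩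
          choose D hD using this
          exact ⟨D, hD⟩
        obtain ⟨D, hD⟩ := this
        obtain ⟨m1, m2⟩ := S.n'_G hG _ γ y hy
        have hu : y 0 1 ∈ S.G γ := by
          have := m1 0 0 1 (by rw [G_zero]; exact Submodule.mem_span_singleton_self _)
          rwa [zero_add] at this
        have h1 := S.Om_G hG D (k + 1) hD (by rw [g1]) hu
        have hs : ∀ i, S.e hG i 0 (y 0 1) = 0 := by
          intro i
          have := congrArg (fun a : EE I U => a 0 1) (hc i)
          simp only [lie_app] at this
          change S.e hG i 0 (y 0 1) - y 0 (S.e hG i 0 1) = 0 at this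
          rwa [e_one, map_zero, sub_zero] at this
        have h2 : Om D (k + 1) 0 (y 0 1) = 0 := by
          simp only [Om, Finset.sum_apply, LinearMap.sum_apply, Pi.mul_apply, Module.End.mul_apply]
          refine sum_eq_zero fun j hj => sum_eq_zero fun a _ => ?_
          have := S.kill hG 0 _ hs j _ _ ((hD j (mem_range.1 hj)).hx a) [] (by simp)
          rw [F_nil, one_mul] at this
          rw [this, map_zero]
        rw [h2] at h1
        have h3 : (0 : ℚ) < kap C 0 γ := by
          have a1 : ∑ i, (γ i : ℚ) * pr C i γ ≤ 0 := sum_nonpos fun i _ => mul_nonpos_of_nonneg_of_nonpos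
            (by exact_mod_cast g0 i) (by exact_mod_cast hp i)
          have a2 : ∑ i, (γ i : ℚ) = k + 1 + 1 := by exact_mod_cast g1
          simp only [kap, Pi.zero_apply, mul_zero, sum_const_zero, a2]
          have : (0 : ℚ) ≤ k := by positivity
          linarith
        have h4 := (smul_eq_zero.1 h1.symm).resolve_left h3.ne'
        refine hy0 ?_
        funext la; ext u
        rw [m2, h4, zero_mul]; rfl

lemma exD : ∃ D : ℕ → DD I (EE I U), ∀ k, (S.K hG).DB k (D k) := by
  choose D hD using fun k => (S.K hG).exDB (S.lnd hG k) (S.rnd hG k)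
  exact ⟨D, hD⟩
end SAlg
end
end KS

namespace KS
open Finset
set_option linter.unusedSectionVars false
section
variable {I : Type} [Fintype I] [DecidableEq I]

lemma ht_lt {β ν : I → ℤ} (h : β ∈ Icc 0 ν) (hne : β ≠ ν) : (∑ i, β i).toNat < (∑ i, ν i).toNat := by
  rw [mem_Icc] at h
  have h1 : ∑ i, β i < ∑ i, ν i := by
    obtain ⟨i, hi⟩ := Function.ne_iff.1 hne
    exact sum_lt_sum (fun j _ => h.2 j) ⟨i, mem_univ i, lt_of_le_of_ne (h.2 i) hi⟩
  have h2 : 0 ≤ ∑ i, β i := sum_nonneg fun i _ => h.1 i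
  omega

lemma conv_uniq (d : (I → ℤ) → ℚ) (d0 : d 0 = 1) (c : (I → ℤ) → ℚ)
    (h : ∀ ν, 0 ≤ ν → ∑ β ∈ Icc 0 ν, c β * d (ν - β) = 0) (ν : I → ℤ) (hν : 0 ≤ ν) : c ν = 0 := by
  induction hn : (∑ i, ν i).toNat using Nat.strong_induction_on generalizing ν with
  | _ n ih =>
    have := h ν hν
    rw [← add_sum_erase _ _ (mem_Icc.2 ⟨hν, le_rfl⟩), sub_self, d0, mul_one, sum_eq_zero, add_zero] at this
    · exact this
    · intro β hβ
      rw [mem_erase] at hβ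
      rw [ih _ (hn ▸ ht_lt hβ.2 hβ.1) β (mem_Icc.1 hβ.2).1 rfl, zero_mul]

lemma conv_comm (f g : (I → ℤ) → ℚ) (ν : I → ℤ) :
    ∑ β ∈ Icc 0 ν, f β * g (ν - β) = ∑ β ∈ Icc 0 ν, g β * f (ν - β) := by
  refine sum_nbij' (fun β => ν - β) (fun β => ν - β) ?_ ?_ ?_ ?_ ?_ <;> intro β hβ
  · simpa [and_comm] using hβ
  · simpa [and_comm] using hβ
  · simp
  · simp
  · simp [mul_comm]

lemma conv_inv (d : (I → ℤ) → ℚ) (d0 : d 0 = 1) : ∃ c : (I → ℤ) → ℚ, (∀ β, c β ≠ 0 → 0 ≤ β) ∧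
    ∀ ν, 0 ≤ ν → ∑ β ∈ Icc 0 ν, c β * d (ν - β) = if ν = 0 then 1 else 0 := by
  classical
  let wf := (measure fun ν : I → ℤ => (∑ i, ν i).toNat).wf
  let c : (I → ℤ) → ℚ := wf.fix fun ν r => if 0 ≤ ν then (if ν = 0 then 1 else 0) -
    ∑ β ∈ ((Icc 0 ν).erase ν).attach, r β.1 (ht_lt (mem_of_mem_erase β.2) (ne_of_mem_erase β.2)) * d (ν - β.1) else 0
  have hc : ∀ ν, c ν = if 0 ≤ ν then (if ν = 0 then 1 else 0) - ∑ β ∈ (Icc 0 ν).erase ν, c β * d (ν - β) else 0 := by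
    intro ν
    refine (wf.fix_eq _ ν).trans ?_
    rw [← sum_attach ((Icc 0 ν).erase ν)]
  refine ⟨c, fun β h => ?_, fun ν hν => ?_⟩
  · by_contra h'
    rw [hc, if_neg h'] at h; exact h rfl
  · rw [← add_sum_erase _ _ (mem_Icc.2 ⟨hν, le_rfl⟩), sub_self, d0, mul_one, hc ν, if_pos hν]; ring

namespace SAlg
variable {C : I → I → ℤ} {U : Type} [Ring U] [Algebra ℚ U] (S : SAlg C U) (hG : GCM C)

noncomputable def pj (ν : I → ℤ) : U →ₗ[ℚ] S.G ν :=
  ((S.G ν).subtype.exists_leftInverse_of_injective (Submodule.ker_subtype _)).choose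
lemma pj_eq {ν : I → ℤ} (u : U) (hu : u ∈ S.G ν) : (S.pj ν u : U) = u := by
  have := ((S.G ν).subtype.exists_leftInverse_of_injective (Submodule.ker_subtype _)).choose_spec
  exact congrArg Subtype.val (LinearMap.congr_fun this ⟨u, hu⟩)
noncomputable def tr (ν : I → ℤ) : Module.End ℚ U →ₗ[ℚ] ℚ :=
  LinearMap.trace ℚ (S.G ν) ∘ₗ (LinearMap.llcomp ℚ _ _ _ (S.pj ν)) ∘ₗ (LinearMap.lcomp ℚ U (S.G ν).subtype)
lemma tr_eq (ν : I → ℤ) (T : Module.End ℚ U) :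
    S.tr ν T = LinearMap.trace ℚ (S.G ν) (S.pj ν ∘ₗ T ∘ₗ (S.G ν).subtype) := rfl
noncomputable def dm (ν : I → ℤ) : ℚ := Module.finrank ℚ (S.G ν)

lemma tr_smul (ν : I → ℤ) (T : Module.End ℚ U) (a : ℚ) (h : ∀ u ∈ S.G ν, T u = a • u) : S.tr ν T = a * S.dm ν := by
  have : S.pj ν ∘ₗ T ∘ₗ (S.G ν).subtype = a • LinearMap.id := by
    ext u
    simp [h u u.2, S.pj_eq u u.2]
  rw [tr_eq, this, map_smul, LinearMap.trace_id]; rfl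
lemma tr_bot (ν : I → ℤ) (T : Module.End ℚ U) (h : ¬ 0 ≤ ν) : S.tr ν T = 0 := by
  have h1 := S.G_bot h
  rw [S.tr_smul ν T 0 (fun u hu => by rw [h1, Submodule.mem_bot] at hu; simp [hu]), zero_mul]
lemma tr_comm (ν μ : I → ℤ) (x y : Module.End ℚ U) (hx : ∀ u ∈ S.G ν, x u ∈ S.G μ) (hy : ∀ u ∈ S.G μ, y u ∈ S.G ν) :
    S.tr ν (y * x) = S.tr μ (x * y) := by
  rw [tr_eq, tr_eq]
  have h1 : S.pj ν ∘ₗ (y * x) ∘ₗ (S.G ν).subtype =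
    (S.pj ν ∘ₗ y ∘ₗ (S.G μ).subtype) ∘ₗ (S.pj μ ∘ₗ x ∘ₗ (S.G ν).subtype) := by
    ext u; simp [S.pj_eq _ (hx u u.2)]
  have h2 : S.pj μ ∘ₗ (x * y) ∘ₗ (S.G μ).subtype =
    (S.pj μ ∘ₗ x ∘ₗ (S.G ν).subtype) ∘ₗ (S.pj ν ∘ₗ y ∘ₗ (S.G μ).subtype) := by
    ext u; simp [S.pj_eq _ (hy u u.2)]
  rw [h1, h2, LinearMap.trace_comp_comm']

include hG in
lemma dm_zero : S.dm 0 = 1 := by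
  rw [dm, G_zero, finrank_span_singleton (S.one_ne hG)]; simp
lemma dm_bot {ν : I → ℤ} (h : ¬ 0 ≤ ν) : S.dm ν = 0 := by rw [dm, S.G_bot h]; simp

def mw (C : I → I → ℤ) (β : I → ℤ) (i : I) : ℚ := -(pr C i β : ℚ)

lemma tr_rec {k : ℕ} {γ : I → ℤ} {x y : EE I U} (hx : x ∈ (S.K hG).n k γ) (hy : y ∈ (S.K hG).swap.n k γ)
    (β ν : I → ℤ) : S.tr (ν - β) (y (mw C β) * x (mw C β)) = S.tr (ν - γ - β) (y (mw C β) * x (mw C β)) -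
      (S.K hG).bf k x y * (∑ i, (γ i : ℚ) * pr C i (ν - γ)) * S.dm (ν - γ - β) := by
  have e : ν - β - γ = ν - γ - β := by abel
  rw [S.tr_comm (ν - β) (ν - γ - β) _ _ (fun u hu => e ▸ S.n_G hG k γ x hx _ _ u hu)
    (fun u hu => by have := (S.n'_G hG k γ y hy).1 (mw C β) _ u hu; rwa [← e, sub_add_cancel] at this)]
  have h1 : x (mw C β) * y (mw C β) = y (mw C β) * x (mw C β) + ((S.K hG).bf k x y • (S.K hG).sh γ) (mw C β) := by
    rw [← (S.K hG).lie_eq hG.s hx hy]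
    ext u; rw [LinearMap.add_apply, lie_app]; simp
  rw [h1, map_add, S.tr_smul _ (((S.K hG).bf k x y • (S.K hG).sh γ) (mw C β))
    (-((S.K hG).bf k x y * (∑ i, (γ i : ℚ) * pr C i (ν - γ)))), neg_mul, ← sub_eq_add_neg]
  intro u hu
  rw [Chev.sh, Pi.smul_apply, Finset.sum_apply, LinearMap.smul_apply, LinearMap.sum_apply]
  have : ∀ i, (((γ i : ℚ) • (S.K hG).h i) (mw C β)) u = (-((γ i : ℚ) * pr C i (ν - γ))) • u := by
    intro i
    change (γ i : ℚ) • S.h i (mw C β) u = _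
    rw [S.h_G i _ hu, smul_smul, mw, pr_sub]; push_cast; congr 1; ring
  simp only [this]
  rw [← sum_smul, smul_smul, sum_neg_distrib, mul_neg]

section
variable (c : (I → ℤ) → ℚ) (hc : ∀ ν, 0 ≤ ν → ∑ β ∈ Icc 0 ν, c β * S.dm (ν - β) = if ν = 0 then 1 else 0)
include hc

lemma tr_sum {k : ℕ} {γ : I → ℤ} {x y : EE I U} (hx : x ∈ (S.K hG).n k γ) (hy : y ∈ (S.K hG).swap.n k γ)
    (ν : I → ℤ) : ∑ β ∈ Icc 0 ν, c β * S.tr (ν - β) (y (mw C β) * x (mw C β)) = 0 := by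
  by_cases hx0 : x = 0
  · simp [hx0]
  obtain ⟨g0, g1⟩ := (S.K hG).n_ht _ _ _ hx hx0
  by_cases hν : 0 ≤ ν
  swap
  · rw [Icc_eq_empty (fun h => hν h), sum_empty]
  induction hn : (∑ i, ν i).toNat using Nat.strong_induction_on generalizing ν with
  | _ n ih =>
    have hsub : Icc 0 (ν - γ) ⊆ Icc 0 ν := Icc_subset_Icc_right (sub_le_self _ g0)
    have hz : ∀ β ∈ Icc 0 ν, β ∉ Icc 0 (ν - γ) → ¬ 0 ≤ ν - γ - β := by
      intro β h1 h2 h3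
      exact h2 (mem_Icc.2 ⟨(mem_Icc.1 h1).1, sub_nonneg.1 h3⟩)
    have h1 : ∀ β, c β * S.tr (ν - β) (y (mw C β) * x (mw C β)) = c β * S.tr (ν - γ - β) (y (mw C β) * x (mw C β)) -
        (S.K hG).bf k x y * (∑ i, (γ i : ℚ) * pr C i (ν - γ)) * (c β * S.dm (ν - γ - β)) := by
      intro β; rw [S.tr_rec hG hx hy]; ring
    simp only [h1, sum_sub_distrib, ← mul_sum]
    rw [← sum_subset hsub fun β h1 h2 => by rw [S.tr_bot _ _ (hz β h1 h2), mul_zero],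
      ← sum_subset hsub fun β h1 h2 => by rw [S.dm_bot (hz β h1 h2), mul_zero]]
    by_cases h0 : 0 ≤ ν - γ
    · rw [ih _ ?_ _ h0 rfl, hc _ h0]
      · split_ifs with h2
        · simp [h2, pr_zero]
        · simp
      · have : 0 ≤ ∑ i, (ν - γ) i := sum_nonneg fun i _ => h0 i
        simp only [Pi.sub_apply, sum_sub_distrib, g1] at this ⊢
        omega
    · rw [Icc_eq_empty (fun h => h0 h)]; simp

include hG in
lemma c_q (β : I → ℤ) (hβ : 0 ≤ β) : c β * kap C 0 β = 0 := by
  obtain ⟨D, hD⟩ := S.exD hG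
  refine conv_uniq S.dm (S.dm_zero hG) (fun β => c β * kap C 0 β) (fun ν hν => ?_) β hβ
  let N := (∑ i, ν i).toNat
  have h1 : ∑ β ∈ Icc 0 ν, c β * S.tr (ν - β) (Om D N (mw C β)) = 0 := by
    simp only [Om, Finset.sum_apply, map_sum, mul_sum]
    rw [sum_comm]
    refine sum_eq_zero fun k _ => ?_
    rw [sum_comm]
    exact sum_eq_zero fun a _ => S.tr_sum hG c hc ((hD k).hx a) ((hD k).hy a) ν
  have h2 : ∀ β ∈ Icc 0 ν, c β * S.tr (ν - β) (Om D N (mw C β)) =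
      kap C 0 ν * (c β * S.dm (ν - β)) - c β * kap C 0 β * S.dm (ν - β) := by
    intro β hβ
    rw [mem_Icc] at hβ
    rw [S.tr_smul _ _ (kap C 0 ν - kap C 0 β)]
    · ring
    · intro u hu
      have e : kap C (mw C β) (ν - β) = kap C 0 ν - kap C 0 β := by
        have e1 : ∑ i, (ν i : ℚ) * pr C i β = ∑ i, (β i : ℚ) * pr C i ν := by
          simp only [pr]; push_cast; simp only [mul_sum]; rw [sum_comm]
          refine sum_congr rfl fun i _ => sum_congr rfl fun j _ => ?_
          rw [hG.s]; ring
        simp only [kap, mw, pr_sub, Pi.sub_apply, Int.cast_sub, sub_mul, mul_sub, sum_sub_distrib, mul_neg, e1,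
          sum_neg_distrib, Pi.zero_apply, mul_zero, sum_const_zero]
        ring
      rw [← e]
      refine S.G_ind (p := fun u => Om D N (mw C β) u = kap C (mw C β) (ν - β) • u) hu (by simp) ?_ ?_ ?_
      · intro x y hx hy; rw [map_add, hx, hy, smul_add]
      · intro a x hx; rw [map_smul, hx, smul_comm]
      · intro l hl
        have := S.Om_word hG D N (fun k _ => hD k) (mw C β) (mw C β) 1 (fun i => S.e_one hG i _)
          (fun i => S.h_one i _) l ?_
        · rwa [mul_one, hl] at this
        · have hl' : ∀ l : List I, ∑ i, cnt l i = l.length := by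
            intro l
            induction l with
            | nil => simp [cnt_nil]
            | cons j l ih => simp [cnt_cons, sum_add_distrib, ih, al]
          have := hl' l
          have hb : 0 ≤ ∑ i, β i := sum_nonneg fun i _ => hβ.1 i
          rw [hl] at this
          simp only [Pi.sub_apply, sum_sub_distrib] at this
          omega
  rw [sum_congr rfl h2, sum_sub_distrib, ← mul_sum, hc ν hν] at h1
  rw [sub_eq_zero] at h1
  rw [← h1]
  split_ifs with h0
  · simp [h0, kap, pr_zero]
  · simp

include hG in
lemma c_anti (cp : ∀ β, c β ≠ 0 → 0 ≤ β) (β : I → ℤ) (h0 : β ≠ 0) (hp : ∀ i, pr C i β ≤ 0) : c β = 0 := by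
  by_contra hc0
  have hβ := cp β hc0
  have h1 := (mul_eq_zero.1 (S.c_q hG c hc β hβ)).resolve_left hc0
  have a1 : ∑ i, (β i : ℚ) * pr C i β ≤ 0 := sum_nonpos fun i _ => mul_nonpos_of_nonneg_of_nonpos
    (by exact_mod_cast hβ i) (by exact_mod_cast hp i)
  have a2 : (0 : ℚ) < ∑ i, (β i : ℚ) := by
    obtain ⟨i, hi⟩ := Function.ne_iff.1 h0
    refine sum_pos' (fun i _ => by exact_mod_cast hβ i) ⟨i, mem_univ i, ?_⟩
    exact_mod_cast lt_of_le_of_ne (hβ i) (Ne.symm hi)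
  simp only [kap, Pi.zero_apply, mul_zero, sum_const_zero] at h1
  linarith
end
end SAlg
end
end KS

namespace KS
open Finset
set_option linter.unusedSectionVars false
section

lemma sl2_inj {V : Type} [AddCommGroup V] [Module ℚ V] (K : Submodule ℚ V) (e f h : Module.End ℚ V)
    (Ke : ∀ v ∈ K, e v ∈ K) (Kf : ∀ v ∈ K, f v ∈ K) (ef : ∀ v ∈ K, e (f v) = f (e v) + h v)
    (he : ∀ v ∈ K, h (e v) = e (h v) + (2 : ℚ) • e v) (hf : ∀ v ∈ K, h (f v) = f (h v) - (2 : ℚ) • f v) (p : ℕ) :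
    ∀ (m j : ℕ) (v : V), v ∈ K → h v = (m : ℚ) • v → (e ^ p) v = 0 → j ≤ m → (f ^ j) v = 0 → v = 0 := by
  have fs : ∀ n v, (f ^ (n + 1)) v = f ((f ^ n) v) := fun n v => by rw [pow_succ']; rfl
  have fK : ∀ n, ∀ v ∈ K, (f ^ n) v ∈ K := by
    intro n v hv
    induction n with
    | zero => exact hv
    | succ n ih => rw [fs]; exact Kf _ ih
  have fh : ∀ (m : ℕ) (v : V), v ∈ K → h v = (m : ℚ) • v → ∀ n : ℕ, h ((f ^ n) v) = (m - 2 * n : ℚ) • (f ^ n) v := by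
    intro m v hv hm n
    induction n with
    | zero => simp [hm]
    | succ n ih => rw [fs, hf _ (fK n v hv), ih, map_smul]; push_cast; module
  have fe : ∀ (m : ℕ) (v : V), v ∈ K → h v = (m : ℚ) • v → ∀ n : ℕ, e ((f ^ (n + 1)) v) =
      (f ^ (n + 1)) (e v) + ((n + 1) * (m - n) : ℚ) • (f ^ n) v := by
    intro m v hv hm n
    induction n with
    | zero => simp [ef v hv, hm]
    | succ n ih =>
      rw [fs, ef _ (fK _ v hv), ih, fh m v hv hm, map_add, map_smul, ← fs, ← fs]; push_cast; module
  induction p with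
  | zero => intro m j v _ _ h0 _ _; exact h0
  | succ p ih =>
    intro m j v hv hm hp hj hfj
    have hev : e v = 0 := by
      refine ih (m + 2) (j + 1) (e v) (Ke v hv) ?_ ?_ (by omega) ?_
      · rw [he v hv, hm, map_smul]; push_cast; module
      · rw [pow_succ] at hp; exact hp
      · have h1 := fe m v hv hm j
        rw [fs, hfj, map_zero, map_zero, smul_zero, add_zero] at h1
        exact h1.symm
    induction j with
    | zero => exact hfj
    | succ j ihj =>
      refine ihj (by omega) ?_
      have h1 := fe m v hv hm j
      rw [hfj, map_zero, hev, map_zero, zero_add] at h1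
      refine (smul_eq_zero.1 h1.symm).resolve_left ?_
      have : (j + 1 : ℚ) ≤ m := by exact_mod_cast hj
      have h2 : (0 : ℚ) < (j + 1) * (m - j) := mul_pos (by positivity) (by linarith)
      exact h2.ne'

variable {I : Type} [Fintype I] [DecidableEq I]
namespace SAlg
variable {C : I → I → ℤ} {U : Type} [Ring U] [Algebra ℚ U] (S : SAlg C U) (hG : GCM C) (i : I)

noncomputable def dd : Module.End ℚ U := S.e hG i (Pi.single i 1) - S.e hG i 0
lemma dd_one : S.dd hG i 1 = 0 := by simp [dd, e_one]
lemma dd_f (j : I) (u : U) : S.dd hG i (S.f j * u) = S.f j * S.dd hG i u + if j = i then u else 0 := by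
  simp only [dd, LinearMap.sub_apply, e_f]
  split_ifs with h
  · simp only [SAlg.h, LinearMap.sub_apply, LinearMap.smul_apply]; simp; noncomm_ring
  · noncomm_ring
lemma dd_G {ν : I → ℤ} {u : U} (hu : u ∈ S.G ν) : S.dd hG i u ∈ S.G (ν - al i) :=
  sub_mem (S.e_G hG i _ hu) (S.e_G hG i _ hu)

lemma dd_fi (u : U) : S.dd hG i (u * S.f i) = S.dd hG i u * S.f i + u := by
  refine LinearMap.congr_fun (S.ext (S.dd hG i ∘ₗ LinearMap.mulRight ℚ (S.f i))
    (LinearMap.mulRight ℚ (S.f i) ∘ₗ S.dd hG i + LinearMap.id) ?_ ?_) u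
  · have := S.dd_f hG i i 1
    simpa [dd_one] using this
  · intro j u hu
    simp only [LinearMap.comp_apply, LinearMap.mulRight_apply, LinearMap.add_apply, LinearMap.id_apply] at hu ⊢
    rw [mul_assoc, dd_f, hu, dd_f]
    split_ifs <;> noncomm_ring

lemma h_fi (u : U) (la : I → ℚ) : S.h i la (u * S.f i) = S.h i la u * S.f i - (C i i : ℚ) • (u * S.f i) := by
  refine LinearMap.congr_fun (S.ext (S.h i la ∘ₗ LinearMap.mulRight ℚ (S.f i))
    (LinearMap.mulRight ℚ (S.f i) ∘ₗ S.h i la - (C i i : ℚ) • LinearMap.mulRight ℚ (S.f i)) ?_ ?_) u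
  · have := S.h_f i i la 1
    simpa [h_one] using this
  · intro j u hu
    simp only [LinearMap.comp_apply, LinearMap.mulRight_apply, LinearMap.sub_apply, LinearMap.smul_apply] at hu ⊢
    rw [mul_assoc, h_f, hu, h_f, mul_sub, sub_mul, mul_smul_comm, smul_mul_assoc, mul_assoc, mul_assoc]
    abel

lemma e_fi (u : U) : S.e hG i 0 (u * S.f i) = S.e hG i 0 u * S.f i - (2 : ℚ) • (S.dd hG i u * S.f i) := by
  refine LinearMap.congr_fun (S.ext (S.e hG i 0 ∘ₗ LinearMap.mulRight ℚ (S.f i))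
    (LinearMap.mulRight ℚ (S.f i) ∘ₗ S.e hG i 0 - (2 : ℚ) • LinearMap.mulRight ℚ (S.f i) ∘ₗ S.dd hG i) ?_ ?_) u
  · have := S.e_f hG i 0 i 1
    simp [e_one, h_one] at this
    simp [e_one, dd_one, this]
  · intro j u hu
    simp only [LinearMap.comp_apply, LinearMap.mulRight_apply, LinearMap.sub_apply, LinearMap.smul_apply] at hu ⊢
    rw [mul_assoc, e_f, hu, e_f, dd_f, h_fi, hG.d]
    split_ifs
    · simp only [mul_sub, add_mul, mul_smul_comm, mul_assoc, smul_add]; push_cast; abel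
    · simp only [mul_sub, mul_smul_comm, mul_assoc, add_zero]

lemma dd_h (u : U) : S.dd hG i (S.h i 0 u) = S.h i 0 (S.dd hG i u) - (2 : ℚ) • S.dd hG i u := by
  refine LinearMap.congr_fun (S.ext (S.dd hG i ∘ₗ S.h i 0) (S.h i 0 ∘ₗ S.dd hG i - (2 : ℚ) • S.dd hG i) ?_ ?_) u
  · simp [h_one, dd_one]
  · intro j u hu
    simp only [LinearMap.comp_apply, LinearMap.sub_apply, LinearMap.smul_apply] at hu ⊢
    rw [h_f, map_sub, map_smul, dd_f, hu, dd_f, map_add, h_f]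
    split_ifs with h
    · subst h; rw [hG.d, mul_sub, mul_smul_comm]; push_cast; module
    · rw [mul_sub, mul_smul_comm, map_zero]; module

lemma dd_e (u : U) : S.dd hG i (S.e hG i 0 u) = S.e hG i 0 (S.dd hG i u) - S.dd hG i (S.dd hG i u) := by
  refine LinearMap.congr_fun (S.ext (S.dd hG i ∘ₗ S.e hG i 0) (S.e hG i 0 ∘ₗ S.dd hG i - S.dd hG i ∘ₗ S.dd hG i) ?_ ?_) u
  · simp [e_one, dd_one]
  · intro j u hu
    simp only [LinearMap.comp_apply, LinearMap.sub_apply] at hu ⊢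
    rw [e_f, map_add, dd_f, hu, dd_f, map_add, map_add, e_f, dd_f]
    split_ifs with h
    · rw [dd_h, mul_sub]; module
    · simp [mul_sub]

noncomputable def kd (ν : I → ℤ) : Submodule ℚ U := LinearMap.ker (S.dd hG i) ⊓ S.G ν
instance (ν : I → ℤ) : FiniteDimensional ℚ (S.kd hG i ν) := Submodule.finiteDimensional_inf_right _ _

lemma dd_pow (n : ℕ) (v : U) : S.dd hG i (S.f i ^ (n + 1) * v) =
    (n + 1 : ℚ) • (S.f i ^ n * v) + S.f i ^ (n + 1) * S.dd hG i v := by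
  induction n with
  | zero => simp [dd_f, add_comm]
  | succ n ih =>
    rw [pow_succ', mul_assoc, dd_f, ih, if_pos rfl, mul_add, mul_smul_comm, ← mul_assoc, ← pow_succ', ← mul_assoc]
    push_cast; module

lemma G_pow {ν : I → ℤ} {u : U} (hu : u ∈ S.G ν) (n : ℕ) : S.f i ^ n * u ∈ S.G (ν + (n : ℤ) • al i) := by
  induction n with
  | zero => simpa using hu
  | succ n ih =>
    rw [pow_succ', mul_assoc]
    have := S.G_f ih i
    rwa [add_assoc, show ((n : ℤ) • al i + al i : I → ℤ) = ((n + 1 : ℕ) : ℤ) • al i by push_cast; module] at this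

lemma dd_onto (p : ℕ) : ∀ (μ : I → ℤ) (v : U) (n : ℕ), v ∈ S.G μ → μ i < p →
    ∃ u ∈ S.G (μ + ((n + 1 : ℕ) : ℤ) • al i), S.dd hG i u = S.f i ^ n * v := by
  induction p with
  | zero =>
    intro μ v n hv hμ
    rw [S.G_bot (fun h => by have := h i; simp at this hμ; omega), Submodule.mem_bot] at hv
    exact ⟨0, zero_mem _, by simp [hv]⟩
  | succ p ih =>
    intro μ v n hv hμ
    obtain ⟨u, hu, hu2⟩ := ih (μ - al i) (S.dd hG i v) (n + 1) (S.dd_G hG i hv) (by simp [al]; push_cast at hμ; omega)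
    refine ⟨((n : ℚ) + 1)⁻¹ • (S.f i ^ (n + 1) * v - u), Submodule.smul_mem _ _ (sub_mem (S.G_pow i hv _) ?_), ?_⟩
    · convert hu using 2; push_cast; module
    · rw [map_smul, map_sub, dd_pow, hu2, add_sub_cancel_right, smul_smul, inv_mul_cancel₀ (by positivity), one_smul]

lemma kd_dim (ν : I → ℤ) : (Module.finrank ℚ (S.kd hG i ν) : ℚ) = S.dm ν - S.dm (ν - al i) := by
  let φ : S.G ν →ₗ[ℚ] S.G (ν - al i) := (S.dd hG i).restrict fun u hu => S.dd_G hG i hu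
  have h1 := φ.finrank_range_add_finrank_ker
  have h2 : LinearMap.range φ = ⊤ := by
    rw [LinearMap.range_eq_top]
    rintro ⟨v, hv⟩
    obtain ⟨u, hu, hu2⟩ := S.dd_onto hG i (((ν - al i) i).toNat + 1) _ v 0 hv (by omega)
    refine ⟨⟨u, by simpa using hu⟩, Subtype.ext ?_⟩
    change S.dd hG i u = v
    rw [hu2]; simp
  have h3 : Module.finrank ℚ (LinearMap.ker φ) = Module.finrank ℚ (S.kd hG i ν) := by
    have : (LinearMap.ker φ).map (S.G ν).subtype = S.kd hG i ν := by
      ext u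
      simp only [Submodule.mem_map, LinearMap.mem_ker, kd, Submodule.mem_inf]
      constructor
      · rintro ⟨⟨u, hu⟩, h, rfl⟩
        exact ⟨congrArg Subtype.val h, hu⟩
      · rintro ⟨h, hu⟩
        exact ⟨⟨u, hu⟩, Subtype.ext h, rfl⟩
    rw [← this, Submodule.finrank_map_subtype_eq]
  rw [h2, finrank_top, h3] at h1
  simp only [dm]
  rw [← h1]; push_cast; ring

lemma kd_le (ν : I → ℤ) : Module.finrank ℚ (S.kd hG i ν) ≤ Module.finrank ℚ (S.kd hG i (ν - pr C i ν • al i)) := by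
  let f : Module.End ℚ U := LinearMap.mulLeft ℚ (S.f i) - LinearMap.mulRight ℚ (S.f i)
  let e := S.e hG i 0
  let h := S.h i 0
  let K := LinearMap.ker (S.dd hG i)
  have f_app : ∀ u, f u = S.f i * u - u * S.f i := fun _ => rfl
  have Kf : ∀ v ∈ K, f v ∈ K := by
    intro v hv
    have hv : S.dd hG i v = 0 := hv
    change S.dd hG i (f v) = 0
    rw [f_app, map_sub, dd_f, dd_fi, hv]; simp
  have Ke : ∀ v ∈ K, e v ∈ K := by
    intro v hv
    have hv : S.dd hG i v = 0 := hv
    change S.dd hG i (e v) = 0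
    rw [S.dd_e, hv]; simp
  have ef : ∀ v ∈ K, e (f v) = f (e v) + h v := by
    intro v hv
    have hv : S.dd hG i v = 0 := hv
    simp only [f_app, e, h, map_sub, e_f, e_fi, hv]; simp; abel
  have he : ∀ v ∈ K, h (e v) = e (h v) + (2 : ℚ) • e v := by
    intro v hv
    have := congrArg (fun a : EE I U => a 0 v) ((S.K hG).he i i)
    simp only [lie_app] at this
    change h (e v) - e (h v) = (C i i : ℚ) • e v at this
    rw [hG.d] at this
    rw [← sub_eq_iff_eq_add', this]; simp
  have hf : ∀ v ∈ K, h (f v) = f (h v) - (2 : ℚ) • f v := by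
    intro v hv
    simp only [f_app, h, map_sub, h_f, h_fi, hG.d]; push_cast; module
  have Gf : ∀ (n : ℕ) μ v, v ∈ S.kd hG i μ → (f ^ n) v ∈ S.kd hG i (μ + (n : ℤ) • al i) := by
    intro n μ v hv
    induction n with
    | zero => simpa using hv
    | succ n ih =>
      rw [pow_succ', Module.End.mul_apply]
      refine ⟨Kf _ ih.1, ?_⟩
      rw [f_app]
      have e1 : μ + (n : ℤ) • al i + al i = μ + ((n + 1 : ℕ) : ℤ) • al i := by push_cast; module
      refine sub_mem (e1 ▸ S.G_f ih.2 i) ?_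
      generalize (f ^ n) v = w at ih
      refine S.G_ind (p := fun w => w * S.f i ∈ S.G (μ + ((n + 1 : ℕ) : ℤ) • al i)) ih.2 (by simp) ?_ ?_ ?_
      · intro x y hx hy; rw [add_mul]; exact add_mem hx hy
      · intro a x hx; rw [smul_mul_assoc]; exact Submodule.smul_mem _ _ hx
      · intro l hl
        have h1 : S.F (l ++ [i]) = S.F l * S.f i := by simp [F]
        have h2 : cnt (l ++ [i]) = cnt l + al i := by
          rw [← cnt_cons i l]; funext j; simp only [cnt]; norm_cast
          exact List.Perm.count_eq (by simp [List.perm_append_singleton]) j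
        rw [← h1, ← e1, ← hl, ← h2]; exact S.F_mem _
  have Ge : ∀ (n : ℕ) μ v, v ∈ S.kd hG i μ → (e ^ n) v ∈ S.kd hG i (μ - (n : ℤ) • al i) := by
    intro n μ v hv
    induction n with
    | zero => simpa using hv
    | succ n ih =>
      rw [pow_succ', Module.End.mul_apply]
      refine ⟨Ke _ ih.1, ?_⟩
      have := S.e_G hG i 0 ih.2
      rwa [show μ - (n : ℤ) • al i - al i = μ - ((n + 1 : ℕ) : ℤ) • al i by push_cast; module] at this
  have main : ∀ (T : Module.End ℚ U) (μ : I → ℤ), (∀ v ∈ S.kd hG i ν, T v ∈ S.kd hG i μ) →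
      (∀ v ∈ S.kd hG i ν, T v = 0 → v = 0) → Module.finrank ℚ (S.kd hG i ν) ≤ Module.finrank ℚ (S.kd hG i μ) := by
    intro T μ h1 h2
    refine LinearMap.finrank_le_finrank_of_injective (f := T.restrict h1) ?_
    rw [injective_iff_map_eq_zero]
    intro v hv
    exact Subtype.ext (h2 v v.2 (congrArg Subtype.val hv))
  rcases le_total (pr C i ν) 0 with hp | hp
  · obtain ⟨m, hm⟩ := Int.eq_ofNat_of_zero_le (neg_nonneg.2 hp)
    have e2 : ν - pr C i ν • al i = ν + (m : ℤ) • al i := by rw [← hm]; module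
    rw [e2]
    refine main (f ^ m) _ (Gf m ν) fun v hv hv0 => ?_
    refine sl2_inj K e f h Ke Kf ef he hf ((ν i).toNat + 1) m m v hv.1 ?_ ?_ le_rfl hv0
    · rw [S.h_G i 0 hv.2]; congr 1
      have : (m : ℚ) = -(pr C i ν : ℚ) := by exact_mod_cast hm.symm
      simp [this]
    · have : _ ∈ S.G _ := (Ge ((ν i).toNat + 1) ν v hv).2
      rwa [S.G_bot, Submodule.mem_bot] at this
      intro h0; have := h0 i; simp [al] at this
  · obtain ⟨m, hm⟩ := Int.eq_ofNat_of_zero_le hp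
    rw [hm]
    refine main (e ^ m) _ (Ge m ν) fun v hv hv0 => ?_
    obtain ⟨p, hp⟩ := S.loc_nilp i v
    have hfp : ∀ n, (f ^ n) v = adp (S.f i) n v := by
      intro n
      induction n with
      | zero => rfl
      | succ n ih => rw [pow_succ', Module.End.mul_apply, ih, adp_succ]; rfl
    refine sl2_inj K f e (-h) Kf Ke (fun v hv => by rw [ef v hv]; simp) (fun v hv => ?_) (fun v hv => ?_) p m m v hv.1
      ?_ ((hfp p).trans hp) le_rfl hv0
    · simp only [LinearMap.neg_apply, hf v hv, map_neg]; module
    · simp only [LinearMap.neg_apply, he v hv, map_neg]; module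
    · rw [LinearMap.neg_apply, S.h_G i 0 hv.2, hm]; simp

noncomputable def kk (ν : I → ℤ) : ℚ := S.dm ν - S.dm (ν - al i)
include hG in
lemma kk_s (ν : I → ℤ) : S.kk i (ν - pr C i ν • al i) = S.kk i ν := by
  rw [kk, kk, ← S.kd_dim hG, ← S.kd_dim hG]
  refine congrArg _ (le_antisymm ?_ (S.kd_le hG i ν))
  have := S.kd_le hG i (ν - pr C i ν • al i)
  rwa [pr_sub, pr_smul, pr_al, hG.d, show ν - pr C i ν • al i - (pr C i ν - pr C i ν * 2) • al i = ν by module] at this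
lemma kk_bot {ν : I → ℤ} (h : ¬ 0 ≤ ν) : S.kk i ν = 0 := by
  rw [kk, S.dm_bot h, S.dm_bot, sub_zero]
  intro h'
  refine h fun j => ?_
  have := h' j
  have h2 : (0 : ℤ) ≤ al i j := (Pi.single_nonneg.2 zero_le_one : (0 : I → ℤ) ≤ al i) j
  simp at this h2 ⊢; linarith
include hG in
lemma kk_al (n : ℤ) : S.kk i (n • al i) = if n = 0 then 1 else 0 := by
  split_ifs with h
  · rw [h, zero_smul, kk, S.dm_zero hG, S.dm_bot, sub_zero]
    intro h; have := h i; simp [al] at this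
  · rcases lt_or_gt_of_ne h with h | h
    · refine S.kk_bot i fun h0 => ?_
      have := h0 i; simp [al] at this; omega
    · rw [← S.kk_s hG, pr_smul, pr_al, hG.d]
      refine S.kk_bot i fun h0 => ?_
      have := h0 i; simp [al] at this; omega

include hG in
lemma c_s (c : (I → ℤ) → ℚ) (cp : ∀ β, c β ≠ 0 → 0 ≤ β)
    (hc : ∀ ν, 0 ≤ ν → ∑ β ∈ Icc 0 ν, c β * S.dm (ν - β) = if ν = 0 then 1 else 0) (β : I → ℤ) :
    c (Crys.rf C i 1 β) = - c β := by
  have supp : ∀ (g : (I → ℤ) → ℚ), (∀ μ, ¬ 0 ≤ μ → g μ = 0) → ∀ ν,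
      (Function.support fun β => c β * g (ν - β)) ⊆ (Icc 0 ν : Finset (I → ℤ)) := by
    intro g hg ν β hβ
    rw [Function.mem_support] at hβ
    have h1 := cp β (left_ne_zero_of_mul hβ)
    have h2 : 0 ≤ ν - β := by by_contra h; exact right_ne_zero_of_mul hβ (hg _ h)
    simpa using ⟨h1, sub_nonneg.1 h2⟩
  have cd : ∀ ν, ∑ᶠ β, c β * S.dm (ν - β) = if ν = 0 then 1 else 0 := by
    intro ν
    rw [finsum_eq_sum_of_support_subset _ (supp _ (fun _ h => S.dm_bot h) ν)]
    by_cases h : 0 ≤ ν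
    · exact hc ν h
    · rw [Icc_eq_empty (fun h' => h h'), sum_empty, if_neg]; rintro rfl; exact h le_rfl
  have fs : ∀ (g : (I → ℤ) → ℚ), (∀ μ, ¬ 0 ≤ μ → g μ = 0) → ∀ ν, (Function.support fun β => c β * g (ν - β)).Finite :=
    fun g hg ν => (Finset.finite_toSet _).subset (supp g hg ν)
  have ck : ∀ ν, ∑ᶠ β, c β * S.kk i (ν - β) = (if ν = 0 then 1 else 0) - if ν = al i then 1 else 0 := by
    intro ν
    have h1 := cd (ν - al i)
    simp only [sub_eq_zero] at h1
    rw [← h1, ← cd, ← finsum_sub_distrib (fs _ (fun _ h => S.dm_bot h) _) (fs _ (fun _ h => S.dm_bot h) _)]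
    refine finsum_congr fun β => ?_
    rw [kk, sub_right_comm ν, mul_sub]
  let s := Crys.rf C i (1 : I → ℤ)
  have s_eq : ∀ β, s β = β + (1 - pr C i β) • al i := fun β => rfl
  have pal : ∀ (n : ℤ) , pr C i (n • al i) = 2 * n := fun n => by rw [pr_smul, pr_al, hG.d, mul_comm]
  have ss : ∀ β, s (s β) = β := fun β => by
    rw [s_eq (s β), s_eq β, pr_add, pal]; module
  have hk : ∀ ν β, S.kk i (ν - s β) = S.kk i (s ν - β) := by
    intro ν β
    rw [← S.kk_s hG i (ν - s β), s_eq, s_eq, pr_sub, pr_add, pal]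
    congr 1; module
  have ck2 : ∀ ν, ∑ᶠ β, (c β + c (s β)) * S.kk i (ν - β) = 0 := by
    intro ν
    have e0 : ∑ᶠ β, c (s β) * S.kk i (ν - β) = ∑ᶠ β, c β * S.kk i (s ν - β) := by
      rw [← finsum_comp_equiv (⟨s, s, ss, ss⟩ : (I → ℤ) ≃ (I → ℤ))]
      refine finsum_congr fun β => ?_
      change c (s (s β)) * S.kk i (ν - s β) = _
      rw [ss, hk]
    have f2 : (Function.support fun β => c (s β) * S.kk i (ν - β)).Finite := by
      refine ((fs _ (fun _ h => S.kk_bot i h) (s ν)).image s).subset fun β hβ => ⟨s β, ?_, ss β⟩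
      rw [Function.mem_support] at hβ ⊢
      rwa [← hk, ss]
    simp only [add_mul]
    rw [finsum_add_distrib (fs _ (fun _ h => S.kk_bot i h) _) f2, e0, ck, ck]
    have h1 : s ν = 0 ↔ ν = al i := by
      constructor
      · intro h; rw [← ss ν, h, s_eq, pr_zero]; simp
      · rintro rfl; rw [s_eq, pr_al, hG.d]; module
    have h2 : s ν = al i ↔ ν = 0 := by
      constructor
      · intro h; rw [← ss ν, h, s_eq, pr_al, hG.d]; module
      · rintro rfl; rw [s_eq, pr_zero]; simp
    simp only [h1, h2]; ring
  let o : (I → ℤ) → ℤ := fun β => ∑ j ∈ univ.erase i, β j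
  have os : ∀ β, o (s β) = o β := by
    intro β
    refine sum_congr rfl fun j hj => ?_
    simp [s_eq, al, ne_of_mem_erase hj]
  have key : ∀ β, c β + c (s β) = 0 := by
    intro β
    by_cases ho : o β < 0
    · have : ∀ β, o β < 0 → c β = 0 := by
        intro β h; by_contra hc0
        have : 0 ≤ o β := sum_nonneg fun j _ => cp β hc0 j
        omega
      rw [this β ho, this (s β) (by rwa [os]), add_zero]
    · push Not at ho
      induction hn : (o β).toNat using Nat.strong_induction_on generalizing β with
      | _ n ih =>
        have h1 := ck2 β
        rw [finsum_eq_single _ β] at h1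
        · rw [sub_self] at h1
          have := S.kk_al hG i 0
          rw [zero_smul, if_pos rfl] at this
          rwa [this, mul_one] at h1
        · intro δ hδ
          by_cases hk0 : S.kk i (β - δ) = 0
          · rw [hk0, mul_zero]
          have hp : 0 ≤ β - δ := by by_contra h; exact hk0 (S.kk_bot i h)
          by_cases hod : o δ < 0
          · have : ∀ β, o β < 0 → c β = 0 := by
              intro β h; by_contra hc0
              have : 0 ≤ o β := sum_nonneg fun j _ => cp β hc0 j
              omega
            rw [this δ hod, this (s δ) (by rwa [os]), add_zero, zero_mul]
          push Not at hod
          rw [ih (o δ).toNat ?_ δ hod rfl, zero_mul]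
          have hle : ∀ j ∈ univ.erase i, δ j ≤ β j := fun j _ => by have := hp j; simpa using this
          suffices o δ < o β by omega
          refine lt_of_le_of_ne (sum_le_sum hle) fun heq => hk0 ?_
          have := (sum_eq_sum_iff_of_le hle).1 heq
          have e1 : β - δ = (β i - δ i) • al i := by
            ext j
            by_cases hj : j = i
            · simp [hj, al]
            · simp [al, hj, this j (mem_erase.2 ⟨hj, mem_univ j⟩)]
          rw [e1, S.kk_al hG, if_neg]
          intro h0
          rw [h0, zero_smul, sub_eq_zero] at e1
          exact hδ e1.symm
  have := key β
  change c (s β) = _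
  linarith
end SAlg
end
end KS

namespace KS
open Finset
set_option linter.unusedSectionVars false
section
variable {I E0 : Type} [Fintype I] [DecidableEq I] [Fintype E0] (a b : E0 → I)

lemma gcm (hn : ∀ x, a x ≠ b x) : GCM (gCartan a b) where
  d i := by
    have : IsEmpty {x : E0 // (a x = i ∧ b x = i) ∨ (a x = i ∧ b x = i)} :=
      ⟨fun x => hn x.1 (by rcases x.2 with h | h <;> rw [h.1, h.2])⟩
    simp only [gCartan, if_true, Nat.card_of_isEmpty]; rfl
  s i j := by simp only [gCartan, eq_comm, or_comm]
  o i j h := by simp [gCartan, h]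

noncomputable def salg : SAlg (gCartan a b) (UPlusQ E0 a b) where
  f := eQ a b
  serre i j h := by
    have := RingQuot.mkAlgHom_rel ℚ (SerreRelQ.serre (a := a) (b := b) i j h)
    simp only [map_sum, map_smul, map_mul, map_pow, map_zero] at this
    have h2 := (adp_serre (eQ a b i) (eQ a b j) (1 - gCartan a b i j).toNat)
    rw [eQ, eQ] at h2
    rw [this] at h2
    exact (smul_eq_zero.1 h2.symm).resolve_left (pow_ne_zero _ (by norm_num))
  lift A _ _ g hg := by
    refine ⟨RingQuot.liftAlgHom ℚ ⟨FreeAlgebra.lift ℚ g, ?_⟩, fun i => ?_⟩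
    · rintro _ _ ⟨i, j, h⟩
      simp only [map_sum, map_smul, map_mul, map_pow, map_zero, FreeAlgebra.lift_ι_apply]
      rw [adp_serre, hg i j h, smul_zero]
    · rw [eQ, RingQuot.liftAlgHom_mkAlgHom_apply, FreeAlgebra.lift_ι_apply]
  gen u := by
    obtain ⟨u, rfl⟩ := RingQuot.mkAlgHom_surjective ℚ (SerreRelQ a b) u
    have hm : ∀ (l : List I) u, u ∈ Submodule.span ℚ (Set.range fun l : List I => (l.map (eQ a b)).prod) →
      (l.map (eQ a b)).prod * u ∈ Submodule.span ℚ (Set.range fun l : List I => (l.map (eQ a b)).prod) := by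
      intro l u hu
      induction hu using Submodule.span_induction with
      | mem x hx => obtain ⟨m, rfl⟩ := hx; exact Submodule.subset_span ⟨l ++ m, by simp⟩
      | zero => simp
      | add x y _ _ hx hy => rw [mul_add]; exact add_mem hx hy
      | smul c x _ hx => rw [mul_smul_comm]; exact Submodule.smul_mem _ _ hx
    induction u using FreeAlgebra.induction with
    | grade0 r =>
      rw [AlgHom.commutes, Algebra.algebraMap_eq_smul_one]
      exact Submodule.smul_mem _ _ (Submodule.subset_span ⟨[], by simp⟩)
    | grade1 i => exact Submodule.subset_span ⟨[i], by simp [eQ]⟩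
    | mul x y hx hy =>
      rw [map_mul]
      generalize RingQuot.mkAlgHom ℚ (SerreRelQ a b) x = x' at hx ⊢
      induction hx using Submodule.span_induction with
      | mem x hx => obtain ⟨m, rfl⟩ := hx; exact hm m _ hy
      | zero => simp
      | add x y _ _ hx hy => rw [add_mul]; exact add_mem hx hy
      | smul c x _ hx => rw [smul_mul_assoc]; exact Submodule.smul_mem _ _ hx
    | add x y hx hy => rw [map_add]; exact add_mem hx hy

theorem partA (hn : ∀ x, a x ≠ b x) (K : Crys (gCartan a b)) (ν : I → ℕ) :
    Module.finrank ℚ (gradeQ a b ν) = K.cnt Set.univ (fun i => (ν i : ℤ)) := by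
  let S := salg a b
  have hG := gcm a b hn
  obtain ⟨c, cp, hc⟩ := conv_inv S.dm (S.dm_zero hG)
  have c0 : c 0 = 1 := by
    have := hc 0 le_rfl
    simpa [S.dm_zero hG] using this
  have hK := K.conv hG.d c c0 cp (fun i β => S.c_s hG i c cp hc β) (fun β => S.c_anti hG c hc cp β)
  have := conv_uniq c c0 (fun ν => S.dm ν - K.cnt Set.univ ν) (fun ν hν => by
    have h1 := hc ν hν
    have h2 := hK ν hν
    rw [conv_comm c S.dm] at h1
    rw [conv_comm c (fun ν => (K.cnt Set.univ ν : ℚ))] at h2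
    simp only [sub_mul, sum_sub_distrib, h1, h2, sub_self]) (fun i => ν i) (fun i => by simp)
  have h2 : gradeQ a b ν = S.G (fun i => ν i) := by
    refine congrArg _ (Set.ext fun u => exists_congr fun l => and_congr_left fun _ => ?_)
    simp [funext_iff, cnt]
  rw [h2]
  have h3 : S.dm (fun i => ν i) = K.cnt Set.univ (fun i => (ν i : ℤ)) := sub_eq_zero.1 this
  unfold SAlg.dm at h3
  exact_mod_cast h3
end
end KS

namespace KS
open MvPolynomial
section
variable {σ : Type} {K : Type} [CommRing K] [Algebra ℂ K]

noncomputable def td (P : Ideal (MvPolynomial σ ℂ)) : Cardinal := Algebra.trdeg ℂ (MvPolynomial σ ℂ ⧸ P)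

noncomputable def pid (f : σ → K) : Ideal (MvPolynomial σ ℂ) := RingHom.ker (aeval (R := ℂ) f)

lemma mem_pid (f : σ → K) (p) : p ∈ pid f ↔ aeval (R := ℂ) f p = 0 := Iff.rfl

lemma pid_le {L : Type} [CommRing L] [Algebra ℂ L] (f : σ → K) (φ : K →ₐ[ℂ] L) : pid f ≤ pid (φ ∘ f) := by
  intro p hp
  rw [mem_pid] at *
  have := (comp_aeval_apply (f := f) (φ := φ) p)
  rw [hp, map_zero] at this
  exact this.symm

lemma pid_eq {L : Type} [CommRing L] [Algebra ℂ L] (f : σ → K) (φ : K →ₐ[ℂ] L) (h : Function.Injective φ) :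
    pid (φ ∘ f) = pid f := by
  ext p
  rw [mem_pid, mem_pid]
  have := (comp_aeval_apply (f := f) (φ := φ) p)
  rw [← map_eq_zero_iff φ h, this]; rfl

instance [IsDomain K] (f : σ → K) : (pid f).IsPrime := RingHom.ker_isPrime _

noncomputable def gpt (P : Ideal (MvPolynomial σ ℂ)) (v : σ) : MvPolynomial σ ℂ ⧸ P := Ideal.Quotient.mk P (X v)

lemma aeval_gpt (P : Ideal (MvPolynomial σ ℂ)) : aeval (R := ℂ) (gpt P) = Ideal.Quotient.mkₐ ℂ P := by
  apply MvPolynomial.algHom_ext; intro i; simp [gpt]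

lemma pid_gpt (P : Ideal (MvPolynomial σ ℂ)) : pid (gpt P) = P := by
  ext p; rw [mem_pid, aeval_gpt]; exact Ideal.Quotient.eq_zero_iff_mem

noncomputable def ev {P : Ideal (MvPolynomial σ ℂ)} (f : σ → K) (h : P ≤ pid f) : (MvPolynomial σ ℂ ⧸ P) →ₐ[ℂ] K :=
  Ideal.Quotient.liftₐ P (aeval f) h

lemma ev_gpt {P : Ideal (MvPolynomial σ ℂ)} (f : σ → K) (h : P ≤ pid f) : ev f h ∘ gpt P = f := by
  ext v; exact (Ideal.Quotient.liftₐ_apply P (aeval f) h _).trans ((Ideal.Quotient.lift_mk P _ _).trans (aeval_X f v))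

lemma ev_inj {P : Ideal (MvPolynomial σ ℂ)} (f : σ → K) (h : P = pid f) : Function.Injective (ev f h.le) := by
  subst h
  exact RingHom.kerLift_injective (aeval (R := ℂ) f).toRingHom

lemma td_mono {P Q : Ideal (MvPolynomial σ ℂ)} (h : P ≤ Q) : td Q ≤ td P :=
  trdeg_le_of_surjective (Ideal.Quotient.factorₐ ℂ h) (Ideal.Quotient.factor_surjective h)

lemma td_eq [Finite σ] {P Q : Ideal (MvPolynomial σ ℂ)} [P.IsPrime] [Q.IsPrime] (h : P ≤ Q) (ht : td P ≤ td Q) : P = Q := by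
  refine le_antisymm h fun q hq => ?_
  by_contra hp
  let φ := Ideal.Quotient.factorₐ ℂ h
  obtain ⟨ι, x, hx⟩ := exists_isTranscendenceBasis' ℂ (MvPolynomial σ ℂ ⧸ Q)
  choose y hy using fun i => Ideal.Quotient.factor_surjective h (x i)
  have hxy : φ ∘ y = x := funext hy
  have hyi : AlgebraicIndependent ℂ y := AlgebraicIndependent.of_comp φ (hxy ▸ hx.1)
  have hb : IsTranscendenceBasis ℂ y := hyi.isTranscendenceBasis_of_trdeg_le
    trdeg_lt_aleph0_of_finiteType (ht.trans_eq hx.cardinalMk_eq_trdeg.symm)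
  have ha := hb.isAlgebraic.1 (Ideal.Quotient.mk P q)
  obtain ⟨r, hr, d⟩ := ha.exists_nonzero_dvd
    (mem_nonZeroDivisors_of_ne_zero (mt Ideal.Quotient.eq_zero_iff_mem.1 hp))
  obtain ⟨r, hr'⟩ := r
  rw [Algebra.adjoin_range_eq_range_aeval] at hr'
  obtain ⟨p, rfl⟩ := hr'
  have h1 : φ (aeval y p) = 0 := by
    have h2 : φ (Ideal.Quotient.mk P q) = 0 := Ideal.Quotient.eq_zero_iff_mem.2 hq
    exact zero_dvd_iff.1 (h2 ▸ map_dvd φ d)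
  have h3 := comp_aeval_apply (R := ℂ) (f := y) (φ := φ) p
  rw [h1] at h3
  have h4 := hx.1 (a₁ := p) (a₂ := 0) (by rw [map_zero, ← hxy]; exact h3.symm)
  exact hr (Subtype.ext (by simp [h4]))

lemma trdeg_alg {A K : Type} [CommRing A] [IsDomain A] [Algebra ℂ A] [CommRing K] [IsDomain K] [Algebra ℂ K] [Algebra A K]
    [IsScalarTower ℂ A K] (h : Function.Injective (algebraMap A K)) [Algebra.IsAlgebraic A K] :
    Algebra.trdeg ℂ A = Algebra.trdeg ℂ K := by
  have : FaithfulSMul A K := (faithfulSMul_iff_algebraMap_injective _ _).2 h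
  have := trdeg_add_eq ℂ A (A := K)
  rwa [trdeg_eq_zero (R := A), add_zero] at this

lemma td_adj {K : Type} [Field K] [Algebra ℂ K] (f : σ → K) (h : IntermediateField.adjoin ℂ (Set.range f) = ⊤) :
    td (pid f) = Algebra.trdeg ℂ K := by
  let φ := ev f (le_refl (pid f))
  let _ := φ.toRingHom.toAlgebra
  have : IsScalarTower ℂ (MvPolynomial σ ℂ ⧸ pid f) K := IsScalarTower.of_algebraMap_eq fun x => (φ.commutes x).symm
  have : Algebra.IsAlgebraic (MvPolynomial σ ℂ ⧸ pid f) K := ⟨fun x => by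
    have hx : x ∈ IntermediateField.adjoin ℂ (Set.range f) := h ▸ IntermediateField.mem_top
    obtain ⟨r, s, rfl⟩ := (IntermediateField.mem_adjoin_range_iff ℂ f x).1 hx
    have e : ∀ r, aeval (R := ℂ) f r = algebraMap (MvPolynomial σ ℂ ⧸ pid f) K (Ideal.Quotient.mk _ r) := fun r => rfl
    rw [e, e, div_eq_mul_inv]
    exact isAlgebraic_algebraMap _ |>.mul (isAlgebraic_algebraMap _).inv⟩
  exact trdeg_alg (ev_inj f rfl)

lemma trdeg_fr (κ R : Type) [Finite κ] [CommRing R] [IsDomain R] [Algebra ℂ R] :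
    Algebra.trdeg ℂ (FractionRing (MvPolynomial κ R)) = Algebra.trdeg ℂ R + Nat.card κ := by
  have h1 := trdeg_add_eq ℂ R (A := MvPolynomial κ R)
  have : Algebra.IsAlgebraic (MvPolynomial κ R) (FractionRing (MvPolynomial κ R)) :=
    IsLocalization.isAlgebraic (FractionRing (MvPolynomial κ R)) (nonZeroDivisors (MvPolynomial κ R))
  rw [MvPolynomial.trdeg_of_isDomain] at h1
  rw [← trdeg_alg (IsFractionRing.injective (MvPolynomial κ R) (FractionRing (MvPolynomial κ R))), ← h1, Cardinal.lift_id, Nat.cast_card]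

open Matrix in
lemma exists_minor {m C K : Type} [Fintype m] [DecidableEq m] [Fintype C] [Field K] (A : Matrix m C K)
    (h : ∀ v, v ᵥ* A = 0 → v = 0) : ∃ s : m → C, (A.submatrix id s).det ≠ 0 := by
  have hr : LinearIndependent K A.row := vecMul_injective_iff.1 fun x y e => by
    rw [← sub_eq_zero]; apply h; simpa [sub_vecMul, sub_eq_zero] using e
  obtain ⟨κ, a, ha, hsp, hli⟩ := exists_linearIndependent' K A.col
  have := Fintype.ofInjective a ha
  have hc : Fintype.card κ = Fintype.card m := by
    rw [← hr.rank_matrix, A.rank_eq_finrank_span_cols, ← hsp, finrank_span_eq_card hli]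
  let e := Fintype.equivOfCardEq hc
  refine ⟨a ∘ e.symm, fun h0 => ?_⟩
  have : LinearIndependent K (A.submatrix id (a ∘ e.symm)).col := hli.comp e.symm e.symm.injective
  rw [linearIndependent_cols_iff_isUnit, isUnit_iff_isUnit_det, h0] at this
  simp at this

lemma rank_semi {m C R K L : Type} [Fintype m] [Fintype C] [CommRing R] [Field K] [Field L]
    (A : Matrix m C R) (φ : R →+* K) (ψ : R →+* L) (hψ : Function.Injective ψ) : (A.map φ).rank ≤ (A.map ψ).rank := by
  classical
  obtain ⟨κ, a, ha, hsp, hli⟩ := exists_linearIndependent' K (A.map φ).row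
  have := Fintype.ofInjective a ha
  obtain ⟨s, hs⟩ := exists_minor ((A.map φ).submatrix a id) fun v hv =>
    (Matrix.vecMul_injective_iff.2 hli) (hv.trans (Matrix.zero_vecMul _).symm)
  have h1 : ((A.submatrix a s).map ψ).det ≠ 0 := by
    rw [← RingHom.mapMatrix_apply, ← RingHom.map_det, Ne, map_eq_zero_iff _ hψ]
    intro h
    apply hs
    have := RingHom.map_det φ (A.submatrix a s)
    rw [h, map_zero] at this
    exact this.symm
  rw [Matrix.rank_eq_finrank_span_row, ← hsp, finrank_span_eq_card hli, ← Matrix.rank_of_det_ne_zero h1]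
  exact Matrix.rank_submatrix_le (A.map ψ) a s
end
end KS

namespace KS
open Matrix
set_option linter.unusedSectionVars false

structure Qv (I Q : Type) where
  src : Q → I
  tgt : Q → I
  bar : Q → Q
  sg : Q → ℤ
  bb : ∀ ρ, bar (bar ρ) = ρ
  sb : ∀ ρ, src (bar ρ) = tgt ρ
  nl : ∀ ρ, src ρ ≠ tgt ρ
  sg0 : ∀ ρ, sg ρ = 1 ∨ sg ρ = -1
variable {I Q : Type} [DecidableEq I] [Fintype Q] [DecidableEq Q] (q : Qv I Q)
lemma Qv.tb (ρ : Q) : q.tgt (q.bar ρ) = q.src ρ := by rw [← q.sb, q.bb]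

abbrev Pt (Q T R : Type) := Q → Matrix T T R

def co {T R : Type} (z : Pt Q T R) (v : Q × T × T) : R := z v.1 v.2.1 v.2.2

def mp {T R S : Type} (φ : R → S) (z : Pt Q T R) : Pt Q T S := fun ρ => (z ρ).map φ

def st {T R : Type} (z : Pt Q T R) : Pt Q T R := fun ρ => (z (q.bar ρ))ᵀ
lemma st_st {T R : Type} (z : Pt Q T R) : st q (st q z) = z := by
  funext ρ; simp [st, q.bb]
noncomputable abbrev pd {T R : Type} [CommRing R] [Algebra ℂ R] (z : Pt Q T R) := pid (co z)

def gd {T T' R : Type} [Zero R] (δ : T → I) (δ' : T' → I) (M : Matrix T T' R) : Prop := ∀ s t, M s t ≠ 0 → δ s = δ' t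

section
variable {T T' S R : Type} [Fintype T] [DecidableEq T] [Fintype T'] [DecidableEq T'] [CommRing R]
  {δ : T → I} {δ' : T' → I} {δ'' : S → I}

lemma exists_mul_ne {M : Matrix S T R} {N : Matrix T T' R} {s t} (h : (M * N) s t ≠ 0) : ∃ r, M s r ≠ 0 ∧ N r t ≠ 0 := by
  obtain ⟨r, -, hr⟩ := Finset.exists_ne_zero_of_sum_ne_zero (by rwa [mul_apply] at h)
  exact ⟨r, left_ne_zero_of_mul hr, right_ne_zero_of_mul hr⟩

lemma gd.mul {M : Matrix S T R} {N : Matrix T T' R} (hM : gd δ'' δ M) (hN : gd δ δ' N) : gd δ'' δ' (M * N) := fun s t h => by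
  obtain ⟨r, h1, h2⟩ := exists_mul_ne h
  exact (hM s r h1).trans (hN r t h2)
lemma gd.tr {M : Matrix T T' R} (hM : gd δ δ' M) : gd δ' δ Mᵀ := fun s t h => (hM t s h).symm
lemma gd.one : gd δ δ (1 : Matrix T T R) := fun s t h => by
  by_contra h'; exact h (one_apply_ne fun e => h' (e ▸ rfl))
lemma gd.sub {M N : Matrix T T' R} (hM : gd δ δ' M) (hN : gd δ δ' N) : gd δ δ' (M - N) := fun s t h => by
  by_cases h1 : M s t = 0
  · exact hN s t fun h2 => h (by simp [h1, h2])
  · exact hM s t h1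

structure Lam (δ : T → I) (z : Pt Q T R) : Prop where
  gr : ∀ ρ s t, z ρ s t ≠ 0 → δ s = q.tgt ρ ∧ δ t = q.src ρ
  mo : ∑ ρ, q.sg ρ • (z ρ * z (q.bar ρ)) = 0
  nil : ∃ N, ∀ l : List Q, l.length = N → (l.map z).prod = 0

variable {q}
lemma Lam.st {z : Pt Q T R} (h : Lam q δ z) : Lam q δ (st q z) where
  gr ρ s t hz := by have := h.gr _ _ _ hz; rw [q.tb, q.sb] at this; exact this.symm
  mo := by
    have := congrArg transpose h.mo
    simpa only [KS.st, transpose_sum, transpose_smul, transpose_mul, q.bb, transpose_zero] using this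
  nil := by
    obtain ⟨N, hN⟩ := h.nil
    refine ⟨N, fun l hl => ?_⟩
    have := congrArg transpose (hN (l.reverse.map q.bar) (by simpa))
    rw [transpose_list_prod] at this
    show (l.map fun ρ => (z (q.bar ρ))ᵀ).prod = 0
    simpa [Function.comp_def] using this

lemma prod_comm {z : Pt Q T R} {x : Pt Q T' R} {J : Matrix T T' R} (c : ∀ ρ, z ρ * J = J * x ρ) (l : List Q) :
    (l.map z).prod * J = J * (l.map x).prod := by
  induction l with
  | nil => simp
  | cons ρ l ih => simp [Matrix.mul_assoc, ih]; rw [← Matrix.mul_assoc, c, Matrix.mul_assoc]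

lemma Lam.sub {z : Pt Q T R} (h : Lam q δ z) {x : Pt Q T' R} {J : Matrix T T' R} {L : Matrix T' T R} (hJ : gd δ δ' J) (hL : gd δ' δ L)
    (LJ : L * J = 1) (c : ∀ ρ, z ρ * J = J * x ρ) : Lam q δ' x where
  gr ρ s t hx := by
    have : x ρ = L * z ρ * J := by rw [Matrix.mul_assoc, c, ← Matrix.mul_assoc, LJ, Matrix.one_mul]
    rw [this] at hx
    obtain ⟨r, h1, h2⟩ := exists_mul_ne hx
    obtain ⟨r', h3, h4⟩ := exists_mul_ne h1
    obtain ⟨h5, h6⟩ := h.gr _ _ _ h4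
    exact ⟨(hL _ _ h3).trans h5, (hJ _ _ h2).symm.trans h6⟩
  mo := by
    have : J * (∑ ρ, q.sg ρ • (x ρ * x (q.bar ρ))) = (∑ ρ, q.sg ρ • (z ρ * z (q.bar ρ))) * J := by
      rw [Matrix.mul_sum, Matrix.sum_mul]
      refine Finset.sum_congr rfl fun ρ _ => ?_
      rw [Matrix.mul_smul, Matrix.smul_mul, Matrix.mul_assoc, c, ← Matrix.mul_assoc, ← Matrix.mul_assoc, c]
    rw [h.mo, Matrix.zero_mul] at this
    rw [← Matrix.one_mul (∑ ρ, _), ← LJ, Matrix.mul_assoc, this, Matrix.mul_zero]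
  nil := by
    obtain ⟨N, hN⟩ := h.nil
    refine ⟨N, fun l hl => ?_⟩
    have := prod_comm c l
    rw [hN l hl, Matrix.zero_mul] at this
    rw [← Matrix.one_mul (List.prod _), ← LJ, Matrix.mul_assoc, ← this, Matrix.mul_zero]

lemma mp_prod {S : Type} [CommRing S] (φ : R →+* S) (z : Pt Q T R) (l : List Q) :
    (l.map (mp φ z)).prod = (l.map z).prod.map φ := by
  induction l with
  | nil => simp
  | cons ρ l ih => simp [ih, mp]

lemma mp_mo {S : Type} [CommRing S] (φ : R →+* S) (z : Pt Q T R) :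
    ∑ ρ, q.sg ρ • (mp φ z ρ * mp φ z (q.bar ρ)) = (∑ ρ, q.sg ρ • (z ρ * z (q.bar ρ))).map φ := by
  rw [← RingHom.mapMatrix_apply, map_sum]
  exact Finset.sum_congr rfl fun ρ _ => by rw [map_zsmul, map_mul]; rfl

lemma Lam.map {S : Type} [CommRing S] (φ : R →+* S) {z : Pt Q T R} (h : Lam q δ z) : Lam q δ (mp φ z) where
  gr ρ s t hz := h.gr ρ s t fun h0 => hz (by simp [mp, h0])
  mo := by rw [mp_mo, h.mo]; simp
  nil := by
    obtain ⟨N, hN⟩ := h.nil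
    exact ⟨N, fun l hl => by rw [mp_prod, hN l hl]; simp⟩

lemma Lam.of_map {S : Type} [CommRing S] (φ : R →+* S) (hφ : Function.Injective φ) {z : Pt Q T R} (h : Lam q δ (mp φ z)) : Lam q δ z where
  gr ρ s t hz := h.gr ρ s t (by simpa [mp] using (map_ne_zero_iff φ hφ).2 hz)
  mo := by
    apply Matrix.map_injective hφ
    have := h.mo
    rw [mp_mo] at this
    simpa using this
  nil := by
    obtain ⟨N, hN⟩ := h.nil
    refine ⟨N, fun l hl => Matrix.map_injective hφ ?_⟩
    have := hN l hl
    rw [mp_prod] at this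
    simpa using this
end
end KS

namespace KS
open Matrix
set_option linter.unusedSectionVars false
variable {I Q : Type} [DecidableEq I] [Fintype Q] [DecidableEq Q] {q : Qv I Q}
section
variable {T T' T₁ T₂ T₃ S R : Type} [Fintype T] [DecidableEq T] [Fintype T'] [DecidableEq T'] [Fintype T₁] [DecidableEq T₁]
  [Fintype T₂] [DecidableEq T₂] [Fintype T₃] [DecidableEq T₃] [Fintype S] [DecidableEq S] [CommRing R]
  {δ : T → I} {δ' : T' → I} {δ₁ : T₁ → I} {δ₂ : T₂ → I} {δ₃ : T₃ → I} {i j : I}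

def en (R : Type) [CommRing R] (δ : T → I) (i : I) : Matrix T T R := diagonal fun t => if δ t = i then 1 else 0
lemma gd.en {M : Matrix T T' R} (h : gd δ δ' M) (i : I) : en R δ i * M = M * en R δ' i := by
  ext s t
  simp only [KS.en, diagonal_mul, mul_diagonal]
  by_cases h0 : M s t = 0
  · simp [h0]
  · rw [h s t h0, mul_comm]
lemma mul_en {M : Matrix S T R} (h : ∀ s t, M s t ≠ 0 → δ t = i) : M * en R δ i = M := by
  ext s t
  simp only [KS.en, mul_diagonal]
  by_cases h0 : M s t = 0
  · simp [h0]
  · simp [h s t h0]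
lemma en_en : en R δ i * en R δ i = en R δ i := by
  simp only [en, diagonal_mul_diagonal]; congr 1; ext t; split_ifs <;> simp
lemma en_ne (h : j ≠ i) : en R δ i * en R δ j = 0 := by
  simp only [en, diagonal_mul_diagonal]; ext s t; simp only [diagonal_apply, Matrix.zero_apply]; split_ifs <;> simp_all
lemma en_tr : (en R δ i)ᵀ = en R δ i := by simp [en]
lemma en_map {R' : Type} [CommRing R'] (φ : R →+* R') : (en R δ i).map φ = en R' δ i := by
  ext s t; simp only [en, diagonal_apply, map_apply]; split_ifs <;> simp

def Sur (δ : T → I) (i : I) (x : Pt Q T R) : Prop := ∃ B : Pt Q T R, en R δ i * ∑ ρ, x ρ * B ρ = en R δ i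
lemma Sur.zero {x : Pt Q T R} (h : Sur δ i x) {M : Matrix S T R} (hM : M * en R δ i = M) (h0 : ∀ ρ, M * x ρ = 0) : M = 0 := by
  obtain ⟨B, hB⟩ := h
  rw [← hM, ← hB, ← Matrix.mul_assoc, hM, Matrix.mul_sum]
  exact Finset.sum_eq_zero fun ρ _ => by rw [← Matrix.mul_assoc, h0, Matrix.zero_mul]
lemma Sur.zero' {x : Pt Q T R} (h : Sur δ i (st q x)) {M : Matrix T S R} (hM : en R δ i * M = M) (h0 : ∀ ρ, x ρ * M = 0) : M = 0 := by
  rw [← transpose_eq_zero]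
  refine h.zero (by rw [← en_tr, ← transpose_mul, hM]) fun ρ => ?_
  rw [KS.st, ← transpose_mul, h0, transpose_zero]
lemma Sur.conj {z : Pt Q T R} {x : Pt Q T' R} (h : Sur δ i z) {P : Matrix T' T R} {J : Matrix T T' R} (hP : gd δ' δ P)
    (c : ∀ ρ, P * z ρ = x ρ * P) (hPJ : P * J = 1) : Sur δ' i x := by
  obtain ⟨B, hB⟩ := h
  refine ⟨fun ρ => P * B ρ * J, ?_⟩
  have : ∑ ρ, x ρ * (P * B ρ * J) = P * (∑ ρ, z ρ * B ρ) * J := by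
    rw [Matrix.mul_sum, Matrix.sum_mul]
    exact Finset.sum_congr rfl fun ρ _ => by simp only [← Matrix.mul_assoc, c]
  rw [this, ← Matrix.mul_assoc, ← Matrix.mul_assoc, hP.en, Matrix.mul_assoc P, hB, ← hP.en, Matrix.mul_assoc, hPJ, Matrix.mul_one]
lemma Sur.map {R' : Type} [CommRing R'] (φ : R →+* R') {x : Pt Q T R} (h : Sur δ i x) : Sur δ i (mp φ x) := by
  obtain ⟨B, hB⟩ := h
  refine ⟨mp φ B, ?_⟩
  have := congrArg (fun M => M.map φ) hB
  simp only [Matrix.map_mul, en_map] at this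
  refine Eq.trans (congrArg _ ?_) this
  rw [← RingHom.mapMatrix_apply, map_sum]
  exact Finset.sum_congr rfl fun ρ _ => by rw [map_mul]; rfl

structure SubD (δ : T → I) (δ' : T' → I) (i : I) (z : Pt Q T R) (x : Pt Q T' R) (J : Matrix T T' R) (L : Matrix T' T R) : Prop where
  gJ : gd δ δ' J
  gL : gd δ' δ L
  LJ : L * J = 1
  c : ∀ ρ, z ρ * J = J * x ρ
  E : ∀ ρ, J * L * z ρ = z ρ
  Ei : (1 - J * L) * en R δ i = 1 - J * L
  s : Sur δ' i x

def Sub (δ : T → I) (δ' : T' → I) (i : I) (z : Pt Q T R) (x : Pt Q T' R) : Prop := ∃ J L, SubD δ δ' i z x J L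

def Iso (δ : T → I) (δ' : T' → I) (x : Pt Q T R) (x' : Pt Q T' R) : Prop :=
  ∃ (M : Matrix T T' R) (N : Matrix T' T R), gd δ δ' M ∧ gd δ' δ N ∧ M * N = 1 ∧ N * M = 1 ∧ ∀ ρ, x ρ * M = M * x' ρ
lemma Iso.symm {x : Pt Q T R} {x' : Pt Q T' R} (h : Iso δ δ' x x') : Iso δ' δ x' x := by
  obtain ⟨M, N, hM, hN, h1, h2, c⟩ := h
  refine ⟨N, M, hN, hM, h2, h1, fun ρ => ?_⟩
  rw [← Matrix.mul_one (N * x ρ), ← h1, ← Matrix.mul_assoc, Matrix.mul_assoc N, c, ← Matrix.mul_assoc N, h2, Matrix.one_mul]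
lemma Iso.trans {x : Pt Q T R} {x' : Pt Q T' R} {x'' : Pt Q T₁ R} (h : Iso δ δ' x x') (h' : Iso δ' δ₁ x' x'') : Iso δ δ₁ x x'' := by
  obtain ⟨M, N, hM, hN, h1, h2, c⟩ := h
  obtain ⟨M', N', hM', hN', h1', h2', c'⟩ := h'
  refine ⟨M * M', N' * N, hM.mul hM', hN'.mul hN, ?_, ?_, fun ρ => ?_⟩
  · rw [Matrix.mul_assoc, ← Matrix.mul_assoc M', h1', Matrix.one_mul, h1]
  · rw [Matrix.mul_assoc, ← Matrix.mul_assoc N, h2, Matrix.one_mul, h2']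
  · rw [← Matrix.mul_assoc, c, Matrix.mul_assoc, c', Matrix.mul_assoc]
lemma Iso.refl (x : Pt Q T R) : Iso δ δ x x := ⟨1, 1, .one, .one, by simp, by simp, by simp⟩
lemma Iso.of_equiv (x : Pt Q T R) (e : T' ≃ T) (he : ∀ t, δ (e t) = δ' t) : Iso δ δ' x (fun ρ => (x ρ).submatrix e e) := by
  refine ⟨(1 : Matrix T T R).submatrix id e, (1 : Matrix T T R).submatrix e id, fun s t h => ?_, fun s t h => ?_, ?_, ?_, fun ρ => ?_⟩
  · by_contra h'; exact h (one_apply_ne fun e => h' (by simpa [he] using congrArg δ e))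
  · by_contra h'; exact h (one_apply_ne fun e => h' (by simpa [he] using congrArg δ e))
  · rw [submatrix_mul_equiv]; simp
  · ext s t; simp [mul_apply, one_apply]
  · ext s t; simp [mul_apply, one_apply]
    rw [Finset.sum_eq_single (e.symm s)] <;> simp
    rintro b hb rfl; simp at hb

def ct (δ : T → I) (i : I) : ℕ := (Finset.univ.filter fun t => δ t = i).card
lemma tr_en : (en R δ i).trace = ct δ i := by simp [en, trace, ct]
lemma Iso.ct [CharZero R] {x : Pt Q T R} {x' : Pt Q T' R} (h : Iso δ δ' x x') (i : I) : ct δ i = KS.ct δ' i := by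
  obtain ⟨M, N, hM, hN, h1, h2, c⟩ := h
  have : (en R δ i).trace = (en R δ' i).trace := by
    rw [← Matrix.mul_one (en R δ i), ← h1, ← Matrix.mul_assoc, hM.en, trace_mul_comm, ← Matrix.mul_assoc, h2, Matrix.one_mul]
  rw [tr_en, tr_en] at this; exact_mod_cast this
lemma Iso.map {R' : Type} [CommRing R'] (φ : R →+* R') {x : Pt Q T R} {x' : Pt Q T' R} (h : Iso δ δ' x x') : Iso δ δ' (mp φ x) (mp φ x') := by
  obtain ⟨M, N, hM, hN, h1, h2, c⟩ := h
  refine ⟨M.map φ, N.map φ, fun s t h => hM s t fun h' => h (by simp [h']), fun s t h => hN s t fun h' => h (by simp [h']), ?_, ?_, fun ρ => ?_⟩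
  · rw [← Matrix.map_mul, h1, Matrix.map_one _ (map_zero _) (map_one _)]
  · rw [← Matrix.map_mul, h2, Matrix.map_one _ (map_zero _) (map_one _)]
  · simp only [mp, ← Matrix.map_mul, c]

namespace SubD
variable {z : Pt Q T R} {x : Pt Q T' R} {J : Matrix T T' R} {L : Matrix T' T R}
lemma map {R' : Type} [CommRing R'] (φ : R →+* R') (h : SubD δ δ' i z x J L) : SubD δ δ' i (mp φ z) (mp φ x) (J.map φ) (L.map φ) where
  gJ s t h' := h.gJ s t fun h0 => h' (by simp [h0])
  gL s t h' := h.gL s t fun h0 => h' (by simp [h0])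
  LJ := by rw [← Matrix.map_mul, h.LJ, Matrix.map_one _ (map_zero _) (map_one _)]
  c ρ := by simp only [mp, ← Matrix.map_mul, h.c]
  E ρ := by simp only [mp, ← Matrix.map_mul, h.E]
  Ei := by
    have := congrArg (fun M => M.map φ) h.Ei
    rw [Matrix.map_mul, en_map, Matrix.map_sub _ (map_sub φ), Matrix.map_mul, Matrix.map_one _ (map_zero _) (map_one _)] at this
    exact this
  s := h.s.map φ
lemma EJ (h : SubD δ δ' i z x J L) {x₁ : Pt Q T₁ R} {J₁ : Matrix T T₁ R} {L₁ : Matrix T₁ T R} (h₁ : SubD δ δ₁ i z x₁ J₁ L₁) : J * L * J₁ = J₁ := by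
  have : (1 - J * L) * J₁ = 0 := h₁.s.zero (by rw [Matrix.mul_assoc, ← h₁.gJ.en, ← Matrix.mul_assoc, h.Ei]) fun ρ => by
    rw [Matrix.mul_assoc, ← h₁.c, ← Matrix.mul_assoc, Matrix.sub_mul, Matrix.one_mul, h.E, sub_self, Matrix.zero_mul]
  rw [Matrix.sub_mul, Matrix.one_mul, sub_eq_zero] at this; exact this.symm
lemma uniq (h : SubD δ δ' i z x J L) {x₁ : Pt Q T₁ R} {J₁ : Matrix T T₁ R} {L₁ : Matrix T₁ T R} (h₁ : SubD δ δ₁ i z x₁ J₁ L₁) : Iso δ' δ₁ x x₁ := by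
  have a := h.EJ h₁
  have b := h₁.EJ h
  refine ⟨L * J₁, L₁ * J, h.gL.mul h₁.gJ, h₁.gL.mul h.gJ, ?_, ?_, fun ρ => ?_⟩
  · rw [Matrix.mul_assoc, ← Matrix.mul_assoc J₁, b, h.LJ]
  · rw [Matrix.mul_assoc, ← Matrix.mul_assoc J, a, h₁.LJ]
  · have : x ρ = L * (z ρ * J) := by rw [h.c, ← Matrix.mul_assoc, h.LJ, Matrix.one_mul]
    calc x ρ * (L * J₁) = L * (z ρ * (J * L * J₁)) := by rw [this]; simp only [Matrix.mul_assoc]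
      _ = _ := by rw [a, h₁.c, Matrix.mul_assoc]
lemma isoz {y : Pt Q T₁ R} (h : SubD δ δ' i z x J L) (hi : Iso δ δ₁ z y) : Sub δ₁ δ' i y x := by
  obtain ⟨M, N, hM, hN, h1, h2, c⟩ := hi
  obtain ⟨N', M', -, -, -, -, c'⟩ := Iso.symm ⟨M, N, hM, hN, h1, h2, c⟩
  have c' : ∀ ρ, y ρ * N = N * z ρ := fun ρ => by
    rw [← Matrix.mul_one (N * z ρ), ← h1, ← Matrix.mul_assoc, Matrix.mul_assoc N, c, ← Matrix.mul_assoc N, h2, Matrix.one_mul]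
  have e : 1 - N * J * (L * M) = N * (1 - J * L) * M := by
    simp only [Matrix.mul_sub, Matrix.sub_mul, Matrix.mul_one, h2, Matrix.mul_assoc]
  refine ⟨N * J, L * M, hN.mul h.gJ, h.gL.mul hM, ?_, fun ρ => ?_, fun ρ => ?_, ?_, h.s⟩
  · rw [Matrix.mul_assoc, ← Matrix.mul_assoc M, h1, Matrix.one_mul, h.LJ]
  · rw [← Matrix.mul_assoc, c', Matrix.mul_assoc, h.c, Matrix.mul_assoc]
  · have : y ρ = N * z ρ * M := by rw [Matrix.mul_assoc, c, ← Matrix.mul_assoc, h2, Matrix.one_mul]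
    rw [this]
    calc _ = N * (J * L * (M * N * z ρ)) * M := by simp only [Matrix.mul_assoc]
      _ = _ := by rw [h1, Matrix.one_mul, h.E]
  · rw [e, Matrix.mul_assoc, ← hM.en, ← Matrix.mul_assoc, Matrix.mul_assoc N, h.Ei]
lemma sur (h : SubD δ δ' i z x J L) (hc : Fintype.card T' = Fintype.card T) : Sur δ i z :=
  h.s.conj h.gJ (fun ρ => (h.c ρ).symm) ((mul_eq_one_comm_of_card_eq _ _ _ hc).1 h.LJ)
lemma lam (h : SubD δ δ' i z x J L) (hz : Lam q δ z) : Lam q δ' x := hz.sub h.gJ h.gL h.LJ h.c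
lemma cntj [CharZero R] (h : SubD δ δ' i z x J L) (hj : j ≠ i) : ct δ j = ct δ' j := by
  have e : (J * L * en R δ j).trace = (en R δ' j).trace := by
    rw [Matrix.mul_assoc, ← h.gL.en, ← Matrix.mul_assoc, trace_mul_comm, ← Matrix.mul_assoc, h.LJ, Matrix.one_mul]
  have : (1 - J * L) * en R δ j = 0 := by rw [← h.Ei, Matrix.mul_assoc, en_ne hj, Matrix.mul_zero]
  rw [Matrix.sub_mul, Matrix.one_mul, sub_eq_zero] at this
  rw [← this, tr_en, tr_en] at e; exact_mod_cast e
end SubD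
lemma Sur.sub {z : Pt Q T R} (h : Sur δ i z) : Sub δ δ i z z :=
  ⟨1, 1, .one, .one, by simp, by simp, by simp, by simp, h⟩

def hs (x : Q → Matrix T S R) : Matrix T (Q × S) R := of fun t c => x c.1 t c.2
lemma mul_hs (M : Matrix T' T R) (x : Q → Matrix T S R) : M * hs x = hs fun ρ => M * x ρ := by
  ext s t; simp [hs, mul_apply]

def vs (x : Q → Matrix S T R) : Matrix (Q × S) T R := of fun c t => x c.1 c.2 t
lemma hs_mul (x : Q → Matrix T S R) (B : Q → Matrix S T' R) : hs x * vs B = ∑ ρ, x ρ * B ρ := by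
  ext s t; simp [hs, vs, mul_apply, Fintype.sum_prod_type, Matrix.sum_apply]

noncomputable def rk (δ : T → I) (i : I) (x : Pt Q T R) : ℕ := (en R δ i * hs x).rank
lemma rank_en {K : Type} [Field K] : (en K δ i).rank = ct δ i := by
  classical
  rw [en, rank_diagonal, Fintype.card_subtype, ct]; simp
lemma rk_le {K : Type} [Field K] (z : Pt Q T K) : rk δ i z ≤ ct δ i := (rank_mul_le_left _ _).trans_eq rank_en
lemma SubD.rk {K : Type} [Field K] {z : Pt Q T K} {x : Pt Q T' K} {J : Matrix T T' K} {L : Matrix T' T K} (h : SubD δ δ' i z x J L) :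
    rk δ i z = ct δ' i := by
  rw [← rank_en (K := K)]
  apply le_antisymm
  · have : en K δ i * hs z = J * (en K δ' i * (L * hs z)) := by
      rw [← Matrix.mul_assoc, ← h.gJ.en, Matrix.mul_assoc, ← Matrix.mul_assoc J, mul_hs (J * L)]; simp only [h.E]
    rw [KS.rk, this]
    exact (rank_mul_le_right _ _).trans (rank_mul_le_left _ _)
  · obtain ⟨B, hB⟩ := h.s
    have e : ∀ ρ, x ρ = L * (z ρ * J) := fun ρ => by rw [h.c, ← Matrix.mul_assoc, h.LJ, Matrix.one_mul]
    have : en K δ' i = L * (en K δ i * hs z * vs fun ρ => J * B ρ) := by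
      rw [Matrix.mul_assoc, hs_mul, ← Matrix.mul_assoc, ← h.gL.en, Matrix.mul_assoc, Matrix.mul_sum]
      simp only [← Matrix.mul_assoc, ← e]
      exact hB.symm
    rw [this, KS.rk]
    exact (rank_mul_le_right _ _).trans (rank_mul_le_left _ _)
lemma Sub.rk_add {K : Type} [Field K] [CharZero K] {z : Pt Q T K} {x : Pt Q T' K} (h : Sub δ δ' i z x) (j : I) :
    ct δ j = ct δ' j + if j = i then ct δ i - rk δ i z else 0 := by
  obtain ⟨J, L, h⟩ := h
  split_ifs with hj
  · have := rk_le (δ := δ) (i := i) z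
    rw [hj, ← h.rk]; omega
  · rw [h.cntj hj, add_zero]

lemma commute {K : Type} [Field K] {z : Pt Q T K} {x₁ : Pt Q T₁ K} {x₂ : Pt Q T₂ K} {x₃ : Pt Q T₃ K} (h1 : Sub δ δ₁ i z x₁)
    (h2 : Sub δ δ₂ j (st q z) (st q x₂)) (h3 : Sub δ₁ δ₃ j (st q x₁) (st q x₃)) : Sub δ₂ δ₃ i x₂ x₃ := by
  obtain ⟨J1, L1, h1⟩ := h1
  obtain ⟨P2, R2, h2⟩ := h2
  obtain ⟨P3, R3, h3⟩ := h3
  have tc : ∀ {T T' : Type} [Fintype T] [Fintype T'] [DecidableEq T] [DecidableEq T'] {δ : T → I} {δ' : T' → I} {z : Pt Q T K} {x : Pt Q T' K} {J L}, SubD δ δ' j (st q z) (st q x) J L →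
      (∀ ρ, Jᵀ * z ρ = x ρ * Jᵀ) ∧ Jᵀ * Lᵀ = 1 ∧ (∀ ρ, z ρ * (Lᵀ * Jᵀ) = z ρ) ∧ en K δ j * (1 - Lᵀ * Jᵀ) = 1 - Lᵀ * Jᵀ := by
    intro T T' _ _ _ _ δ δ' z x J L h
    refine ⟨fun ρ => ?_, ?_, fun ρ => ?_, ?_⟩
    · have := congrArg transpose (h.c (q.bar ρ))
      simpa [st, transpose_mul, q.bb] using this
    · rw [← transpose_mul, h.LJ, transpose_one]
    · have := congrArg transpose (h.E (q.bar ρ))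
      simpa [st, transpose_mul, q.bb] using this
    · have := congrArg transpose h.Ei
      simpa [transpose_mul, en_tr] using this
  obtain ⟨c2, i2, F2, e2⟩ := tc h2
  obtain ⟨c3, i3, F3, e3⟩ := tc h3
  have g2 := h2.gJ.tr
  have g2' := h2.gL.tr
  have g3 := h3.gJ.tr
  have g3' := h3.gL.tr
  have s2 := h2.s
  have s3 := h3.s
  clear h2 h3
  revert c2 i2 F2 e2 c3 i3 F3 e3 g2 g2' g3 g3'
  generalize P2ᵀ = P2, R2ᵀ = R2, P3ᵀ = P3, R3ᵀ = R3
  intro c2 i2 F2 e2 c3 i3 F3 e3 g2 g2' g3 g3'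
  have k1 : P2 * J1 * R3 * P3 = P2 * J1 := by
    have : P2 * J1 * (1 - R3 * P3) = 0 := by
      apply s2.zero'
      · rw [← Matrix.mul_assoc, (g2.mul h1.gJ).en, Matrix.mul_assoc, e3]
      · intro ρ
        calc _ = x₂ ρ * P2 * J1 * (1 - R3 * P3) := by simp only [Matrix.mul_assoc]
          _ = P2 * (J1 * (x₁ ρ - x₁ ρ * (R3 * P3))) := by rw [← c2, Matrix.mul_assoc P2, h1.c]; simp only [Matrix.mul_assoc, Matrix.mul_sub, Matrix.mul_one]
          _ = 0 := by rw [F3]; simp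
    rw [Matrix.mul_sub, Matrix.mul_one, sub_eq_zero, ← Matrix.mul_assoc] at this; exact this.symm
  set J3 := P2 * J1 * R3 with hJ3
  have gJ3 : gd δ₂ δ₃ J3 := (g2.mul h1.gJ).mul g3'
  have cJ : ∀ ρ, x₂ ρ * J3 = J3 * x₃ ρ := fun ρ => by
    have : x₂ ρ * J3 * P3 = J3 * x₃ ρ * P3 := by
      rw [Matrix.mul_assoc, k1, ← Matrix.mul_assoc, ← c2, Matrix.mul_assoc, h1.c, ← Matrix.mul_assoc, ← k1, Matrix.mul_assoc J3 P3, c3, Matrix.mul_assoc J3]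
    have := congrArg (· * R3) this
    simpa [Matrix.mul_assoc, i3] using this
  have inj : Function.Injective J3.mulVec := by
    rw [← coe_mulVecLin, ← LinearMap.ker_eq_bot, LinearMap.ker_eq_bot']
    intro v hv
    rw [mulVecLin_apply] at hv
    let V : Matrix T₃ (Fin 1) K := replicateCol _ v
    have hV : J3 * V = 0 := by ext s t; exact congrFun hv s
    suffices V = 0 by ext s; exact congrFun (congrFun this s) 0
    clear_value V; clear hv v
    have hu : P2 * (J1 * (R3 * V)) = 0 := by rw [hJ3] at hV; simpa only [Matrix.mul_assoc] using hV
    have hu2 : (1 - R2 * P2) * (J1 * (R3 * V)) = J1 * (R3 * V) := by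
      rw [Matrix.sub_mul, Matrix.mul_assoc, hu]; simp
    apply s3.zero'
    · have : V = P3 * (L1 * (J1 * (R3 * V))) := by
        rw [← Matrix.mul_assoc L1, h1.LJ, Matrix.one_mul, ← Matrix.mul_assoc, i3, Matrix.one_mul]
      rw [this, ← Matrix.mul_assoc, g3.en, Matrix.mul_assoc, ← Matrix.mul_assoc _ L1, h1.gL.en, Matrix.mul_assoc L1]
      rw [← hu2, ← Matrix.mul_assoc (en K δ j), e2]
    · intro ρ
      have a : J1 * (x₁ ρ * (R3 * V)) = 0 := by
        rw [← Matrix.mul_assoc, ← h1.c, Matrix.mul_assoc, ← hu2, ← Matrix.mul_assoc, Matrix.mul_sub, F2]; simp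
      have b : x₁ ρ * (R3 * V) = 0 := by
        rw [← Matrix.one_mul (x₁ ρ), ← h1.LJ, Matrix.mul_assoc, Matrix.mul_assoc, a, Matrix.mul_zero]
      calc x₃ ρ * V = x₃ ρ * (P3 * R3) * V := by rw [i3, Matrix.mul_one]
        _ = P3 * (x₁ ρ * (R3 * V)) := by rw [← Matrix.mul_assoc, ← c3]; simp only [Matrix.mul_assoc]
        _ = 0 := by rw [b, Matrix.mul_zero]
  obtain ⟨L', hL⟩ := (J3.toLin').exists_leftInverse_of_injective (LinearMap.ker_eq_bot.2 inj)
  obtain ⟨L, rfl⟩ := (toLin' (R := K)).surjective L'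
  rw [← toLin'_mul, ← toLin'_one] at hL
  replace hL := (toLin' (R := K)).injective hL
  let L3 : Matrix T₃ T₂ K := of fun s t => if δ₃ s = δ₂ t then L s t else 0
  have gL3 : gd δ₃ δ₂ L3 := fun s t h => by by_contra h'; exact h (by simp [L3, h'])
  have LJ3 : L3 * J3 = 1 := by
    rw [← hL]; ext s t
    by_cases hst : δ₃ s = δ₃ t
    · simp only [mul_apply]
      refine Finset.sum_congr rfl fun r _ => ?_
      by_cases h0 : J3 r t = 0
      · simp [h0]
      · simp [L3, hst, gJ3 r t h0]
    · rw [hL, one_apply_ne fun h => hst (congrArg δ₃ h)]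
      by_contra h
      exact hst ((gL3.mul gJ3) s t h)
  clear_value L3 J3
  obtain ⟨E3, hE⟩ : ∃ E3, E3 = 1 - J3 * L3 := ⟨_, rfl⟩
  have hEJ : E3 * J3 = 0 := by rw [hE, Matrix.sub_mul, Matrix.mul_assoc, LJ3]; simp
  have k2 : E3 * P2 = E3 * P2 * (1 - J1 * L1) := by
    rw [Matrix.mul_sub, Matrix.mul_one, ← Matrix.mul_assoc, Matrix.mul_assoc E3 P2 J1, ← k1, ← Matrix.mul_assoc, hEJ]
    simp
  have k3 : ∀ ρ, (1 - J1 * L1) * z ρ = 0 := fun ρ => by rw [Matrix.sub_mul, h1.E]; simp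
  refine ⟨J3, L3, gJ3, gL3, LJ3, cJ, fun ρ => ?_, ?_, h1.s.conj g3 c3 i3⟩
  · have : E3 * x₂ ρ = 0 := by
      rw [← Matrix.mul_one (x₂ ρ), ← i2, ← Matrix.mul_assoc (x₂ ρ), ← c2, Matrix.mul_assoc P2, ← Matrix.mul_assoc _ P2, k2, Matrix.mul_assoc, ← Matrix.mul_assoc _ (z ρ), k3]
      simp
    rw [hE, Matrix.sub_mul, Matrix.one_mul, sub_eq_zero] at this; exact this.symm
  · have : E3 = E3 * P2 * (1 - J1 * L1) * R2 := by rw [← k2, Matrix.mul_assoc, i2, Matrix.mul_one]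
    rw [← hE, this, Matrix.mul_assoc, ← g2'.en, ← Matrix.mul_assoc, Matrix.mul_assoc _ (1 - J1 * L1), h1.Ei]
end
end KS

namespace KS
open Matrix
set_option linter.unusedSectionVars false
variable {I Q : Type} [DecidableEq I] [Fintype Q] [DecidableEq Q] {q : Qv I Q}
section
variable {T T' F R K : Type} [Fintype T] [DecidableEq T] [Fintype T'] [DecidableEq T'] [Fintype F] [DecidableEq F]
  [CommRing R] [Field K] {δ : T → I} {δ' : T' → I} {i : I}

abbrev dd (F : Type) (δ' : T' → I) (i : I) : T' ⊕ F → I := Sum.elim δ' fun _ => i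

abbrev JJ (g : Matrix F T' R) : Matrix (T' ⊕ F) T' R := fromRows 1 g

abbrev LL (F : Type) (T' R : Type) [DecidableEq T'] [CommRing R] : Matrix T' (T' ⊕ F) R := fromCols 1 0

abbrev MM (x : Pt Q T' R) (W : Q → Matrix T' F R) (g : Matrix F T' R) (ρ : Q) : Matrix T' (T' ⊕ F) R := fromCols (x ρ - W ρ * g) (W ρ)

def yy (x : Pt Q T' R) (W : Q → Matrix T' F R) (g : Matrix F T' R) : Pt Q (T' ⊕ F) R :=
  fun ρ => JJ g * MM x W g ρ

structure YD (q : Qv I Q) (δ' : T' → I) (i : I) (x : Pt Q T' R) (W : Q → Matrix T' F R) (g : Matrix F T' R) : Prop where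
  lam : Lam q δ' x
  gW : ∀ ρ t f, W ρ t f ≠ 0 → δ' t = q.tgt ρ ∧ i = q.src ρ
  gg : ∀ f t, g f t ≠ 0 → δ' t = i
  mo : ∑ ρ, q.sg ρ • (x ρ * W (q.bar ρ)) = 0
lemma yy_eq (x : Pt Q T' R) (W : Q → Matrix T' F R) (g : Matrix F T' R) (ρ : Q) :
    yy x W g ρ = fromBlocks (x ρ - W ρ * g) (W ρ) (g * (x ρ - W ρ * g)) (g * W ρ) := by
  rw [yy, JJ, MM, fromRows_mul_fromCols]; simp
lemma yy_c (x : Pt Q T' R) (W : Q → Matrix T' F R) (g : Matrix F T' R) (ρ : Q) :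
    MM x W g ρ * JJ g = x ρ := by rw [MM, JJ, fromCols_mul_fromRows]; simp
lemma LJ (g : Matrix F T' R) : LL F T' R * JJ g = 1 := by rw [LL, JJ, fromCols_mul_fromRows]; simp
lemma gL : gd δ' (dd F δ' i) (LL F T' R) := by
  rintro s (t | t) hst
  · exact gd.one s t hst
  · simp at hst
lemma gJ {g : Matrix F T' R} (h : ∀ f t, g f t ≠ 0 → δ' t = i) : gd (dd F δ' i) δ' (JJ g) := by
  rintro (s | s) t hst
  · exact gd.one s t hst
  · exact (h s t hst).symm
lemma YD.yy {x : Pt Q T' R} {W : Q → Matrix T' F R} {g : Matrix F T' R} (h : YD q δ' i x W g) : Lam q (dd F δ' i) (yy x W g) where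
  gr ρ s t hst := by
    obtain ⟨r, h1, h2⟩ := exists_mul_ne hst
    have h1 := gJ h.gg _ _ h1
    have k : ∀ t, (x ρ - W ρ * g) r t ≠ 0 → δ' r = q.tgt ρ ∧ δ' t = q.src ρ := fun t ht => by
      by_cases h3 : x ρ r t = 0
      · have : (W ρ * g) r t ≠ 0 := fun h4 => ht (by simp [h3, h4])
        obtain ⟨f, h5, h6⟩ := exists_mul_ne this
        obtain ⟨h7, h8⟩ := h.gW _ _ _ h5
        exact ⟨h7, (h.gg _ _ h6).trans h8⟩
      · exact h.lam.gr _ _ _ h3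
    rw [h1]
    rcases t with t | t
    · exact k t h2
    · exact h.gW _ _ _ h2
  mo := by
    have e : ∀ ρ, q.sg ρ • (KS.yy x W g ρ * KS.yy x W g (q.bar ρ)) = JJ g * ((q.sg ρ • (x ρ * x (q.bar ρ))) * LL F T' R + (q.sg ρ • (x ρ * W (q.bar ρ))) * (fromCols (-g) 1 : Matrix F (T' ⊕ F) R)) := fun ρ => by
      rw [KS.yy, KS.yy, Matrix.mul_assoc, ← Matrix.mul_assoc (MM x W g ρ), yy_c, Matrix.smul_mul, Matrix.smul_mul, ← smul_add, Matrix.mul_smul]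
      congr 2
      rw [MM, LL, mul_fromCols, mul_fromCols, mul_fromCols]; ext s (t | t) <;> simp [sub_eq_add_neg, Matrix.mul_add, Matrix.mul_assoc]
    rw [Finset.sum_congr rfl fun ρ _ => e ρ, ← Matrix.mul_sum, Finset.sum_add_distrib, ← Matrix.sum_mul, ← Matrix.sum_mul, h.lam.mo, h.mo]; simp
  nil := by
    obtain ⟨N, hN⟩ := h.lam.nil
    refine ⟨N + 1, fun l hl => ?_⟩
    rcases List.eq_nil_or_concat l with rfl | ⟨l, ρ, rfl⟩
    · simp at hl
    rw [List.concat_eq_append, List.map_append, List.prod_append, List.map_singleton, List.prod_singleton, KS.yy, ← Matrix.mul_assoc,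
      prod_comm (x := x) (fun ρ => by rw [KS.yy, Matrix.mul_assoc, yy_c]), hN l (by simpa using hl)]
    simp
lemma yy_sub (x : Pt Q T' R) (W : Q → Matrix T' F R) {g : Matrix F T' R} (h : ∀ f t, g f t ≠ 0 → δ' t = i) (hs : Sur δ' i x) :
    Sub (dd F δ' i) δ' i (yy x W g) x := by
  refine ⟨JJ g, LL F T' R, gJ h, gL, LJ g, fun ρ => ?_, fun ρ => ?_, mul_en fun s t hst => ?_, hs⟩
  · rw [KS.yy, Matrix.mul_assoc, yy_c]
  · rw [KS.yy, Matrix.mul_assoc, ← Matrix.mul_assoc (LL F T' R), LJ, Matrix.one_mul]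
  · rw [JJ, LL, fromRows_mul_fromCols, ← fromBlocks_one] at hst
    rcases s with s | s <;> rcases t with t | t
    · exact absurd (by simp [one_apply]) hst
    · rfl
    · simp at hst; exact h s t hst
    · rfl

lemma Sur.mk' {x : Pt Q T K} (h : ∀ v : T → K, (∀ t, v t ≠ 0 → δ t = i) → (∀ ρ, v ᵥ* x ρ = 0) → v = 0) : Sur δ i x := by
  let A : Matrix {t // δ t = i} (Q × T) K := (hs x).submatrix Subtype.val id
  obtain ⟨s, hs'⟩ := exists_minor A fun v hv => by
    let w : T → K := fun t => if ht : δ t = i then v ⟨t, ht⟩ else 0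
    have : w = 0 := h w (fun t ht => by by_contra h'; simp [w, h'] at ht) fun ρ => by
      ext u
      have := congrFun hv (ρ, u)
      simp only [vecMul, dotProduct, A, submatrix_apply, hs, of_apply, id, Pi.zero_apply] at this ⊢
      rw [← this]; symm
      refine Finset.sum_of_injOn Subtype.val (Subtype.val_injective.injOn) (by simp) ?_ ?_
      · intro t _ ht
        have : ¬ δ t = i := fun h' => ht ⟨⟨t, h'⟩, by simp, rfl⟩
        simp [w, this]
      · rintro ⟨t, ht⟩ _; simp [w, ht]
    ext ⟨t, ht⟩
    simpa [w, ht] using congrFun this t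
  let Y := (1 : Matrix (Q × T) (Q × T) K).submatrix id s * (A.submatrix id s)⁻¹
  have hY : A * Y = 1 := by
    have : A * (1 : Matrix (Q × T) (Q × T) K).submatrix id s = A.submatrix id s := by
      ext a b; simp [mul_apply, one_apply]
    rw [← Matrix.mul_assoc, this, mul_nonsing_inv _ (isUnit_iff_ne_zero.2 hs')]
  refine ⟨fun ρ => (Matrix.of fun u t => if ht : δ t = i then Y (ρ, u) ⟨t, ht⟩ else 0 : Matrix T T K), ?_⟩
  ext r t
  rw [← hs_mul]
  simp only [en, diagonal_mul]
  by_cases hr : δ r = i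
  · rw [if_pos hr, one_mul]
    by_cases ht : δ t = i
    · have := congrFun (congrFun hY ⟨r, hr⟩) ⟨t, ht⟩
      simpa [mul_apply, A, vs, ht, diagonal_apply, hr, one_apply] using this
    · simp [mul_apply, vs, ht, diagonal_apply]; rintro rfl; exact absurd hr ht
  · simp [hr, diagonal_apply]
lemma Sur.ann {x : Pt Q T R} (h : Sur δ i x) (v : T → R) (hv : ∀ t, v t ≠ 0 → δ t = i) (h0 : ∀ ρ, v ᵥ* x ρ = 0) : v = 0 := by
  have := h.zero (M := replicateRow (Fin 1) v) (mul_en fun s t => hv t) fun ρ => by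
    ext s t; exact congrFun (h0 ρ) t
  ext t; exact congrFun (congrFun this 0) t

lemma exists_yy {z : Pt Q T K} (hz : Lam q δ z) (i : I) : ∃ (T' F : Type) (_ : Fintype T') (_ : DecidableEq T') (_ : Fintype F) (_ : DecidableEq F)
    (δ' : T' → I) (e : T' ⊕ F ≃ T) (x : Pt Q T' K) (W : Q → Matrix T' F K) (g : Matrix F T' K), (∀ t, δ (e t) = dd F δ' i t) ∧
    YD q δ' i x W g ∧ Sur δ' i x ∧ (fun ρ => (z ρ).submatrix e e) = yy x W g := by
  classical
  obtain ⟨κ, a, ha, hsp, hli⟩ := exists_linearIndependent' K (fun t : {t // δ t = i} => hs z t.1)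
  have := Fintype.ofInjective a ha
  let p : T → Prop := fun t => δ t ≠ i ∨ ∃ k, (a k).1 = t
  have hpi : ∀ t : {t // ¬ p t}, δ t.1 = i := fun t => by
    have := t.2; simp only [p, not_or, not_not] at this; exact this.1
  have hc : ∀ f : {t // ¬ p t}, ∃ c : κ → K, ∑ k, c k • hs z (a k).1 = hs z f.1 := fun f => by
    have : hs z f.1 ∈ Submodule.span K (Set.range fun t : {t // δ t = i} => hs z t.1) := Submodule.subset_span ⟨⟨f.1, hpi f⟩, rfl⟩
    rw [← hsp] at this
    exact (Submodule.mem_span_range_iff_exists_fun K).1 this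
  choose c hc using hc
  let g : Matrix {t // ¬ p t} {t // p t} K := of fun f t => ∑ k, if (a k).1 = t.1 then c f k else 0
  let e := Equiv.sumCompl p
  let A : Q → Matrix {t // p t} {t // p t} K := fun ρ => (z ρ).submatrix Subtype.val Subtype.val
  let B : Q → Matrix {t // p t} {t // ¬ p t} K := fun ρ => (z ρ).submatrix Subtype.val Subtype.val
  have hg : ∀ f ρ u, ∑ t : {t // p t}, g f t * z ρ t.1 u = z ρ f.1 u := fun f ρ u => by
    have := congrFun (hc f) (ρ, u)
    simp only [hs, of_apply, Finset.sum_apply, Pi.smul_apply, smul_eq_mul] at this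
    simp only [g, of_apply, Finset.sum_mul]
    rw [← this, Finset.sum_comm]
    refine Finset.sum_congr rfl fun k _ => ?_
    rw [Finset.sum_eq_single ⟨(a k).1, Or.inr ⟨k, rfl⟩⟩] <;> simp
    rintro t ht h1 h2; exact absurd h2.symm h1
  have hB : ∀ ρ t f, B ρ t f ≠ 0 → δ t.1 = q.tgt ρ ∧ i = q.src ρ := fun ρ t f h => by
    have := hz.gr _ _ _ h; rw [hpi] at this; exact this
  have hgg : ∀ f t, g f t ≠ 0 → δ t.1 = i := fun f t h => by
    obtain ⟨k, -, hk⟩ := Finset.exists_ne_zero_of_sum_ne_zero h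
    have : (a k).1 = t.1 := by by_contra h'; simp [h'] at hk
    rw [← this]; exact (a k).2
  let x : Pt Q {t // p t} K := fun ρ => A ρ + B ρ * g
  have hyy : (fun ρ => (z ρ).submatrix e e) = yy x B g := by
    funext ρ
    rw [yy_eq]; simp only [x, add_sub_cancel_right]
    ext (s | s) (t | t)
    · rfl
    · rfl
    · exact (hg s ρ t.1).symm
    · exact (hg s ρ t.1).symm
  have hd : ∀ t, δ (e t) = dd {t // ¬ p t} (fun t : {t // p t} => δ t.1) i t := by
    rintro (t | t); exacts [rfl, hpi t]
  have hly : Lam q (dd {t // ¬ p t} (fun t : {t // p t} => δ t.1) i) (yy x B g) := by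
    obtain ⟨M, N, hM, hN, h1, h2, c⟩ := Iso.of_equiv z e hd
    rw [← hyy]
    exact hz.sub hM hN h2 c
  have hl : Lam q (fun t : {t // p t} => δ t.1) x := by
    exact hly.sub (gJ hgg) gL (LJ g) (fun ρ => by rw [yy, Matrix.mul_assoc, yy_c])
  refine ⟨_, _, inferInstance, inferInstance, inferInstance, inferInstance, fun t => δ t.1, e, x, B, g, hd, ⟨hl, hB, hgg, ?_⟩, ?_, hyy⟩
  · have := hly.mo
    have h2 : ∀ ρ, q.sg ρ • (x ρ * B (q.bar ρ)) = LL {t // ¬ p t} {t // p t} K * (q.sg ρ • (yy x B g ρ * yy x B g (q.bar ρ))) * (fromRows 0 1 : Matrix ({t // p t} ⊕ {t // ¬ p t}) {t // ¬ p t} K) := fun ρ => by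
      rw [Matrix.mul_smul, Matrix.smul_mul, yy, yy, Matrix.mul_assoc (JJ g), ← Matrix.mul_assoc (MM x B g ρ), yy_c, ← Matrix.mul_assoc (LL _ _ K), LJ, Matrix.one_mul,
        Matrix.mul_assoc, MM, fromCols_mul_fromRows]
      simp
    rw [Finset.sum_congr rfl fun ρ _ => h2 ρ, ← Matrix.sum_mul, ← Matrix.mul_sum, this]
    simp
  · apply Sur.mk'
    intro v hv h0
    have h1 : ∀ ρ, v ᵥ* B ρ = 0 := fun ρ => by
      ext f; refine Finset.sum_eq_zero fun t _ => ?_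
      by_contra h
      obtain ⟨h3, h4⟩ := hB ρ t f (right_ne_zero_of_mul h)
      exact q.nl ρ (h4.symm.trans ((hv t (left_ne_zero_of_mul h)).symm.trans h3))
    have h2 : ∀ ρ, v ᵥ* A ρ = 0 := fun ρ => by
      have := h0 ρ
      rwa [vecMul_add, ← vecMul_vecMul, h1, zero_vecMul, add_zero] at this
    have h3 : ∀ ρ u, ∑ t : {t // p t}, v t * z ρ t.1 u = 0 := fun ρ u => by
      by_cases hu : p u
      · exact congrFun (h2 ρ) ⟨u, hu⟩
      · exact congrFun (h1 ρ) ⟨u, hu⟩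
    have h4 := Fintype.linearIndependent_iff.1 hli (fun k => v ⟨(a k).1, Or.inr ⟨k, rfl⟩⟩) (by
      ext ⟨ρ, u⟩
      rw [Pi.zero_apply, ← h3 ρ u, Finset.sum_apply]
      refine Finset.sum_of_injOn (fun k => (⟨(a k).1, Or.inr ⟨k, rfl⟩⟩ : {t // p t})) ?_ (by simp) ?_ ?_
      · intro k _ l _ h; exact ha (Subtype.ext (congrArg (fun u => u.1) h))
      · intro t _ ht
        by_cases h5 : v t = 0
        · simp [h5]
        · rcases t.2 with h6 | ⟨k, hk⟩
          · exact absurd (hv t h5) h6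
          · exact absurd ⟨k, by simp, Subtype.ext hk⟩ ht
      · intro k _; rfl)
    ext t
    by_contra h5
    rcases t.2 with h6 | ⟨k, hk⟩
    · exact h6 (hv t h5)
    · exact h5 (by have := h4 k; simpa [hk] using this)
end
end KS

namespace KS
open Matrix
set_option linter.unusedSectionVars false
section
variable {m C F R K : Type} [Fintype m] [DecidableEq m] [Fintype C] [DecidableEq C] [Fintype F] [DecidableEq F] [CommRing R] [Field K]

def SS (R : Type) [CommRing R] (s : m → C) : Matrix C m R := (1 : Matrix C C R).submatrix id s
lemma mul_SS (A : Matrix F C R) (s : m → C) : A * SS R s = A.submatrix id s := by ext a b; simp [SS, mul_apply, one_apply]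

def WW (A : Matrix m C R) (s : m → C) (θ : Matrix C F R) : Matrix C F R :=
  (A.submatrix id s).det • θ - SS R s * ((A.submatrix id s).adjugate * (A * θ))
lemma mul_WW (A : Matrix m C R) (s : m → C) (θ : Matrix C F R) : A * WW A s θ = 0 := by
  rw [WW, Matrix.mul_sub, ← Matrix.mul_assoc A (SS R s), mul_SS, ← Matrix.mul_assoc _ _ (A * θ), mul_adjugate]; simp
lemma WW_off (A : Matrix m C R) (s : m → C) (θ : Matrix C F R) (c : C) (hc : c ∉ Set.range s) (f : F) :
    WW A s θ c f = (A.submatrix id s).det * θ c f := by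
  have : (SS R s * ((A.submatrix id s).adjugate * (A * θ))) c f = 0 := by
    rw [mul_apply]; refine Finset.sum_eq_zero fun r _ => ?_
    rw [SS, submatrix_apply, id, one_apply_ne fun h => hc ⟨r, h.symm⟩, zero_mul]
  rw [WW, Matrix.sub_apply, this]; simp
lemma WW_map {R' : Type} [CommRing R'] (φ : R →+* R') (A : Matrix m C R) (s : m → C) (θ : Matrix C F R) :
    (WW A s θ).map φ = WW (A.map φ) s (θ.map φ) := by
  have h1 : (SS R s).map φ = SS R' s := by ext a b; simp [SS, one_apply]
  have h2 : (A.submatrix id s).map φ = (A.map φ).submatrix id s := rfl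
  rw [WW, WW, Matrix.map_sub _ (map_sub φ), Matrix.map_mul, Matrix.map_mul, Matrix.map_mul, h1, ← h2]
  have h3 := RingHom.map_adjugate φ (A.submatrix id s)
  have h4 := RingHom.map_det φ (A.submatrix id s)
  simp only [RingHom.mapMatrix_apply] at h3 h4
  rw [h3, ← h4]; congr 1; ext a b; simp
lemma det_inj {A : Matrix m C R} {s : m → C} (h : (A.submatrix id s).det ≠ 0) : Function.Injective s := fun a b hab => by
  by_contra hne
  exact h (det_zero_of_column_eq hne fun k => by simp [hab])
open Classical in

noncomputable def off (s : m → C) (θ : {c // c ∉ Set.range s} → F → R) : Matrix C F R := of fun c f => if h : c ∈ Set.range s then 0 else θ ⟨c, h⟩ f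
lemma exists_off {A : Matrix m C K} {s : m → C} (h : (A.submatrix id s).det ≠ 0) (W : Matrix C F K) (hW : A * W = 0) :
    WW A s (off s fun c f => (A.submatrix id s).det⁻¹ * W c.1 f) = W := by
  set W1 := WW A s (off s fun c f => (A.submatrix id s).det⁻¹ * W c.1 f) with hW1
  have h0 : A * (W1 - W) = 0 := by rw [Matrix.mul_sub, hW, hW1, mul_WW, sub_zero]
  have h1 : ∀ c, c ∉ Set.range s → ∀ f, (W1 - W) c f = 0 := fun c hc f => by
    rw [Matrix.sub_apply, hW1, WW_off _ _ _ _ hc]; simp only [off, of_apply, dif_neg hc]; field_simp; simp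
  rw [← sub_eq_zero]
  generalize W1 - W = V at h0 h1 ⊢
  have h2 : V = SS K s * V.submatrix s id := by
    ext c f
    rw [mul_apply]
    by_cases hc : c ∈ Set.range s
    · obtain ⟨r, rfl⟩ := hc
      rw [Finset.sum_eq_single r] <;> simp +contextual [SS, one_apply, (det_inj h).eq_iff, eq_comm]
    · rw [h1 c hc, Finset.sum_eq_zero]
      intro r _; rw [SS, submatrix_apply, id, one_apply_ne fun h => hc ⟨r, h.symm⟩, zero_mul]
  rw [h2, ← Matrix.mul_assoc, mul_SS] at h0
  have h3 : V.submatrix s id = 0 := by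
    rw [← Matrix.one_mul (V.submatrix s id), ← nonsing_inv_mul _ (isUnit_iff_ne_zero.2 h), Matrix.mul_assoc, h0, Matrix.mul_zero]
  rw [h2, h3, Matrix.mul_zero]
end
variable {I Q : Type} [DecidableEq I] [Fintype Q] [DecidableEq Q] {q : Qv I Q}
section
variable {T F R K : Type} [Fintype T] [DecidableEq T] [Fintype F] [DecidableEq F]
  [CommRing R] [Field K] {δ : T → I} {i : I}

abbrev mi (δ : T → I) (i : I) := {t : T // δ t = i}

abbrev Ci (q : Qv I Q) (δ : T → I) (i : I) := {c : Q × T // q.tgt c.1 = i ∧ δ c.2 = q.src c.1}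

def AA (q : Qv I Q) (δ : T → I) (i : I) (x : Pt Q T R) : Matrix (mi δ i) (Ci q δ i) R := of fun r c => x c.1.1 r.1 c.1.2

def Wof (U : Matrix (Ci q δ i) F R) (ρ : Q) : Matrix T F R :=
  of fun t f => if h : q.tgt (q.bar ρ) = i ∧ δ t = q.src (q.bar ρ) then q.sg (q.bar ρ) • U ⟨(q.bar ρ, t), h⟩ f else 0

def Wto (q : Qv I Q) (δ : T → I) (i : I) (W : Q → Matrix T F R) : Matrix (Ci q δ i) F R := of fun c f => q.sg c.1.1 • W (q.bar c.1.1) c.1.2 f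
lemma sg_sg (ρ : Q) (a : R) : q.sg ρ • q.sg ρ • a = a := by rcases q.sg0 ρ with h | h <;> simp [h]
lemma Wof_to (W : Q → Matrix T F R) (h : ∀ ρ t f, W ρ t f ≠ 0 → δ t = q.tgt ρ ∧ i = q.src ρ) : Wof (Wto q δ i W) = W := by
  funext ρ; ext t f
  simp only [Wof, of_apply, Wto, q.bb, sg_sg, q.tb, q.sb]
  split_ifs with h'
  · rfl
  · by_contra h0; obtain ⟨h1, h2⟩ := h ρ t f (Ne.symm h0); exact h' ⟨h2.symm, h1⟩
lemma Wto_of (U : Matrix (Ci q δ i) F R) : Wto q δ i (Wof U) = U := by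
  ext ⟨⟨ρ, t⟩, hc⟩ f
  simp only [Wto, of_apply, Wof, q.bb]; rw [dif_pos hc, sg_sg]
lemma Wof_gr (U : Matrix (Ci q δ i) F R) (ρ t f) (h : Wof U ρ t f ≠ 0) : δ t = q.tgt ρ ∧ i = q.src ρ := by
  simp only [Wof, of_apply, q.tb, q.sb] at h
  by_contra h'
  rw [dif_neg (by tauto)] at h; exact h rfl
lemma Wof_map {R' : Type} [CommRing R'] (φ : R →+* R') (U : Matrix (Ci q δ i) F R) (ρ : Q) : (Wof U ρ).map φ = Wof (U.map φ) ρ := by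
  ext t f; simp only [Wof, of_apply, map_apply]; split_ifs <;> simp
lemma sum_Ci {M : Type} [AddCommMonoid M] (f : Q × T → M) (h : ∀ c, f c ≠ 0 → q.tgt c.1 = i ∧ δ c.2 = q.src c.1) : ∑ c : Ci q δ i, f c.1 = ∑ ρ, ∑ t, f (ρ, t) := by
  rw [← Fintype.sum_prod_type']
  refine Finset.sum_of_injOn Subtype.val Subtype.val_injective.injOn (by simp) ?_ (fun _ _ => rfl)
  intro c _ hc
  by_contra h0; exact hc ⟨⟨c, h c h0⟩, by simp, rfl⟩
lemma mo_iff {x : Pt Q T R} (hx : Lam q δ x) (W : Q → Matrix T F R) (h : ∀ ρ t f, W ρ t f ≠ 0 → δ t = q.tgt ρ ∧ i = q.src ρ) :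
    ∑ ρ, q.sg ρ • (x ρ * W (q.bar ρ)) = 0 ↔ AA q δ i x * Wto q δ i W = 0 := by
  have e : ∀ r f, (∑ ρ, q.sg ρ • (x ρ * W (q.bar ρ))) r f = ∑ ρ, ∑ t, q.sg ρ • (x ρ r t * W (q.bar ρ) t f) := fun r f => by
    rw [Matrix.sum_apply]; refine Finset.sum_congr rfl fun ρ _ => ?_
    rw [Matrix.smul_apply, mul_apply, Finset.smul_sum]
  have e2 : ∀ (r : mi δ i) f, (AA q δ i x * Wto q δ i W) r f = ∑ ρ, ∑ t, q.sg ρ • (x ρ r t * W (q.bar ρ) t f) := fun r f => by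
    rw [mul_apply, ← sum_Ci (q := q) (δ := δ) (i := i) (fun c : Q × T => q.sg c.1 • (x c.1 r c.2 * W (q.bar c.1) c.2 f))]
    · refine Finset.sum_congr rfl fun c _ => ?_
      simp only [AA, Wto, of_apply, mul_smul_comm]
    · intro c hc
      have : x c.1 r c.2 ≠ 0 := fun h0 => hc (by simp [h0])
      obtain ⟨h1, h2⟩ := hx.gr _ _ _ this
      exact ⟨h1.symm.trans r.2, h2⟩
  constructor
  · intro h0; ext r f; rw [e2, ← e, h0]; rfl
  · intro h0; ext r f
    by_cases hr : δ r = i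
    · rw [e, ← e2 ⟨r, hr⟩, h0]; rfl
    · rw [e]; refine Finset.sum_eq_zero fun ρ _ => Finset.sum_eq_zero fun t _ => ?_
      by_contra h1
      have h2 : x ρ r t ≠ 0 := fun h0 => h1 (by simp [h0])
      have h3 : W (q.bar ρ) t f ≠ 0 := fun h0 => h1 (by simp [h0])
      exact hr ((hx.gr _ _ _ h2).1.trans ((q.sb ρ).symm.trans (h _ _ _ h3).2.symm))
lemma AA_minor {x : Pt Q T K} (hx : Lam q δ x) (h : Sur δ i x) : ∃ s, ((AA q δ i x).submatrix id s).det ≠ 0 := by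
  apply exists_minor
  intro v hv
  let w : T → K := fun t => if ht : δ t = i then v ⟨t, ht⟩ else 0
  have : w = 0 := h.ann w (fun t ht => by by_contra h'; simp [w, h'] at ht) fun ρ => by
    ext u
    by_cases hc : q.tgt ρ = i ∧ δ u = q.src ρ
    · refine Eq.trans (Eq.symm ?_) (congrFun hv ⟨(ρ, u), hc⟩)
      refine Finset.sum_of_injOn Subtype.val (Subtype.val_injective.injOn) (by simp) ?_ ?_
      · intro t _ ht
        have : ¬ δ t = i := fun h' => ht ⟨⟨t, h'⟩, by simp, rfl⟩
        simp [w, this]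
      · rintro ⟨t, ht⟩ _; simp [w, ht, AA]
    · refine Finset.sum_eq_zero fun t _ => ?_
      by_contra h1
      have h2 := hx.gr _ _ _ (right_ne_zero_of_mul h1)
      have h3 : δ t = i := by by_contra h'; simp [w, h'] at h1
      exact hc ⟨h2.1.symm.trans h3, h2.2⟩
  ext ⟨t, ht⟩
  simpa [w, ht] using congrFun this t
lemma AA_sur {x : Pt Q T K} {s} (h : ((AA q δ i x).submatrix id s).det ≠ 0) : Sur δ i x := Sur.mk' fun v hv h0 => by
  have : (fun r : mi δ i => v r.1) ᵥ* ((AA q δ i x).submatrix id s) = 0 := by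
    ext r
    refine Eq.trans ?_ (congrFun (h0 (s r).1.1) (s r).1.2)
    refine Finset.sum_of_injOn Subtype.val (Subtype.val_injective.injOn) (by simp) ?_ (fun _ _ => rfl)
    intro t _ ht
    have : v t = 0 := by by_contra h'; exact ht ⟨⟨t, hv t h'⟩, by simp, rfl⟩
    simp [this]
  have h2 := eq_zero_of_vecMul_eq_zero h this
  ext t; by_contra ht; exact ht (congrFun h2 ⟨t, hv t ht⟩)
end
end KS

namespace KS
open Matrix
set_option linter.unusedSectionVars false
variable {I Q : Type} [DecidableEq I] [Fintype Q] [DecidableEq Q] {q : Qv I Q}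
section
variable {T F R K : Type} [Fintype T] [DecidableEq T] [Fintype F] [DecidableEq F]
  [CommRing R] [Field K] {δ : T → I} {i : I}

noncomputable def gW (x : Pt Q T R) (s : mi δ i → Ci q δ i) (θ : {c // c ∉ Set.range s} → F → R) : Q → Matrix T F R := Wof (WW (AA q δ i x) s (off s θ))

def gG (γ : F → mi δ i → R) : Matrix F T R := of fun f t => if h : δ t = i then γ f ⟨t, h⟩ else 0

noncomputable def Y (x : Pt Q T R) (s : mi δ i → Ci q δ i) (θ : {c // c ∉ Set.range s} → F → R) (γ : F → mi δ i → R) : Pt Q (T ⊕ F) R := yy x (gW x s θ) (gG γ)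
variable {s : mi δ i → Ci q δ i}
lemma Y_map {R' : Type} [CommRing R'] (φ : R →+* R') (x : Pt Q T R) (θ : {c // c ∉ Set.range s} → F → R) (γ : F → mi δ i → R) :
    mp φ (Y x s θ γ) = Y (mp φ x) s (fun c f => φ (θ c f)) (fun f r => φ (γ f r)) := by
  have h1 : ∀ ρ, (gW x s θ ρ).map φ = gW (mp φ x) s (fun c f => φ (θ c f)) ρ := fun ρ => by
    rw [gW, Wof_map, WW_map, gW]
    congr 2
    ext c f; simp only [off, map_apply, of_apply]; split_ifs <;> simp
  have h2 : (gG γ).map φ = gG (δ := δ) (i := i) (fun f r => φ (γ f r)) := by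
    ext f t; simp only [gG, map_apply, of_apply]; split_ifs <;> simp
  funext ρ
  have h1' := (funext h1).symm
  rw [mp, Y, Y, yy, yy, Matrix.map_mul, h1', ← h2]
  congr 1
  · ext (a | a) b
    · simp [one_apply];
    · simp
  · ext a (b | b)
    · simp only [map_apply, fromCols_apply_inl, Matrix.sub_apply, map_sub, mp, ← Matrix.map_mul]
    · simp
lemma Y_yd {x : Pt Q T R} (hx : Lam q δ x) (θ : {c // c ∉ Set.range s} → F → R) (γ : F → mi δ i → R) : YD q δ i x (gW x s θ) (gG γ) where
  lam := hx
  gW := Wof_gr _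
  gg f t h := by by_contra h'; exact h (by simp [gG, h'])
  mo := (mo_iff hx _ (Wof_gr _)).2 (by rw [Wto_of, mul_WW])
lemma Y_ex {x : Pt Q T K} {W : Q → Matrix T F K} {g : Matrix F T K} (h : YD q δ i x W g) (hs : ((AA q δ i x).submatrix id s).det ≠ 0) :
    ∃ θ γ, Y x s θ γ = yy x W g := by
  refine ⟨fun c f => ((AA q δ i x).submatrix id s).det⁻¹ * Wto q δ i W c.1 f, fun f r => g f r.1, ?_⟩
  have h1 := exists_off hs (Wto q δ i W) ((mo_iff h.lam W h.gW).1 h.mo)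
  rw [Y, gW, h1, Wof_to W h.gW]
  congr 1
  ext f t; simp only [gG, of_apply]; split_ifs with h'
  · rfl
  · by_contra h0; exact h' (h.gg f t (Ne.symm h0))
lemma adj_mem {m L : Type} [Fintype m] [DecidableEq m] [Field L] [Algebra ℂ L] (N : IntermediateField ℂ L) (A : Matrix m m L) (h : ∀ a b, A a b ∈ N) :
    A.det ∈ N ∧ ∀ a b, A.adjugate a b ∈ N := by
  let B : Matrix m m N := of fun a b => ⟨A a b, h a b⟩
  have hB : N.val.toRingHom.mapMatrix B = A := rfl
  constructor
  · rw [← hB, ← RingHom.map_det]; exact (B.det).2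
  · intro a b; rw [← hB, ← RingHom.map_adjugate]; exact (B.adjugate a b).2
lemma Y_mem {L : Type} [Field L] [Algebra ℂ L] (N : IntermediateField ℂ L) {x : Pt Q T L} (hx : Lam q δ x) (θ : {c // c ∉ Set.range s} → F → L) (γ : F → mi δ i → L)
    (hs : ((AA q δ i x).submatrix id s).det ≠ 0) (h : ∀ ρ u v, Y x s θ γ ρ u v ∈ N) :
    (∀ ρ u v, x ρ u v ∈ N) ∧ (∀ c f, θ c f ∈ N) ∧ ∀ f r, γ f r ∈ N := by
  simp only [Y, yy_eq] at h
  have hW : ∀ ρ u v, gW x s θ ρ u v ∈ N := fun ρ u v => h ρ (.inl u) (.inr v)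
  have hA : ∀ ρ u v, (x ρ - gW x s θ ρ * gG γ) u v ∈ N := fun ρ u v => h ρ (.inl u) (.inl v)
  have hB : ∀ ρ u v, (gG γ * (x ρ - gW x s θ ρ * gG γ)) u v ∈ N := fun ρ u v => h ρ (.inr u) (.inl v)
  have h0 : ∀ ρ, q.tgt ρ = i → x ρ - gW x s θ ρ * gG γ = x ρ := fun ρ hρ => by
    have : gW x s θ ρ = 0 := by
      ext u v; by_contra h'
      exact q.nl ρ ((Wof_gr _ _ _ _ h').2.symm.trans hρ.symm)
    rw [this]; simp
  have hAA : ∀ a b, AA q δ i x a b ∈ N := fun a b => by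
    have := hA b.1.1 a.1 b.1.2; rwa [h0 _ b.2.1] at this
  obtain ⟨hd, hadj⟩ := adj_mem N ((AA q δ i x).submatrix id s) fun a b => hAA _ _
  have hgA : ∀ f c, (of γ * AA q δ i x : Matrix F _ L) f c ∈ N := fun f c => by
    have := hB c.1.1 f c.1.2
    rw [h0 _ c.2.1] at this
    convert this using 1
    rw [mul_apply, mul_apply]
    refine Finset.sum_of_injOn Subtype.val (Subtype.val_injective.injOn) (by simp) ?_ ?_
    · intro t _ ht
      have : ¬ δ t = i := fun h' => ht ⟨⟨t, h'⟩, by simp, rfl⟩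
      simp [gG, this]
    · rintro ⟨t, ht⟩ _; simp [gG, ht, AA]
  have hg : ∀ f r, γ f r ∈ N := fun f r => by
    have e : ((AA q δ i x).submatrix id s).det • (of γ : Matrix F _ L) = (of γ * AA q δ i x : Matrix F _ L).submatrix id s * ((AA q δ i x).submatrix id s).adjugate := by
      rw [← mul_SS (of γ * AA q δ i x : Matrix F _ L), Matrix.mul_assoc (of γ), mul_SS, Matrix.mul_assoc, mul_adjugate]; simp
    have e2 := congrFun (congrFun e f) r
    have : γ f r = ((AA q δ i x).submatrix id s).det⁻¹ * (((of γ * AA q δ i x : Matrix F _ L).submatrix id s * ((AA q δ i x).submatrix id s).adjugate) f r) := by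
      rw [← e2, Matrix.smul_apply, smul_eq_mul, of_apply]; field_simp
    rw [this]
    exact mul_mem (inv_mem hd) (sum_mem fun r _ => mul_mem (hgA _ _) (hadj _ _))
  refine ⟨fun ρ u v => ?_, fun c f => ?_, hg⟩
  · rw [← sub_add_cancel (x ρ) (gW x s θ ρ * gG γ)]
    refine add_mem (hA ρ u v) (sum_mem fun f _ => mul_mem (hW _ _ _) ?_)
    simp only [gG, of_apply]; split_ifs
    exacts [hg _ _, zero_mem _]
  · have e := WW_off (AA q δ i x) s (off s θ) c.1 c.2 f
    rw [off, of_apply, dif_neg c.2] at e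
    have : θ c f = ((AA q δ i x).submatrix id s).det⁻¹ * Wto q δ i (gW x s θ) c.1 f := by
      rw [gW, Wto_of]; simp only [off]; rw [e]; field_simp
    rw [this]
    refine mul_mem (inv_mem hd) ?_
    simp only [Wto, of_apply]
    exact zsmul_mem (hW _ _ _) _

noncomputable def gp {T : Type} (P : Ideal (MvPolynomial (Q × T × T) ℂ)) : Pt Q T (MvPolynomial (Q × T × T) ℂ ⧸ P) := fun ρ s t => gpt P (ρ, s, t)
lemma mp_gp [Algebra ℂ R] {P : Ideal (MvPolynomial (Q × T × T) ℂ)} (x : Pt Q T R) (h : P ≤ pd x) : mp (ev (co x) h) (gp P) = x := by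
  funext ρ; ext a b; exact congrFun (ev_gpt (co x) h) (ρ, a, b)
lemma gp_lam [Algebra ℂ R] {x : Pt Q T R} (h : Lam q δ x) : Lam q δ (gp (pd x)) := by
  refine Lam.of_map (ev (co x) le_rfl).toRingHom (ev_inj (co x) rfl) ?_
  have := mp_gp x le_rfl
  rw [← this] at h; exact h
lemma AA_map {R' : Type} [CommRing R'] (φ : R →+* R') (x : Pt Q T R) : ((AA q δ i (mp φ x)).submatrix id s).det = φ ((AA q δ i x).submatrix id s).det := by
  rw [RingHom.map_det]; rfl
lemma AA_le {K' : Type} [Field K'] [Algebra ℂ K'] [Algebra ℂ K] {x : Pt Q T K} {x' : Pt Q T K'} (h : pd x ≤ pd x') (hs : ((AA q δ i x').submatrix id s).det ≠ 0) : ((AA q δ i x).submatrix id s).det ≠ 0 := by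
  rw [← mp_gp x' h] at hs
  have h1 : ((AA q δ i (gp (pd x))).submatrix id s).det ≠ 0 := fun h0 => hs ((AA_map (ev (co x') h).toRingHom _).trans (by rw [h0, map_zero]))
  rw [← mp_gp x le_rfl]
  have h2 := AA_map (s := s) (q := q) (ev (co x) le_rfl).toRingHom (gp (pd x))
  intro h0
  exact h1 (ev_inj (co x) rfl ((h2.symm.trans h0).trans (map_zero _).symm))
end
end KS

namespace KS
open Matrix
set_option linter.unusedSectionVars false
variable {I Q : Type} [DecidableEq I] [Fintype Q] [DecidableEq Q] {q : Qv I Q}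
section
variable {T K K' : Type} [Fintype T] [DecidableEq T] [Field K] [Field K'] [Algebra ℂ K] [Algebra ℂ K'] {δ : T → I} {i : I}
lemma pd_map {R R' : Type} [CommRing R] [CommRing R'] [Algebra ℂ R] [Algebra ℂ R'] (φ : R →ₐ[ℂ] R') (hφ : Function.Injective φ) (z : Pt Q T R) : pd (mp φ z) = pd z :=
  pid_eq (co z) φ hφ
lemma univ1 (κ A : Type) [Finite κ] [CommRing A] [IsDomain A] [Algebra ℂ A] : ∃ (R L : Type) (_ : CommRing R) (_ : Algebra ℂ R) (_ : Field L) (_ : Algebra ℂ L) (l : R →ₐ[ℂ] L)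
    (j : A →ₐ[ℂ] R) (w : κ → R), Function.Injective l ∧ Function.Injective j ∧ Algebra.trdeg ℂ L = Algebra.trdeg ℂ A + (Nat.card κ : ℕ) ∧
    (∀ N : IntermediateField ℂ L, (∀ a, l (j a) ∈ N) → (∀ k, l (w k) ∈ N) → N = ⊤) ∧
    ∀ (K : Type) [Field K] [Algebra ℂ K] (ψ : A →ₐ[ℂ] K) (w2 : κ → K), ∃ φ : R →ₐ[ℂ] K, (∀ v, φ (j v) = ψ v) ∧ ∀ k, φ (w k) = w2 k := by
  have hi : Function.Injective (algebraMap (MvPolynomial κ A) (FractionRing (MvPolynomial κ A))) := IsFractionRing.injective _ _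
  refine ⟨MvPolynomial κ A, FractionRing (MvPolynomial κ A), inferInstance, inferInstance, inferInstance, inferInstance,
    IsScalarTower.toAlgHom ℂ _ _, IsScalarTower.toAlgHom ℂ _ _, MvPolynomial.X, hi, MvPolynomial.C_injective κ _, trdeg_fr κ _, fun N h1 h2 => ?_, ?_⟩
  · have h3 : ∀ r, algebraMap (MvPolynomial κ A) (FractionRing (MvPolynomial κ A)) r ∈ N := fun r => by
      induction r using MvPolynomial.induction_on with
      | C a => exact h1 a
      | add p q hp hq => rw [map_add]; exact add_mem hp hq
      | mul_X p n hp => rw [map_mul]; exact mul_mem hp (h2 n)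
    rw [eq_top_iff]; intro z _
    obtain ⟨a, b, -, rfl⟩ := IsFractionRing.div_surjective (A := MvPolynomial κ A) z
    exact div_mem (h3 a) (h3 b)
  · intro K _ _ ψ w2
    let _ := ψ.toRingHom.toAlgebra
    have : IsScalarTower ℂ A K := .of_algebraMap_eq fun r => (ψ.commutes r).symm
    exact ⟨(MvPolynomial.aeval w2).restrictScalars ℂ, fun v => MvPolynomial.aeval_C _ _, fun k => MvPolynomial.aeval_X _ _⟩
lemma exists_univ {κ σ : Type} [Finite κ] (P : Ideal (MvPolynomial σ ℂ)) [P.IsPrime] : ∃ (R L : Type) (_ : CommRing R) (_ : Algebra ℂ R) (_ : Field L) (_ : Algebra ℂ L) (l : R →ₐ[ℂ] L)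
    (u : σ → R) (w : κ → R), Function.Injective l ∧ pid u = P ∧ Algebra.trdeg ℂ L = td P + (Nat.card κ : ℕ) ∧
    (∀ N : IntermediateField ℂ L, (∀ v, l (u v) ∈ N) → (∀ k, l (w k) ∈ N) → N = ⊤) ∧
    ∀ (K : Type) [Field K] [Algebra ℂ K] (u2 : σ → K) (w2 : κ → K), P ≤ pid u2 → ∃ φ : R →ₐ[ℂ] K, (∀ v, φ (u v) = u2 v) ∧ ∀ k, φ (w k) = w2 k := by
  obtain ⟨R, L, _, _, _, _, l, j, w, hl, hj, htd, htop, hsp⟩ := univ1 κ (MvPolynomial σ ℂ ⧸ P)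
  refine ⟨R, L, _, _, _, _, l, fun v => j (gpt P v), w, hl, (pid_eq (gpt P) j hj).trans (pid_gpt P), htd, fun N h1 h2 => htop N (fun a => ?_) h2, fun K _ _ u2 w2 h => ?_⟩
  · obtain ⟨a, rfl⟩ := Ideal.Quotient.mk_surjective a
    induction a using MvPolynomial.induction_on with
    | C a =>
      have := (l.comp (j.comp (Ideal.Quotient.mkₐ ℂ P))).commutes a
      exact this ▸ N.algebraMap_mem a
    | add p q hp hq => rw [map_add, map_add, map_add]; exact add_mem hp hq
    | mul_X p n hp => rw [map_mul, map_mul, map_mul]; exact mul_mem hp (h1 n)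
  · obtain ⟨φ, h1, h2⟩ := hsp K (ev u2 h) w2
    exact ⟨φ, fun v => (h1 _).trans (congrFun (ev_gpt u2 h) v), h2⟩

theorem gen (F : Type) [Fintype F] [DecidableEq F] {x' : Pt Q T K'} (hx' : Lam q δ x') {x1 : Pt Q T K} (hx1 : Lam q δ x1) (h1 : Sur δ i x1) (hle : pd x' ≤ pd x1) :
    ∃ (L : Type) (_ : Field L) (_ : Algebra ℂ L) (x0 : Pt Q T L) (W : Q → Matrix T F L) (g : Matrix F T L), YD q δ i x0 W g ∧ Sur δ i x0 ∧ pd x0 = pd x' ∧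
    td (pd (yy x0 W g)) = td (pd x') + (Fintype.card F * Fintype.card (Ci q δ i) : ℕ) ∧
    ∀ (K2 : Type) [Field K2] [Algebra ℂ K2] (x2 : Pt Q T K2) (W2 : Q → Matrix T F K2) (g2 : Matrix F T K2), YD q δ i x2 W2 g2 → pd x' ≤ pd x2 → pd x2 ≤ pd x1 →
      pd (yy x0 W g) ≤ pd (yy x2 W2 g2) := by
  classical
  obtain ⟨s, hs⟩ := AA_minor hx1 h1
  let κ := ({c // c ∉ Set.range s} × F) ⊕ (F × mi δ i)
  obtain ⟨R, L, _, _, _, _, l, u, w, hl, hu, htd, htop, hsp⟩ := exists_univ (κ := κ) (pd x')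
  let xR : Pt Q T R := fun ρ s t => u (ρ, s, t)
  let θ : {c // c ∉ Set.range s} → F → R := fun c f => w (.inl (c, f))
  let γ : F → mi δ i → R := fun f r => w (.inr (f, r))
  let yR := Y xR s θ γ
  have ex : pd (mp l xR) = pd x' := (pd_map l hl xR).trans hu
  have ey : mp l yR = Y (mp l xR) s (fun c f => l (θ c f)) (fun f r => l (γ f r)) := Y_map l.toRingHom xR θ γ
  have hlam : Lam q δ (mp l xR) := by
    have := (gp_lam hx').map (ev (co (mp l xR)) ex.ge).toRingHom
    rw [← mp_gp (mp l xR) ex.ge]; exact this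
  have hdet : ((AA q δ i (mp l xR)).submatrix id s).det ≠ 0 := AA_le (ex.trans_le hle) hs
  refine ⟨L, inferInstance, inferInstance, mp l xR, _, _, Y_yd hlam (fun c f => l (θ c f)) (fun f r => l (γ f r)), AA_sur hdet, ex, ?_, ?_⟩
  · have h2 := td_adj (co (Y (mp l xR) s (fun c f => l (θ c f)) (fun f r => l (γ f r)))) (htop _ ?_ ?_)
    · refine h2.trans (htd.trans ?_)
      have hc : Nat.card κ = Fintype.card F * Fintype.card (Ci q δ i) := by
        have h3 : Fintype.card {c // c ∉ Set.range s} = Fintype.card (Ci q δ i) - Fintype.card (mi δ i) := by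
          rw [Fintype.card_subtype_compl]; congr 1
          exact (Fintype.card_congr (Equiv.ofInjective s (det_inj hs))).symm
        have h4 : Fintype.card (mi δ i) ≤ Fintype.card (Ci q δ i) := Fintype.card_le_of_injective s (det_inj hs)
        rw [Nat.card_eq_fintype_card, Fintype.card_sum, Fintype.card_prod, Fintype.card_prod, h3, mul_comm, ← mul_add, Nat.sub_add_cancel h4]
      rw [hc]
    all_goals
      obtain ⟨k1, k2, k3⟩ := Y_mem (IntermediateField.adjoin ℂ (Set.range (co (Y (mp l xR) s (fun c f => l (θ c f)) (fun f r => l (γ f r)))))) hlam _ _ hdet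
        fun ρ u v => IntermediateField.subset_adjoin _ _ ⟨(ρ, u, v), rfl⟩
    · rintro ⟨ρ, u, v⟩; exact k1 ρ u v
    · rintro (⟨c, f⟩ | ⟨f, r⟩)
      · exact k2 c f
      · exact k3 f r
  · intro K2 _ _ x2 W2 g2 hY hle2 hle3
    obtain ⟨θ2, γ2, h2⟩ := Y_ex hY (AA_le hle3 hs)
    obtain ⟨φ, f1, f2⟩ := hsp K2 (co x2) (Sum.elim (fun c => θ2 c.1 c.2) fun c => γ2 c.1 c.2) hle2
    have h3 : mp φ yR = yy x2 W2 g2 := by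
      refine (Y_map φ.toRingHom xR θ γ).trans ?_
      rw [← h2]
      congr 1
      · funext ρ; ext a b; exact f1 _
      · funext c f; exact f2 _
      · funext c f; exact f2 _
    have h4 := pd_map l hl yR
    rw [ey] at h4
    refine h4.trans_le ?_
    rw [← h3]
    exact pid_le (co yR) φ
end
end KS

namespace KS
open Matrix
set_option linter.unusedSectionVars false
variable {I Q : Type} [DecidableEq I] [Fintype Q] [DecidableEq Q] {q : Qv I Q}
section
variable {σ τ K K' : Type} [CommRing K] [CommRing K'] [Algebra ℂ K] [Algebra ℂ K']
lemma mem_ren (e : σ → τ) (f : τ → K) (p) : p ∈ pid (f ∘ e) ↔ MvPolynomial.rename e p ∈ pid f := by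
  rw [mem_pid, mem_pid, MvPolynomial.aeval_rename]
lemma ren_le (e : σ → τ) {f : τ → K} {g : τ → K'} (h : pid f ≤ pid g) : pid (f ∘ e) ≤ pid (g ∘ e) := fun p hp => by
  rw [mem_ren] at *; exact h hp
lemma ren_td' (e : σ → τ) (f : τ → K) : td (pid (f ∘ e)) ≤ td (pid f) := by
  have h : pid (f ∘ e) = (pid f).comap (MvPolynomial.rename (R := ℂ) e) := Ideal.ext fun p => mem_ren e f p
  refine trdeg_le_of_injective (Ideal.quotientMapₐ (pid f) (MvPolynomial.rename (R := ℂ) e) h.le) ?_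
  exact Ideal.quotientMap_injective' (H := h.le) h.ge
lemma ren_td (e : σ ≃ τ) (f : τ → K) : td (pid (f ∘ e)) = td (pid f) := by
  refine le_antisymm (ren_td' e f) ?_
  have := ren_td' e.symm (f ∘ e)
  simpa [Function.comp_assoc] using this
end
section
variable {T T' F R K K' : Type} [Fintype T] [DecidableEq T] [Fintype T'] [DecidableEq T'] [Fintype F] [DecidableEq F] [CommRing R] [Field K] [Field K'] [Algebra ℂ K] [Algebra ℂ K'] {δ : T → I} {δ' : T' → I} {i : I}

def ri (e : T' ≃ T) (z : Pt Q T R) : Pt Q T' R := fun ρ => (z ρ).submatrix e e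
lemma ri_ri (e : T' ≃ T) (z : Pt Q T R) : ri e.symm (ri e z) = z := by funext ρ; simp [ri]
lemma co_ri (e : T' ≃ T) (z : Pt Q T R) : co (ri e z) = co z ∘ Equiv.prodCongr (Equiv.refl Q) (Equiv.prodCongr e e) := rfl
lemma co_st (z : Pt Q T R) : co (st q z) = co z ∘ Equiv.prodCongr ⟨q.bar, q.bar, q.bb, q.bb⟩ (Equiv.prodComm T T) := rfl
lemma ri_le (e : T' ≃ T) {z : Pt Q T K} {z' : Pt Q T K'} (h : pd z ≤ pd z') : pd (ri e z) ≤ pd (ri e z') := by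
  rw [pd, pd, co_ri, co_ri]; exact ren_le _ h
lemma ri_td (e : T' ≃ T) (z : Pt Q T K) : td (pd (ri e z)) = td (pd z) := by
  rw [pd, co_ri, ren_td]
lemma st_le {z : Pt Q T K} {z' : Pt Q T K'} (h : pd z ≤ pd z') : pd (st q z) ≤ pd (st q z') := by
  rw [pd, pd, co_st, co_st]; exact ren_le _ h
lemma st_td (z : Pt Q T K) : td (pd (st q z)) = td (pd z) := by
  rw [pd, co_st, ren_td]
lemma Iso.lam {z : Pt Q T K} {x : Pt Q T' K} (h : Iso δ δ' z x) (hz : Lam q δ z) : Lam q δ' x := by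
  obtain ⟨M, N, hM, hN, h1, h2, c⟩ := h
  exact hz.sub hM hN h2 c
lemma ri_iso (e : T' ≃ T) (he : ∀ t, δ (e t) = δ' t) (z : Pt Q T K) : Iso δ δ' z (ri e z) := .of_equiv z e he

def dm (q : Qv I Q) (δ : T → I) : ℕ := (∑ ρ, ct δ (q.src ρ) * ct δ (q.tgt ρ)) / 2
lemma dm_ct (h : ∀ i, ct δ i = ct δ' i) : dm q δ = dm q δ' := by simp [dm, h]
lemma ct_dd (j : I) : ct (dd F δ i) j = ct δ j + if i = j then Fintype.card F else 0 := by
  simp only [ct, Finset.card_filter, Fintype.sum_sum_type, Sum.elim_inl, Sum.elim_inr]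
  split_ifs with h <;> simp only [h, if_true, if_false, Finset.sum_const, smul_eq_mul, mul_one, mul_zero, Finset.card_univ] <;> rfl
lemma card_Ci : Fintype.card (Ci q δ i) = ∑ ρ, if q.tgt ρ = i then ct δ (q.src ρ) else 0 := by
  have := sum_Ci (q := q) (δ := δ) (i := i) (fun c : Q × T => if q.tgt c.1 = i ∧ δ c.2 = q.src c.1 then 1 else 0) (by simp)
  rw [Fintype.card_eq_sum_ones]
  refine (Finset.sum_congr rfl fun c _ => ?_).trans (this.trans (Finset.sum_congr rfl fun ρ _ => ?_))
  · rw [if_pos c.2]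
  · by_cases h : q.tgt ρ = i <;> simp [h, ct]
lemma dm_dd : dm q (dd F δ i) = dm q δ + Fintype.card F * Fintype.card (Ci q δ i) := by
  have h2 : ∑ ρ, (if q.src ρ = i then ct δ (q.tgt ρ) else 0) = ∑ ρ, if q.tgt ρ = i then ct δ (q.src ρ) else 0 := by
    rw [← Equiv.sum_comp (⟨q.bar, q.bar, q.bb, q.bb⟩ : Q ≃ Q)]; simp [q.tb, q.sb]
  have : ∑ ρ, ct (dd F δ i) (q.src ρ) * ct (dd F δ i) (q.tgt ρ) = ∑ ρ, ct δ (q.src ρ) * ct δ (q.tgt ρ) + (Fintype.card F * Fintype.card (Ci q δ i)) * 2 := by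
    rw [mul_assoc, mul_two, card_Ci]; nth_rw 2 [← h2]
    rw [mul_add, Finset.mul_sum, Finset.mul_sum, ← Finset.sum_add_distrib, ← Finset.sum_add_distrib]
    refine Finset.sum_congr rfl fun ρ _ => ?_
    rw [ct_dd, ct_dd]
    have := q.nl ρ
    by_cases h : i = q.src ρ
    · subst h; rw [if_pos rfl, if_neg this, if_neg this.symm, if_pos rfl]; ring
    · rw [if_neg h, if_neg (Ne.symm h)]
      by_cases h' : i = q.tgt ρ
      · rw [if_pos h', if_pos h'.symm]; ring
      · rw [if_neg h', if_neg (Ne.symm h')]; ring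
  rw [dm, this, Nat.add_mul_div_right _ _ two_pos, dm]

structure Gd (q : Qv I Q) (δ : T → I) (z : Pt Q T K) : Prop where
  lam : Lam q δ z
  td : td (pd z) = dm q δ

lemma not_sur [Nonempty T] {z : Pt Q T K} (hz : Lam q δ z) : ∃ i, ¬ Sur δ i z := by
  by_contra! h
  obtain ⟨N, hN⟩ := hz.nil
  induction N with
  | zero =>
    have := hN [] rfl
    simp at this
  | succ N ih =>
    refine ih fun l hl => ?_
    have h0 : ∀ i, (l.map z).prod * en K δ i = 0 := fun i => (h i).zero (by rw [Matrix.mul_assoc, en_en]) fun ρ => by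
      have h1 := hN (l ++ [ρ]) (by simp [hl])
      simp only [List.map_append, List.prod_append, List.map_cons, List.map_nil, List.prod_singleton] at h1
      rw [Matrix.mul_assoc]
      by_cases hi : q.tgt ρ = i
      · rw [show en K δ i * z ρ = z ρ from ?_, h1]
        ext s t
        rw [en, diagonal_mul]
        by_cases h2 : z ρ s t = 0
        · simp [h2]
        · rw [(hz.gr _ _ _ h2).1, if_pos hi, one_mul]
      · rw [show en K δ i * z ρ = 0 from ?_, Matrix.mul_zero]
        ext s t
        rw [en, diagonal_mul]
        by_cases h2 : z ρ s t = 0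
        · simp [h2]
        · rw [(hz.gr _ _ _ h2).1, if_neg hi, zero_mul, Matrix.zero_apply]
    ext s t
    have := congrFun (congrFun (h0 (δ t)) s) t
    simpa [en] using this
lemma td_fin (z : Pt Q T K) : td (pd z) < Cardinal.aleph0 := trdeg_lt_aleph0_of_finiteType
lemma ct_equiv (e : T' ≃ T) (he : ∀ t, δ (e t) = δ' t) (j : I) : ct δ j = ct δ' j := by
  simp only [ct, Finset.card_filter]
  rw [← Equiv.sum_comp e]; simp [he]
lemma sur_yy (e : T' ⊕ F ≃ T) [IsEmpty F] (he : ∀ t, δ (e t) = dd F δ' i t) {z : Pt Q T K} {x W g} (hs : Sur δ' i x) (hY : YD q δ' i x W g) (hz : ri e z = yy x W g) : Sur δ i z := by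
  obtain ⟨J, L, h⟩ := yy_sub x W hY.gg hs
  rw [← hz] at h
  obtain ⟨J, L, h⟩ := h.isoz (ri_iso e he z).symm
  exact h.sur (by simp [← Fintype.card_congr e])
end
section
variable {K : Type} [Field K] [Algebra ℂ K]
theorem claim (n : ℕ) : ∀ {T : Type} [Fintype T] [DecidableEq T] {δ : T → I} {K : Type} [Field K] [Algebra ℂ K] {z : Pt Q T K}, Fintype.card T = n → Lam q δ z →
    ∃ (K' : Type) (_ : Field K') (_ : Algebra ℂ K') (y : Pt Q T K'), Gd q δ y ∧ pd y ≤ pd z := by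
  induction n using Nat.strong_induction_on with | _ n ih => ?_
  intro T _ _ δ K _ _ z hT hz
  rcases isEmpty_or_nonempty T with h | h
  · refine ⟨K, _, _, z, ⟨hz, ?_⟩, le_rfl⟩
    have h1 : dm q δ = 0 := by simp [dm, ct]
    rw [h1]
    refine le_antisymm ?_ zero_le
    refine (trdeg_le_of_surjective (Ideal.Quotient.mkₐ ℂ (pd z)) (Ideal.Quotient.mkₐ_surjective _ _)).trans ?_
    rw [MvPolynomial.trdeg_of_isDomain]; simp
  · obtain ⟨i, hi⟩ := not_sur hz
    obtain ⟨T', F, _, _, _, _, δ', e, x, W, g, he, hY, hs, hxy⟩ := exists_yy hz i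
    have hF : Nonempty F := by
      by_contra hF; rw [not_nonempty_iff] at hF
      exact hi (sur_yy e he hs hY hxy)
    have hc := Fintype.card_congr e
    rw [Fintype.card_sum] at hc
    have := Fintype.card_pos (α := F)
    obtain ⟨K', _, _, y, hy, hle⟩ := ih (Fintype.card T') (by omega) rfl hY.lam
    obtain ⟨L, _, _, x0, W0, g0, hY0, -, h0, htd, hsp⟩ := gen F hy.lam hY.lam hs hle
    refine ⟨L, _, _, ri e.symm (yy x0 W0 g0), ⟨(ri_iso e.symm (δ' := δ) (fun t => by rw [← he]; simp) _).lam hY0.yy, ?_⟩, ?_⟩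
    · rw [ri_td, htd, hy.td, ← Nat.cast_add, ← dm_dd, dm_ct (ct_equiv e he)]
    · have := ri_le e.symm (hsp _ x W g hY hle le_rfl)
      rw [← hxy] at this
      exact this.trans_eq (congrArg pd (ri_ri e z))
variable {T T' F : Type} [Fintype T] [DecidableEq T] [Fintype T'] [DecidableEq T'] [Fintype F] [DecidableEq F] {δ : T → I} {δ' : T' → I} {i : I}
lemma UB {z : Pt Q T K} (hz : Lam q δ z) : td (pd z) ≤ dm q δ := by
  obtain ⟨K', _, _, y, hy, hle⟩ := claim _ rfl hz
  exact hy.td ▸ td_mono hle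
lemma Gd.eq {K' : Type} [Field K'] [Algebra ℂ K'] {z : Pt Q T K} {y : Pt Q T K'} (hz : Gd q δ z) (hy : Lam q δ y) (h : pd y ≤ pd z) : pd y = pd z :=
  td_eq h (hz.td.symm ▸ UB hy)
lemma Gd.yy {x : Pt Q T K} {W : Q → Matrix T F K} {g : Matrix F T K} (hY : YD q δ i x W g) (hs : Sur δ i x) (h : Gd q (dd F δ i) (yy x W g)) : Gd q δ x := by
  refine ⟨hY.lam, le_antisymm (UB hY.lam) ?_⟩
  obtain ⟨L, _, _, x0, W0, g0, hY0, -, h0, htd, hsp⟩ := gen F hY.lam hY.lam hs le_rfl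
  have h1 := td_mono (hsp _ x W g hY le_rfl le_rfl)
  rw [h.td, htd, dm_dd] at h1
  obtain ⟨n, hn⟩ := Cardinal.lt_aleph0.1 (td_fin x)
  rw [hn] at h1 ⊢
  exact_mod_cast Nat.le_of_add_le_add_right (by exact_mod_cast h1)
lemma Gd.st {z : Pt Q T K} (h : Gd q δ z) : Gd q δ (st q z) := ⟨h.lam.st, (st_td z).trans h.td⟩
lemma Gd.ri {z : Pt Q T K} (h : Gd q δ z) (e : T' ≃ T) (he : ∀ t, δ (e t) = δ' t) : Gd q δ' (ri e z) :=
  ⟨(ri_iso e he z).lam h.lam, by rw [ri_td, h.td, dm_ct (ct_equiv e he)]⟩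
lemma pd_le {R R' : Type} [CommRing R] [CommRing R'] [Algebra ℂ R] [Algebra ℂ R'] (φ : R →ₐ[ℂ] R') (z : Pt Q T R) : pd z ≤ pd (mp φ z) := pid_le (co z) φ
lemma Lam.of_le {R R' : Type} [CommRing R] [CommRing R'] [Algebra ℂ R] [Algebra ℂ R'] {x : Pt Q T R} {y : Pt Q T R'} (h : Lam q δ x) (hle : pd x ≤ pd y) : Lam q δ y := by
  rw [← mp_gp y hle]; exact (gp_lam h).map (ev (co y) hle).toRingHom
lemma Lam.conj {z : Pt Q T K} (hz : Lam q δ z) {A B : Matrix T T K} {c d : K} (hA : gd δ δ A) (hB : gd δ δ B) (h : B * A = d • (1 : Matrix T T K)) : Lam q δ (fun ρ => c • (A * z ρ * B)) where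
  gr ρ s t h0 := by
    obtain ⟨r, h1, h2⟩ := exists_mul_ne (right_ne_zero_of_mul (a := c) h0)
    obtain ⟨r', h3, h4⟩ := exists_mul_ne h1
    obtain ⟨h5, h6⟩ := hz.gr _ _ _ h4
    exact ⟨(hA _ _ h3).trans h5, (hB _ _ h2).symm.trans h6⟩
  mo := by
    have : ∀ ρ, q.sg ρ • (c • (A * z ρ * B) * c • (A * z (q.bar ρ) * B)) = (c * c * d) • (A * (q.sg ρ • (z ρ * z (q.bar ρ))) * B) := fun ρ => by
      have h1 : A * z ρ * B * (A * z (q.bar ρ) * B) = d • (A * (z ρ * z (q.bar ρ)) * B) := by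
        calc _ = A * z ρ * (B * A) * z (q.bar ρ) * B := by simp only [Matrix.mul_assoc]
          _ = _ := by rw [h, Matrix.mul_smul, Matrix.mul_one, Matrix.smul_mul, Matrix.smul_mul]; simp only [Matrix.mul_assoc]
      rw [Matrix.smul_mul, Matrix.mul_smul, h1, Matrix.mul_smul, Matrix.smul_mul, smul_smul, smul_smul, smul_comm]
    rw [Finset.sum_congr rfl fun ρ _ => this ρ, ← Finset.smul_sum, ← Finset.sum_mul, ← Finset.mul_sum, hz.mo]; simp
  nil := by
    obtain ⟨N, hN⟩ := hz.nil
    refine ⟨N + 1, fun l hl => ?_⟩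
    rcases List.eq_nil_or_concat' l with rfl | ⟨l, ρ, rfl⟩
    · simp at hl
    have h1 := prod_comm (z := fun ρ => c • (A * z ρ * B)) (J := A) (x := fun ρ => (c * d) • z ρ) (fun ρ => by
      rw [Matrix.smul_mul, Matrix.mul_assoc, h, Matrix.mul_smul, Matrix.mul_one, smul_smul, Matrix.mul_smul]) l
    have h2 : (l.map fun ρ => (c * d) • z ρ).prod = (c * d) ^ l.length • (l.map z).prod := by
      clear h1 hl
      induction l with
      | nil => simp
      | cons a l ih => simp [ih, pow_succ, smul_smul, mul_comm]
    rw [h2, hN l (by simpa using hl), smul_zero, Matrix.mul_zero] at h1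
    rw [List.map_append, List.prod_append, List.map_singleton, List.prod_singleton, Matrix.mul_smul, Matrix.mul_assoc, ← Matrix.mul_assoc, h1, Matrix.zero_mul, smul_zero]
lemma gd_adj {H : Matrix T T K} (h : gd δ δ H) (hd : H.det ≠ 0) : gd δ δ H.adjugate := fun s t hst => by
  have h1 := h.en (δ t)
  have h2 : H.det • (H.adjugate * en K δ (δ t)) = H.det • (en K δ (δ t) * H.adjugate) := by
    calc _ = H.adjugate * en K δ (δ t) * (H.det • 1) := by rw [Matrix.mul_smul, Matrix.mul_one]
      _ = H.adjugate * (en K δ (δ t) * H) * H.adjugate := by rw [← Matrix.mul_adjugate]; simp only [Matrix.mul_assoc]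
      _ = _ := by rw [h1, ← Matrix.mul_assoc, Matrix.adjugate_mul]; simp
  have h3 := congrFun (congrFun (smul_right_injective _ hd h2) s) t
  by_contra h4
  simp [en, h4] at h3
  exact hst h3
theorem CJ {K1 : Type} [Field K1] [Algebra ℂ K1] {x : Pt Q T K} (hx : Gd q δ x) {x1 x2 : Pt Q T K1} (h1 : pd x ≤ pd x1) (hi : Iso δ δ x1 x2) : pd x ≤ pd x2 := by
  classical
  obtain ⟨M, N, gM, gN, MN, NM, c⟩ := hi
  obtain ⟨R, L, _, _, _, _, l, u, w, hl, hu, -, -, hsp⟩ := exists_univ (κ := Option {v : T × T // δ v.1 = δ v.2}) (pd x)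
  let z : Pt Q T R := fun ρ s t => u (ρ, s, t)
  let H : Matrix T T R := of fun s t => if h : δ s = δ t then w (some ⟨(s, t), h⟩) else 0
  let Y : Pt Q T R := fun ρ => w none • (H.adjugate * z ρ * H)
  have key : ∀ (K2 : Type) [Field K2] [Algebra ℂ K2] (y : Pt Q T K2) (P : Matrix T T K2) (c : K2), gd δ δ P → pd x ≤ pd y →
      ∃ φ : R →ₐ[ℂ] K2, H.map φ = P ∧ mp φ Y = fun ρ => c • (P.adjugate * y ρ * P) := fun K2 _ _ y P c gP hy => by
    obtain ⟨φ, h2, h3⟩ := hsp K2 (co y) (fun k => k.elim c fun v => P v.1.1 v.1.2) hy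
    have hP : H.map φ = P := by
      ext s t
      by_cases h : δ s = δ t
      · simp [H, h, h3]
      · simp only [map_apply, of_apply, H, dif_neg h, map_zero]
        by_contra h'; exact h (gP s t (Ne.symm h'))
    refine ⟨φ, hP, funext fun ρ => ?_⟩
    have h5 : H.adjugate.map φ = P.adjugate := by rw [← hP]; exact RingHom.map_adjugate φ.toRingHom H
    have h6 : (z ρ).map φ = y ρ := by ext s t; exact h2 _
    have h7 : ((H.adjugate * z ρ * H).map φ) = P.adjugate * y ρ * P := by
      rw [← h5, ← h6, ← hP]; exact (Matrix.map_mul (f := φ.toRingHom)).trans (congrArg (· * _) (Matrix.map_mul (f := φ.toRingHom)))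
    rw [← h7]; ext s t
    exact (map_mul φ _ _).trans (by rw [h3]; rfl)
  have ez : pd (mp l z) = pd x := (pd_map l hl z).trans hu
  have lz : Lam q δ (mp l z) := hx.lam.of_le ez.ge
  have lY : Lam q δ (mp l Y) := by
    have hd : (H.map l).det ≠ 0 := by
      obtain ⟨φ, h2, -⟩ := key K x 1 1 .one le_rfl
      have h3 : φ H.det = (H.map φ).det := RingHom.map_det φ.toRingHom H
      have h4 : l H.det = (H.map l).det := RingHom.map_det l.toRingHom H
      rw [h2, det_one] at h3
      rw [← h4, Ne, map_eq_zero_iff l hl]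
      rintro h5; simp [h5] at h3
    have gH : gd δ δ (H.map l) := fun s t h => by
      by_contra h'; simp [H, h'] at h
    have := lz.conj (c := l (w none)) (gd_adj gH hd) gH (mul_adjugate _)
    convert this using 1
    funext ρ
    have h5 : H.adjugate.map l = (H.map l).adjugate := RingHom.map_adjugate l.toRingHom H
    have h7 : ((H.adjugate * z ρ * H).map l) = (H.map l).adjugate * mp l z ρ * H.map l := by
      rw [← h5]; exact (Matrix.map_mul (f := l.toRingHom)).trans (congrArg (· * _) (Matrix.map_mul (f := l.toRingHom)))
    rw [← h7]; ext s t
    exact map_mul l _ _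
  have h0 : pd (mp l Y) = pd x := hx.eq lY (by
    obtain ⟨φ, h2, h3⟩ := key K x 1 1 .one le_rfl
    refine (pd_map l hl Y).trans_le ((pd_le φ Y).trans_eq ?_)
    rw [h3]; simp)
  obtain ⟨φ, h2, h3⟩ := key K1 x1 M M.det⁻¹ gM h1
  refine h0.symm.trans_le ((pd_map l hl Y).trans_le ((pd_le φ Y).trans_eq ?_))
  refine congrArg pd (h3.trans (funext fun ρ => ?_))
  have hd : M.det ≠ 0 := (isUnit_det_of_left_inverse NM).ne_zero
  rw [Matrix.mul_assoc, c, ← Matrix.mul_assoc, adjugate_mul]; simp [smul_smul, hd]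
end
end KS

namespace KS
open Matrix
set_option linter.unusedSectionVars false
variable {I Q : Type} [DecidableEq I] [Fintype Q] [DecidableEq Q] {q : Qv I Q}
lemma exists_frac (A : Type) [CommRing A] [IsDomain A] [Algebra ℂ A] : ∃ (k : Type) (_ : Field k) (_ : Algebra ℂ k) (l : A →ₐ[ℂ] k), Function.Injective l ∧
    ∀ (K : Type) [Field K] [Algebra ℂ K] (ψ : A →ₐ[ℂ] K), Function.Injective ψ → ∃ φ : k →ₐ[ℂ] K, ∀ a, φ (l a) = ψ a := by
  refine ⟨FractionRing A, inferInstance, inferInstance, IsScalarTower.toAlgHom ℂ _ _, IsFractionRing.injective _ _, fun K _ _ ψ h => ?_⟩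
  exact ⟨IsFractionRing.liftAlgHom (A := A) (K := FractionRing A) (g := ψ) h, fun a => IsFractionRing.lift_algebraMap h a⟩
lemma exists_gen {T : Type} (P : Ideal (MvPolynomial (Q × T × T) ℂ)) [P.IsPrime] : ∃ (k : Type) (_ : Field k) (_ : Algebra ℂ k) (z : Pt Q T k), pd z = P ∧
    ∀ (K : Type) [Field K] [Algebra ℂ K] (y : Pt Q T K), pd y = P → ∃ φ : k →ₐ[ℂ] K, mp φ z = y := by
  obtain ⟨k, _, _, l, hl, h⟩ := exists_frac (MvPolynomial (Q × T × T) ℂ ⧸ P)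
  refine ⟨k, _, _, mp l (gp P), (pid_eq (gpt P) l hl).trans (pid_gpt P), fun K _ _ y hy => ?_⟩
  obtain ⟨φ, hφ⟩ := h K (ev (co y) hy.ge) (ev_inj (co y) hy.symm)
  refine ⟨φ, funext fun ρ => Matrix.ext fun a b => (hφ _).trans ?_⟩
  exact congrFun (ev_gpt (co y) hy.ge) (ρ, a, b)

abbrev TT (ν : I → ℕ) := Σ i, Fin (ν i)

abbrev sf (ν : I → ℕ) : TT ν → I := Sigma.fst
variable [Fintype I]

structure BB (q : Qv I Q) : Type where
  nu : I → ℕ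
  P : Ideal (MvPolynomial (Q × TT nu × TT nu) ℂ)
  h : ∃ (K : Type) (_ : Field K) (_ : Algebra ℂ K) (z : Pt Q (TT nu) K), Gd q (sf nu) z ∧ pd z = P
lemma BB.ex (b : BB q) : ∃ (k : Type) (_ : Field k) (_ : Algebra ℂ k) (z : Pt Q (TT b.1) k), Gd q (sf b.1) z ∧ pd z = b.2 ∧
    ∀ (K : Type) [Field K] [Algebra ℂ K] (y : Pt Q (TT b.1) K), pd y = b.2 → ∃ φ : k →ₐ[ℂ] K, mp φ z = y := by
  obtain ⟨ν, P, K, _, _, z, hz, rfl⟩ := b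
  obtain ⟨k, _, _, y, hy, h⟩ := exists_gen (pd z)
  exact ⟨k, _, _, y, ⟨hz.lam.of_le hy.ge, by rw [hy, hz.td]⟩, hy, h⟩

def kb (b : BB q) : Type := b.ex.choose
noncomputable instance (b : BB q) : Field (kb b) := b.ex.choose_spec.choose
noncomputable instance (b : BB q) : Algebra ℂ (kb b) := b.ex.choose_spec.choose_spec.choose

noncomputable def zb (b : BB q) : Pt Q (TT b.1) (kb b) := b.ex.choose_spec.choose_spec.choose_spec.choose
lemma zb_gd (b : BB q) : Gd q (sf b.1) (zb b) := b.ex.choose_spec.choose_spec.choose_spec.choose_spec.1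
lemma zb_pd (b : BB q) : pd (zb b) = b.2 := b.ex.choose_spec.choose_spec.choose_spec.choose_spec.2.1
lemma zb_u (b : BB q) {K : Type} [Field K] [Algebra ℂ K] (y : Pt Q (TT b.1) K) (h : pd y = pd (zb b)) : ∃ φ : kb b →ₐ[ℂ] K, mp φ (zb b) = y :=
  b.ex.choose_spec.choose_spec.choose_spec.choose_spec.2.2 K y (h.trans (zb_pd b))
section
variable {T T' F K K' : Type} [Fintype T] [DecidableEq T] [Fintype T'] [DecidableEq T'] [Fintype F] [DecidableEq F] [Field K] [Field K'] [Algebra ℂ K] [Algebra ℂ K'] {δ : T → I} {δ' : T' → I} {i j : I} {b b' c : BB q}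
lemma ct_sf (ν : I → ℕ) (i : I) : ct (sf ν) i = ν i := by
  rw [ct, Finset.card_filter, ← Finset.univ_sigma_univ, Finset.sum_sigma]
  refine (Fintype.sum_eq_single i fun j hj => ?_).trans ?_
  · simp [hj]
  · simp
lemma exists_e {ν : I → ℕ} (h : ∀ i, ct δ i = ν i) : ∃ e : TT ν ≃ T, ∀ t, δ (e t) = t.1 := by
  let f : ∀ i, Fin (ν i) ≃ {t // δ t = i} := fun i => Fintype.equivOfCardEq (by rw [Fintype.card_fin, ← h, ct, Fintype.card_subtype])
  exact ⟨(Equiv.sigmaCongrRight f).trans (Equiv.sigmaFiberEquiv δ), fun t => (f t.1 t.2).2⟩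
lemma card_ct (h : ∀ i, ct δ i = ct δ' i) : Fintype.card T = Fintype.card T' := by
  obtain ⟨e, -⟩ := exists_e h
  obtain ⟨e', -⟩ := exists_e (δ := δ') (fun i => rfl)
  exact (Fintype.card_congr e).symm.trans (Fintype.card_congr e')

def Rp (b : BB q) (δ : T → I) (z : Pt Q T K) : Prop := ∃ φ : kb b →ₐ[ℂ] K, Iso (sf b.1) δ (mp φ (zb b)) z
lemma char0 : CharZero K := charZero_of_injective_algebraMap (algebraMap ℂ K).injective
lemma Rp.iso {z : Pt Q T K} {x : Pt Q T' K} (h : Rp b δ z) (hi : Iso δ δ' z x) : Rp b δ' x := h.imp fun _ h => h.trans hi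
lemma Rp.ct {z : Pt Q T K} (h : Rp b δ z) (j : I) : ct δ j = b.1 j := by
  have := char0 (K := K)
  obtain ⟨φ, h⟩ := h
  rw [← h.ct, ct_sf]
lemma Rp.map {z : Pt Q T K} (h : Rp b δ z) (ψ : K →ₐ[ℂ] K') : Rp b δ (mp ψ z) := by
  obtain ⟨φ, h⟩ := h
  exact ⟨ψ.comp φ, h.map ψ.toRingHom⟩
lemma Gd.map {z : Pt Q T K} (h : Gd q δ z) (ψ : K →ₐ[ℂ] K') : Gd q δ (mp ψ z) :=
  ⟨h.lam.map ψ.toRingHom, (congrArg KS.td (pd_map ψ ψ.injective z)).trans h.td⟩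
lemma Rp.lam {z : Pt Q T K} (h : Rp b δ z) : Lam q δ z := by
  obtain ⟨φ, h⟩ := h
  exact h.lam ((zb_gd b).map φ).lam
lemma Rp.zb (b : BB q) : Rp b (sf b.1) (zb b) := ⟨AlgHom.id ℂ _, Iso.refl _⟩
lemma Rp.of_pd {z : Pt Q T K} (e : T ≃ TT b.1) (he : ∀ t, (e t).1 = δ t) (h : pd z = pd (ri e (KS.zb b))) : Rp b δ z := by
  have h1 : pd (ri e.symm z) = pd (KS.zb b) := by
    have h2 := congrArg pd (ri_ri e (KS.zb b))
    exact le_antisymm ((ri_le e.symm h.le).trans_eq h2) (h2.ge.trans (ri_le e.symm h.ge))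
  obtain ⟨φ, hφ⟩ := zb_u b _ h1
  exact ⟨φ, hφ ▸ (ri_iso e.symm (fun t => by rw [← he]; simp) z).symm⟩
lemma Rp.pd {z : Pt Q (TT b.1) K} (h : Rp b (sf b.1) z) (hz : Gd q (sf b.1) z) : pd z = KS.pd (KS.zb b) := by
  obtain ⟨φ, hi⟩ := h
  have h0 : KS.pd (mp φ (KS.zb b)) = KS.pd (KS.zb b) := pd_map φ φ.injective _
  exact le_antisymm ((CJ hz le_rfl hi.symm).trans_eq h0) (CJ (zb_gd b) h0.ge hi)
lemma Rp.uniq {z : Pt Q T K} (h : Rp b δ z) (h' : Rp b' δ z) : b = b' := by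
  have hb : b.1 = b'.1 := funext fun j => (h.ct j).symm.trans (h'.ct j)
  have e : KS.pd (KS.zb b) = b.2 := zb_pd b
  have e' : KS.pd (KS.zb b') = b'.2 := zb_pd b'
  have g := zb_gd b
  have g' := zb_gd b'
  obtain ⟨φ, h⟩ := h
  obtain ⟨φ', h'⟩ := h'
  obtain ⟨ν, P, p⟩ := b
  obtain ⟨ν', P', p'⟩ := b'
  dsimp at hb; subst hb
  have h0 := pd_map φ φ.toRingHom.injective (KS.zb ⟨ν, P, p⟩)
  have h0' := pd_map φ' φ'.toRingHom.injective (KS.zb ⟨ν, P', p'⟩)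
  have := le_antisymm ((CJ g h0.ge (h.trans h'.symm)).trans_eq h0') ((CJ g' h0'.ge (h'.trans h.symm)).trans_eq h0)
  obtain rfl := e.symm.trans (this.trans e')
  rfl
lemma Gd.rp {z : Pt Q T K} (hz : Gd q δ z) : ∃ b : BB q, Rp b δ z := by
  obtain ⟨e, he⟩ := exists_e (δ := δ) (fun i => rfl)
  let b : BB q := ⟨KS.ct δ, KS.pd (KS.ri e z), K, _, _, _, hz.ri e he, rfl⟩
  refine ⟨b, Rp.of_pd e.symm (fun t => by rw [← he]; simp) ?_⟩
  have h2 : KS.pd (zb b) = KS.pd (KS.ri e z) := zb_pd b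
  have h3 := congrArg KS.pd (ri_ri e z)
  exact le_antisymm (h3.ge.trans (ri_le e.symm h2.ge)) ((ri_le e.symm h2.le).trans_eq h3)
lemma em_ex (b : BB q) (i : I) : ∃ (b' : BB q) (T' : Type) (_ : Fintype T') (_ : DecidableEq T') (δ' : T' → I) (x : Pt Q T' (kb b)), Sub (sf b.1) δ' i (zb b) x ∧ Rp b' δ' x := by
  obtain ⟨T', F, _, _, _, _, δ', e, x, W, g, he, hY, hs, hxy⟩ := exists_yy (zb_gd b).lam i
  obtain ⟨J, L, h⟩ := yy_sub x W hY.gg hs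
  have hg := (zb_gd b).ri e he
  rw [show ri e (zb b) = yy x W g from hxy] at hg
  obtain ⟨b', hb⟩ := (hg.yy hY hs).rp
  rw [← hxy] at h
  exact ⟨b', T', _, _, δ', x, h.isoz (ri_iso e he _).symm, hb⟩

noncomputable def em (i : I) (b : BB q) : BB q := (em_ex b i).choose
lemma Rp.em {z : Pt Q T K} (h : Rp b δ z) {x : Pt Q T' K} (hx : Sub δ δ' i z x) : Rp (em i b) δ' x := by
  obtain ⟨T₁, _, _, δ₁, x₁, ⟨J, L, h1⟩, h2⟩ := (em_ex b i).choose_spec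
  obtain ⟨φ, h⟩ := h
  obtain ⟨J, L, h3⟩ := (h1.map φ.toRingHom).isoz h
  obtain ⟨J', L', hx⟩ := hx
  exact (h2.map φ).iso (h3.uniq hx)
lemma Rp.ex {z : Pt Q T K} (h : Rp b δ z) (i : I) : ∃ (T' : Type) (_ : Fintype T') (_ : DecidableEq T') (δ' : T' → I) (x : Pt Q T' K), Sub δ δ' i z x ∧ Rp (KS.em i b) δ' x := by
  obtain ⟨T₁, _, _, δ₁, x₁, ⟨J, L, h1⟩, h2⟩ := (em_ex b i).choose_spec
  have h0 := h
  obtain ⟨φ, h⟩ := h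
  have h3 := (h1.map φ.toRingHom).isoz h
  exact ⟨T₁, _, _, δ₁, _, h3, h0.em h3⟩

noncomputable def ep (i : I) (b : BB q) : ℕ := b.1 i - (em i b).1 i
lemma Rp.rk {z : Pt Q T K} (h : Rp b δ z) (i : I) : b.1 i = ep i b + rk δ i z ∧ rk δ i z = (KS.em i b).1 i := by
  obtain ⟨T₁, _, _, δ₁, x, hs, h2⟩ := h.ex i
  have := char0 (K := K)
  have h4 := hs.rk_add i
  have h5 := rk_le (δ := δ) (i := i) z
  rw [if_pos rfl, h.ct, h2.ct] at h4
  rw [h.ct] at h5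
  rw [ep]; omega
lemma em_wt (i : I) (b : BB q) (j : I) : b.1 j = (em i b).1 j + if j = i then ep i b else 0 := by
  obtain ⟨T₁, _, _, δ₁, x, hs, h2⟩ := (Rp.zb b).ex i
  have := char0 (K := kb b)
  have h4 := hs.rk_add j
  have h5 := (Rp.zb b).rk i
  rw [(Rp.zb b).ct, (Rp.zb b).ct, h2.ct] at h4
  rw [h4]; congr 2; omega
lemma Rp.sur {z : Pt Q T K} (h : Rp b δ z) (h0 : ep i b = 0) : Sur δ i z := by
  obtain ⟨T₁, _, _, δ₁, x, ⟨J, L, hs⟩, h2⟩ := h.ex i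
  refine hs.sur (card_ct (δ := δ₁) (δ' := δ) fun j => ?_)
  rw [h2.ct, h.ct]; have := em_wt i b j; simp only [h0, ite_self] at this; exact this.symm
lemma Rp.sur' {z : Pt Q T K} (h : Rp b δ z) (h0 : Sur δ i z) : KS.em i b = b := (h.em h0.sub).uniq h
lemma em_eq (h0 : ep i b = 0) : em i b = b := (Rp.zb b).sur' ((Rp.zb b).sur h0)
lemma ep_em : ep i (em i b) = 0 := by
  obtain ⟨T₁, _, _, δ₁, x, ⟨J, L, hs⟩, h2⟩ := (Rp.zb b).ex i
  have := h2.sur' hs.s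
  rw [ep, this, Nat.sub_self]

noncomputable def sr (b : BB q) : BB q := (zb_gd b).st.rp.choose
lemma Iso.st {x : Pt Q T K} {x' : Pt Q T' K} (h : Iso δ δ' x x') : Iso δ δ' (st q x) (st q x') := by
  obtain ⟨M, N, hM, hN, h1, h2, c⟩ := h
  refine ⟨Nᵀ, Mᵀ, hN.tr, hM.tr, by rw [← transpose_mul, h1, transpose_one], by rw [← transpose_mul, h2, transpose_one], fun ρ => ?_⟩
  have : N * x (q.bar ρ) = x' (q.bar ρ) * N := by
    calc _ = N * (x (q.bar ρ) * M) * N := by rw [Matrix.mul_assoc, Matrix.mul_assoc, h1, Matrix.mul_one]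
      _ = _ := by rw [c, ← Matrix.mul_assoc, h2, Matrix.one_mul]
  rw [KS.st, KS.st, ← transpose_mul, ← transpose_mul, this]
lemma Rp.st {z : Pt Q T K} (h : Rp b δ z) : Rp (sr b) δ (st q z) := by
  obtain ⟨φ, h⟩ := h
  exact ((zb_gd b).st.rp.choose_spec.map φ).iso h.st
lemma sr_wt (b : BB q) : (sr b).1 = b.1 := funext fun j => ((Rp.zb b).st.ct j).symm.trans ((Rp.zb b).ct j)

noncomputable def ems (i : I) (b : BB q) : BB q := sr (em i (sr b))
lemma Rp.ex' {z : Pt Q T K} (h : Rp b δ z) (i : I) : ∃ (T' : Type) (_ : Fintype T') (_ : DecidableEq T') (δ' : T' → I) (x : Pt Q T' K), Sub δ δ' i (KS.st q z) (KS.st q x) ∧ Rp (KS.ems i b) δ' x := by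
  obtain ⟨T₁, _, _, δ₁, x, hs, h2⟩ := h.st.ex i
  exact ⟨T₁, _, _, δ₁, KS.st q x, (st_st q x).symm ▸ hs, h2.st⟩
lemma em_comm : em i (ems j b) = ems j (em i b) := by
  obtain ⟨T₁, _, _, δ₁, x₁, h1, r1⟩ := (Rp.zb b).ex i
  obtain ⟨T₂, _, _, δ₂, x₂, h2, r2⟩ := (Rp.zb b).ex' j
  obtain ⟨T₃, _, _, δ₃, x₃, h3, r3⟩ := r1.ex' j
  exact (r2.em (commute h1 h2 h3)).uniq r3
end
end KS

namespace KS
open Matrix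
set_option linter.unusedSectionVars false
variable {I Q : Type} [DecidableEq I] [Fintype Q] [DecidableEq Q] {q : Qv I Q} [Fintype I] {i j : I} {b b' c : BB q}
lemma yy_ri {T T' F F' K : Type} [Fintype T] [DecidableEq T] [Fintype T'] [DecidableEq T'] [Fintype F] [DecidableEq F] [Fintype F'] [DecidableEq F'] [Field K] [Algebra ℂ K]
    {δ : T → I} {δ' : T' → I} (e : T' ≃ T) (f : F' ≃ F) (he : ∀ t, δ (e t) = δ' t) {x : Pt Q T K} {W : Q → Matrix T F K} {g : Matrix F T K} (h : YD q δ i x W g) :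
    YD q δ' i (ri e x) (fun ρ => (W ρ).submatrix e f) (g.submatrix f e) ∧ ri (Equiv.sumCongr e f) (yy x W g) = yy (ri e x) (fun ρ => (W ρ).submatrix e f) (g.submatrix f e) := by
  refine ⟨⟨(ri_iso e he x).lam h.lam, fun ρ t f' h1 => he t ▸ h.gW _ _ _ h1, fun f' t h1 => he t ▸ h.gg _ _ h1, ?_⟩, funext fun ρ => ?_⟩
  · have := congrArg (fun M => M.submatrix e f) h.mo
    ext a b
    have h2 := congrFun (congrFun this a) b
    simp only [submatrix_apply, Matrix.sum_apply, Matrix.zero_apply] at h2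
    simp only [Matrix.sum_apply, Matrix.zero_apply, ← h2, ri, submatrix_mul_equiv]
    rfl
  · rw [yy_eq, ri, yy_eq, ri]
    have h1 : (W ρ).submatrix e f * g.submatrix f e = (W ρ * g).submatrix e e := submatrix_mul_equiv _ _ _ _ _
    have h2 : (x ρ).submatrix e e - (W ρ * g).submatrix e e = (x ρ - W ρ * g).submatrix e e := rfl
    rw [h1, h2, submatrix_mul_equiv, submatrix_mul_equiv]
    ext (a | a) (b | b) <;> rfl
theorem YU (h0 : ep i c = 0) (p : ℕ) : ∃ (L : Type) (_ : Field L) (_ : Algebra ℂ L) (x0 : Pt Q (TT c.1) L) (W : Q → Matrix (TT c.1) (Fin p) L) (g : Matrix (Fin p) (TT c.1) L),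
    YD q (sf c.1) i x0 W g ∧ Sur (sf c.1) i x0 ∧ Rp c (sf c.1) x0 ∧ Gd q (dd (Fin p) (sf c.1) i) (yy x0 W g) ∧
    (∀ (W2 : Q → Matrix (TT c.1) (Fin p) L) (g2 : Matrix (Fin p) (TT c.1) L), YD q (sf c.1) i x0 W2 g2 → pd (yy x0 W g) ≤ pd (yy x0 W2 g2)) ∧
    ∀ b : BB q, em i b = c → ep i b = p → Rp b (dd (Fin p) (sf c.1) i) (yy x0 W g) := by
  have hc := zb_gd c
  obtain ⟨L, _, _, x0, W, g, hY, hs, h0, htd, hsp⟩ := gen (Fin p) hc.lam hc.lam ((Rp.zb c).sur h0) le_rfl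
  have hG : Gd q (dd (Fin p) (sf c.1) i) (yy x0 W g) := ⟨hY.yy, by rw [htd, hc.td, ← Nat.cast_add, ← dm_dd]⟩
  refine ⟨L, _, _, x0, W, g, hY, hs, ?_, hG, fun W2 g2 h => hsp L x0 W2 g2 h h0.ge h0.le, ?_⟩
  · obtain ⟨φ, h⟩ := zb_u c x0 h0
    exact ⟨φ, h ▸ .refl _⟩
  rintro b rfl hp
  obtain ⟨T', F, _, _, _, _, δ', e, x, V, v, he, hY', hs', hxy⟩ := exists_yy (zb_gd b).lam i
  have hxy : ri e (zb b) = yy x V v := hxy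
  have hg := (zb_gd b).ri e he
  rw [hxy] at hg
  have hx := hg.yy hY' hs'
  obtain ⟨J, M, hS⟩ := yy_sub x V hY'.gg hs'
  rw [← hxy] at hS
  have hR := (Rp.zb b).em (hS.isoz (ri_iso e he _).symm)
  obtain ⟨e1, he1⟩ := exists_e hR.ct
  have hF : Fintype.card F = p := by
    have h1 := ct_equiv e he i
    have h2 := em_wt i b i
    rw [ct_dd, if_pos rfl, hR.ct, ct_sf] at h1
    rw [if_pos rfl] at h2
    omega
  obtain ⟨h1, h2⟩ := yy_ri e1 (Fintype.equivFinOfCardEq hF).symm he1 hY'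
  have h3 := (hR.iso (ri_iso e1 he1 x)).pd (hx.ri e1 he1)
  have h4 := hsp _ _ _ _ h1 h3.ge h3.le
  rw [← h2, ← hxy] at h4
  generalize (Fintype.equivFinOfCardEq hF).symm = f at *
  have he2 : ∀ t, (((e1.sumCongr f).trans e) t).1 = dd (Fin p) (sf (em i b).1) i t := fun t => by
    rw [Equiv.trans_apply]
    refine (he _).trans ?_
    rcases t with t | t <;> simp [he1]
  exact Rp.of_pd _ he2 (((zb_gd b).ri _ he2).eq hG.lam h4)
lemma em_inj (h : em i b = em i b') (h' : ep i b = ep i b') : b = b' := by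
  obtain ⟨L, _, _, x0, W, g, -, -, -, -, -, h1⟩ := YU (ep_em (b := b) (i := i)) (ep i b)
  exact (h1 b rfl rfl).uniq (h1 b' h.symm h'.symm)
lemma em_surj (h : ep i c = 0) (p : ℕ) : ∃ b, em i b = c ∧ ep i b = p := by
  obtain ⟨L, _, _, x0, W, g, hY, hs, hR, hG, -, -⟩ := YU h p
  obtain ⟨b, hb⟩ := hG.rp
  have h1 := (hb.em (yy_sub x0 W hY.gg hs)).uniq hR
  refine ⟨b, h1, ?_⟩
  have h2 := hb.ct i
  have h3 := em_wt i b i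
  rw [ct_dd, if_pos rfl, ct_sf, Fintype.card_fin] at h2
  rw [if_pos rfl, h1] at h3
  omega
lemma top (h : b.1 ≠ 0) : ∃ i, 0 < ep i b := by
  obtain ⟨i, hi⟩ := Function.ne_iff.1 h
  have : Nonempty (TT b.1) := ⟨⟨i, 0, Nat.pos_of_ne_zero hi⟩⟩
  obtain ⟨i, hi⟩ := not_sur (zb_gd b).lam
  exact ⟨i, Nat.pos_of_ne_zero fun h0 => hi ((Rp.zb b).sur h0)⟩
lemma one_ex : ∃ b : BB q, b.1 = 0 := by
  have : IsEmpty (TT (0 : I → ℕ)) := ⟨fun t => t.2.elim0⟩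
  have h : Lam q (sf (0 : I → ℕ)) (0 : Pt Q _ ℂ) := ⟨fun _ s => isEmptyElim s, Subsingleton.elim _ _, 0, fun _ _ => Subsingleton.elim _ _⟩
  obtain ⟨K, _, _, y, hy, -⟩ := claim _ rfl h
  exact ⟨⟨0, _, K, _, _, y, hy, rfl⟩, rfl⟩
lemma uniq0 (h : b.1 = 0) (h' : b'.1 = 0) : b = b' := by
  have key : ∀ b : BB q, b.1 = 0 → b.2 = ⊥ := fun b h => by
    have : IsEmpty (TT b.1) := ⟨fun t => by have := t.2.2; simp [h] at this⟩
    rw [← zb_pd, eq_bot_iff]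
    intro p hp
    rw [mem_pid, MvPolynomial.eq_C_of_isEmpty p, MvPolynomial.aeval_C] at hp
    rw [Ideal.mem_bot, MvPolynomial.eq_C_of_isEmpty p, (map_eq_zero _).1 hp, map_zero]
  have h1 := key b h
  have h2 := key b' h'
  obtain ⟨ν, P, p⟩ := b
  obtain ⟨ν', P', p'⟩ := b'
  dsimp at h h' h1 h2
  subst h h'
  obtain rfl := h1.trans h2.symm; rfl
lemma finB (n : ℕ) : ∀ ν : I → ℕ, ∑ i, ν i = n → {b : BB q | b.1 = ν}.Finite := by
  induction n using Nat.strong_induction_on with | _ n ih => ?_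
  intro ν hν
  have hs : {b : BB q | b.1 = ν} ⊆ {b : BB q | b.1 = 0} ∪ ⋃ i, {b : BB q | b.1 = ν ∧ 0 < ep i b} := fun b hb => by
    by_cases h : b.1 = 0
    · exact .inl h
    · obtain ⟨i, hi⟩ := top h
      exact .inr (Set.mem_iUnion.2 ⟨i, hb, hi⟩)
  refine ((Set.Subsingleton.finite fun b h b' h' => uniq0 h h').union (Set.finite_iUnion fun i => ?_)).subset hs
  have h1 : (⋃ p ∈ Finset.Icc 1 (ν i), {x : ℕ × BB q | x.1 = p ∧ x.2.1 = fun j => ν j - if j = i then p else 0}).Finite := by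
    refine Set.Finite.biUnion (Finset.finite_toSet _) fun p hp => ?_
    rw [Finset.coe_Icc, Set.mem_Icc] at hp
    refine Set.Finite.subset ((Set.finite_singleton p).prod (ih (∑ j, (ν j - if j = i then p else 0)) ?_ _ rfl)) fun x hx => hx
    rw [← hν]
    refine Finset.sum_lt_sum (fun j _ => Nat.sub_le _ _) ⟨i, Finset.mem_univ _, ?_⟩
    rw [if_pos rfl]; omega
  refine Set.Finite.of_finite_image (f := fun b => (ep i b, em i b)) (h1.subset ?_) fun b _ b' _ h => em_inj (Prod.ext_iff.1 h).2 (Prod.ext_iff.1 h).1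
  rintro _ ⟨b, ⟨rfl, hb⟩, rfl⟩
  simp only [Set.mem_iUnion]
  have := em_wt i b
  refine ⟨ep i b, ?_, rfl, funext fun j => ?_⟩
  · have := this i; rw [if_pos rfl] at this; rw [Finset.mem_Icc]; omega
  · have := this j; dsimp only; omega
end KS

namespace KS
open Matrix
set_option linter.unusedSectionVars false
variable {I Q : Type} [DecidableEq I] [Fintype Q] [DecidableEq Q] {q : Qv I Q}
lemma lin_ex {K E : Type} [Field K] [AddCommGroup E] [Module K E] [FiniteDimensional K E] (S V : Submodule K E) (p : ℕ) :
    ∃ w : Fin p → E, (∀ f, w f ∈ V) ∧ min (Module.finrank K S + p) (Module.finrank K V) ≤ Module.finrank K ↥(S ⊔ Submodule.span K (Set.range w)) := by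
  induction p with
  | zero => exact ⟨Fin.elim0, fun f => f.elim0, (min_le_left _ _).trans (Submodule.finrank_mono le_sup_left)⟩
  | succ p ih =>
    obtain ⟨w, hw, h⟩ := ih
    by_cases hV : V ≤ S ⊔ Submodule.span K (Set.range w)
    · refine ⟨Fin.cons 0 w, Fin.cases V.zero_mem hw, (min_le_right _ _).trans ((Submodule.finrank_mono hV).trans (Submodule.finrank_mono ?_))⟩
      rw [Fin.range_cons]
      exact sup_le_sup_left (Submodule.span_mono (Set.subset_insert _ _)) _
    · obtain ⟨v, hv, hv'⟩ := SetLike.not_le_iff_exists.1 hV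
      refine ⟨Fin.cons v w, Fin.cases hv hw, ?_⟩
      have : S ⊔ Submodule.span K (Set.range w) < S ⊔ Submodule.span K (Set.range (Fin.cons v w : Fin (p + 1) → E)) := by
        rw [Fin.range_cons]
        refine lt_of_le_of_ne (sup_le_sup_left (Submodule.span_mono (Set.subset_insert _ _)) _) fun he => hv' ?_
        rw [he]
        exact Submodule.mem_sup_right (Submodule.subset_span (Set.mem_insert _ _))
      have := Submodule.finrank_lt_finrank_of_lt this
      omega
section
variable {T T' F K : Type} [Fintype T] [DecidableEq T] [Fintype T'] [DecidableEq T'] [Fintype F] [DecidableEq F] [Field K] {δ : T → I} {i : I}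
lemma rk_semi {K' : Type} [Field K'] [Algebra ℂ K] [Algebra ℂ K'] {z : Pt Q T K} {z' : Pt Q T K'} (h : pd z ≤ pd z') : rk δ i z' ≤ rk δ i z := by
  have key : ∀ {R R' : Type} [CommRing R] [CommRing R'] (φ : R →+* R') (x : Pt Q T R), en R' δ i * hs (mp φ x) = (en R δ i * hs x).map φ := fun φ x => by
    rw [Matrix.map_mul, en_map]; rfl
  have k2 : ∀ {R : Type} [CommRing R] (w : Pt Q T R) (φ : R →+* K') (ψ : R →+* K), Function.Injective ψ → rk δ i (mp φ w) ≤ rk δ i (mp ψ w) := fun w φ ψ h => by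
    rw [rk, rk, key, key]; exact rank_semi _ _ _ h
  exact (congrArg (rk δ i) (mp_gp z' h)).symm.trans_le ((k2 (gp (pd z)) (ev (co z') h).toRingHom (ev (co z) le_rfl).toRingHom (ev_inj (co z) rfl)).trans_eq (congrArg (rk δ i) (mp_gp z le_rfl)))
lemma rank_vs_mul (A : Matrix T' T K) (Z : Q → Matrix T F K) : (vs fun ρ => A * Z ρ).rank ≤ (vs Z).rank := by
  have : (vs fun ρ => A * Z ρ) = kroneckerMap (· * ·) (1 : Matrix Q Q K) A * vs Z := by
    ext ⟨ρ, s⟩ t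
    simp only [vs, of_apply, mul_apply, kroneckerMap_apply, Fintype.sum_prod_type, one_apply, ite_mul, one_mul, zero_mul]
    simp
  rw [this]; exact rank_mul_le_right _ _
lemma rank_Wto (W : Q → Matrix T F K) (h : ∀ ρ t f, W ρ t f ≠ 0 → δ t = q.tgt ρ ∧ i = q.src ρ) : (vs fun ρ => W (q.bar ρ)).rank = (Wto q δ i W).rank := by
  let D : Matrix (Q × T) (Ci q δ i) K := of fun c c' => if c = c'.1 then q.sg c.1 • 1 else 0
  have e1 : Wto q δ i W = Dᵀ * vs fun ρ => W (q.bar ρ) := by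
    ext c f
    simp only [D, Wto, vs, mul_apply, of_apply, transpose_apply, ite_mul, zero_mul, Finset.sum_ite_eq', Finset.mem_univ, if_true, smul_one_mul]
  have e2 : (vs fun ρ => W (q.bar ρ)) = D * Wto q δ i W := by
    ext c f
    simp only [D, Wto, vs, mul_apply, of_apply, ite_mul, zero_mul]
    by_cases hc : q.tgt c.1 = i ∧ δ c.2 = q.src c.1
    · rw [Finset.sum_eq_single ⟨c, hc⟩ (fun c' _ hne => if_neg fun h => hne (Subtype.ext h.symm)) (by simp), if_pos rfl, smul_one_mul, sg_sg]
    · rw [Finset.sum_eq_zero fun c' _ => if_neg fun h2 : c = c'.1 => hc (h2 ▸ c'.2)]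
      by_contra h0
      obtain ⟨h1, h2⟩ := h _ _ _ h0
      exact hc ⟨by rw [h2, q.sb], by rw [h1, q.tb]⟩
  apply le_antisymm
  · rw [e2]; exact rank_mul_le_right _ _
  · rw [e1]; exact rank_mul_le_right _ _
lemma rk_st (x : Pt Q T K) : rk δ i (st q x) = (vs fun ρ => x (q.bar ρ) * en K δ i).rank := by
  rw [rk, ← rank_transpose, transpose_mul, en_tr]
  congr 1
lemma gr_en {x : Pt Q T K} (hx : Lam q δ x) (ρ t f) (h : (x ρ * en K δ i) t f ≠ 0) : δ t = q.tgt ρ ∧ i = q.src ρ := by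
  rw [en, mul_diagonal] at h
  by_cases h1 : δ f = i
  · have := hx.gr ρ t f (left_ne_zero_of_mul h)
    exact ⟨this.1, h1 ▸ this.2⟩
  · simp [h1] at h

abbrev XX (q : Qv I Q) (δ : T → I) (i : I) (x : Pt Q T K) : Matrix (Ci q δ i) T K := Wto q δ i fun ρ => x ρ * en K δ i
lemma rk_x {x : Pt Q T K} (hx : Lam q δ x) : rk δ i (st q x) = (XX q δ i x).rank := by
  rw [rk_st, rank_Wto (fun ρ => x ρ * en K δ i) (gr_en hx)]
lemma rk_yy {x : Pt Q T K} {W : Q → Matrix T F K} {g : Matrix F T K} (h : YD q δ i x W g) :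
    rk (dd F δ i) i (st q (yy x W g)) = (fromCols (XX q δ i x) (Wto q δ i W)).rank := by
  have e0 : fromCols (XX q δ i x) (Wto q δ i W) = Wto q δ i fun ρ => (fromCols (x ρ * en K δ i) (W ρ) : Matrix T (T ⊕ F) K) := by
    ext c (f | f) <;> rfl
  rw [e0, ← rank_Wto _ (by rintro ρ t (f | f) h1; exacts [gr_en h.lam ρ t f h1, h.gW _ _ _ h1]), rk_st]
  have eg : g * en K δ i = g := mul_en h.gg
  have ee : en K (dd F δ i) i = fromBlocks (en K δ i) 0 0 1 := by
    ext (a | a) (b | b) <;> simp [en, diagonal_apply, one_apply]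
    congr
  let B (g : Matrix F T K) : Matrix (T ⊕ F) (T ⊕ F) K := fromBlocks 1 0 g 1
  have eM : ∀ ρ, MM x W g ρ * en K (dd F δ i) i = (fromCols (x ρ * en K δ i) (W ρ) : Matrix T (T ⊕ F) K) * B (-g) := fun ρ => by
    simp only [B]
    rw [ee, MM, fromCols_mul_fromBlocks, fromCols_mul_fromBlocks]
    rw [Matrix.sub_mul, Matrix.mul_assoc, eg]; simp [sub_eq_add_neg]
  have eB : B (-g) * B g = 1 := by
    simp only [B, fromBlocks_multiply]; simp
  have vm : ∀ (Z : Q → Matrix T (T ⊕ F) K) (B : Matrix (T ⊕ F) (T ⊕ F) K), (vs fun ρ => Z ρ * B) = vs Z * B := fun Z B => by ext; rfl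
  have e1 : (vs fun ρ => yy x W g (q.bar ρ) * en K (dd F δ i) i).rank = (vs fun ρ => MM x W g (q.bar ρ) * en K (dd F δ i) i).rank := by
    apply le_antisymm
    · simp only [yy, Matrix.mul_assoc (JJ g)]; exact rank_vs_mul _ _
    · have := rank_vs_mul (LL F T K) (fun ρ => yy x W g (q.bar ρ) * en K (dd F δ i) i)
      simp only [yy, ← Matrix.mul_assoc, LJ, Matrix.one_mul] at this
      simpa only [yy, ← Matrix.mul_assoc] using this
  rw [e1]
  simp only [eM]
  rw [vm]
  apply le_antisymm (rank_mul_le_left _ _)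
  refine le_trans (le_of_eq ?_) (rank_mul_le_left _ (B g))
  rw [Matrix.mul_assoc, eB, Matrix.mul_one]
lemma AA_rank {x : Pt Q T K} (hx : Lam q δ x) (hs : Sur δ i x) : (AA q δ i x).rank = ct δ i := by
  have hc : Fintype.card (mi δ i) = ct δ i := by rw [Fintype.card_subtype, ct]
  obtain ⟨s, h⟩ := AA_minor hx hs
  rw [← hc]
  refine le_antisymm (rank_le_card_height _) ?_
  rw [← rank_of_isUnit _ ((isUnit_iff_isUnit_det _).2 h.isUnit)]
  exact rank_submatrix_le _ _ _
lemma AA_XX {x : Pt Q T K} (hx : Lam q δ x) : AA q δ i x * XX q δ i x = 0 := by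
  refine (mo_iff hx _ (gr_en hx)).1 ?_
  have := congrArg (· * en K δ i) hx.mo
  simpa only [Matrix.sum_mul, Matrix.smul_mul, Matrix.mul_assoc, Matrix.zero_mul] using this
lemma rank_fc {m : Type} [Fintype m] (X : Matrix m T K) (U : Matrix m F K) : (fromCols X U).rank = Module.finrank K ↥(Submodule.span K (Set.range X.col) ⊔ Submodule.span K (Set.range U.col)) := by
  rw [rank_eq_finrank_span_cols, ← Submodule.span_union]
  have h4 : Set.range (fromCols X U).col = Set.range X.col ∪ Set.range U.col := by
    rw [Set.range_eq_iUnion, Set.range_eq_iUnion, Set.range_eq_iUnion, Set.iUnion_sum]; rfl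
  rw [h4]
lemma rk_up {x : Pt Q T K} {W : Q → Matrix T F K} {g : Matrix F T K} (h : YD q δ i x W g) (hs : Sur δ i x) :
    rk (dd F δ i) i (st q (yy x W g)) ≤ rk δ i (st q x) + Fintype.card F ∧
    ct δ i + rk (dd F δ i) i (st q (yy x W g)) ≤ Fintype.card (Ci q δ i) := by
  rw [rk_yy h, rk_x h.lam]
  constructor
  · rw [rank_fc]
    refine (Submodule.finrank_add_le_finrank_add_finrank _ _).trans ?_
    rw [← rank_eq_finrank_span_cols, ← rank_eq_finrank_span_cols]
    exact Nat.add_le_add_left (rank_le_card_width _) _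
  · rw [← AA_rank h.lam hs]
    refine rank_add_rank_le_card_of_mul_eq_zero ?_
    rw [mul_fromCols, AA_XX h.lam, (mo_iff h.lam _ h.gW).1 h.mo]
    ext a (b | b) <;> simp
lemma rk_low {x : Pt Q T K} (hx : Lam q δ x) (hs : Sur δ i x) (p : ℕ) : ∃ W : Q → Matrix T (Fin p) K, YD q δ i x W 0 ∧
    min (rk δ i (st q x) + p) (Fintype.card (Ci q δ i) - ct δ i) ≤ rk (dd (Fin p) δ i) i (st q (yy x W 0)) := by
  obtain ⟨w, hw, h⟩ := lin_ex (Submodule.span K (Set.range (XX q δ i x).col)) (LinearMap.ker (AA q δ i x).mulVecLin) p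
  have h1 : AA q δ i x * (of fun c f => w f c : Matrix (Ci q δ i) (Fin p) K) = 0 := by
    ext r f; exact congrFun (hw f) r
  have hY : YD q δ i x (Wof (of fun c f => w f c : Matrix (Ci q δ i) (Fin p) K)) (0 : Matrix (Fin p) T K) := ⟨hx, Wof_gr _, by simp, (mo_iff hx _ (Wof_gr _)).2 (by rw [Wto_of, h1])⟩
  refine ⟨_, hY, ?_⟩
  rw [rk_yy hY, rk_x hx, Wto_of]
  have h2 := (AA q δ i x).mulVecLin.finrank_range_add_finrank_ker
  rw [Module.finrank_fintype_fun_eq_card] at h2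
  have h3 := AA_rank hx hs
  rw [Matrix.rank] at h3
  rw [← rank_eq_finrank_span_cols] at h
  rw [rank_fc]
  change min _ (_ - _) ≤ Module.finrank K ↥(_ ⊔ Submodule.span K (Set.range w))
  omega
end
variable [Fintype I] {i j : I} {b b' c : BB q}
lemma mx (b : BB q) (i : I) : (ep i (sr b) : ℤ) = max (ep i (sr (em i b)) : ℤ) (ep i b + (2 * (em i b).1 i - ∑ ρ, if q.tgt ρ = i then ((em i b).1 (q.src ρ) : ℤ) else 0)) := by
  obtain ⟨L, _, _, x0, W, g, hY, hs, hR, hG, hsp, h1⟩ := YU (ep_em (b := b) (i := i)) (ep i b)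
  have h1 := ((h1 b rfl rfl).st.rk i).1
  have h2 := (hR.st.rk i).1
  obtain ⟨u1, u2⟩ := rk_up hY hs
  obtain ⟨W', hY', l⟩ := rk_low hY.lam hs (ep i b)
  have l2 := rk_semi (δ := dd (Fin (ep i b)) (sf (em i b).1) i) (i := i) (st_le (q := q) (hsp _ _ hY'))
  have w := em_wt i b i
  rw [if_pos rfl] at w
  rw [sr_wt] at h1 h2
  rw [Fintype.card_fin] at u1
  rw [ct_sf] at u2 l
  have hN := card_Ci (q := q) (δ := sf (em i b).1) (i := i)
  simp only [ct_sf] at hN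
  have : (∑ ρ, if q.tgt ρ = i then ((em i b).1 (q.src ρ) : ℤ) else 0) = (Fintype.card (Ci q (sf (em i b).1) i) : ℤ) := by
    rw [hN]; push_cast; rfl
  rw [this]
  omega
lemma mkC (C : I → I → ℤ) (hC : ∀ i β, pr C i β = 2 * β i - ∑ ρ, if q.tgt ρ = i then β (q.src ρ) else 0) :
    ∃ K : Crys C, ∀ ν : I → ℕ, K.cnt Set.univ (fun i => (ν i : ℤ)) = {b : BB q | b.1 = ν}.ncard := by
  have hw : ∀ b : BB q, ∀ ν : I → ℕ, (fun i => (b.1 i : ℤ)) = (fun i => (ν i : ℤ)) ↔ b.1 = ν := fun b ν =>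
    ⟨fun h => funext fun i => by exact_mod_cast congrFun h i, fun h => by rw [h]⟩
  obtain ⟨o, ho⟩ := one_ex (q := q)
  have we : ∀ i (b : BB q), (fun j => ((em i b).1 j : ℤ)) + (ep i b : ℤ) • al i = fun j => (b.1 j : ℤ) := fun i b => funext fun j => by
    rw [em_wt i b j]; simp [al, Pi.single_apply]
  refine ⟨{
    B := BB q, wt := fun b i => b.1 i, ep := ep, es := fun i b => ep i (sr b), em := em, ems := ems, fin := fun ν => ?_, nonneg := fun b i => (by simp), wt_em := we,
    wt_ems := fun i b => ?_, em_eq := fun i b => em_eq, ep_em := fun i b => ep_em, inj := fun i b b' => em_inj, surj := fun i b h => em_surj h, comm := fun i j b => em_comm,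
    mx := fun i b => ?_, top := fun b h => top fun h0 => h (by rw [h0]; rfl), one := o, wt_one := (by rw [ho]; rfl), uniq := fun b h => uniq0 ((hw b 0).1 h) ho }, fun ν => ?_⟩
  · refine (finB _ (fun i => (ν i).toNat) rfl).subset fun b hb => funext fun i => ?_
    rw [← congrFun hb i]; simp
  · have := we i (sr b)
    simp only [sr_wt] at this
    simp only [ems, sr_wt]
    exact this
  · rw [hC]; exact mx b i
  · simp only [Crys.cnt, Set.mem_univ, true_and]
    simp only [hw]
end KS

namespace KS
open Matrix MvPolynomial
set_option linter.unusedSectionVars false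
lemma topo {X σ : Type} [TopologicalSpace X] [Finite σ] (u : X → σ → ℂ) (hO : ∀ p : MvPolynomial σ ℂ, IsOpen {x | aeval (u x) p ≠ 0})
    (hB : ∀ U : Set X, IsOpen U → ∀ x ∈ U, ∃ p : MvPolynomial σ ℂ, aeval (u x) p ≠ 0 ∧ ∀ y, aeval (u y) p ≠ 0 → y ∈ U)
    (S : Set (Ideal (MvPolynomial σ ℂ))) (hf : S.Finite) (hp : ∀ P ∈ S, P.IsPrime) (hr : ∀ P ∈ S, ∀ f, P ≤ pid f → ∃ x, u x = f)
    (hc : ∀ x, ∃ P ∈ S, P ≤ pid (u x)) (ha : ∀ P ∈ S, ∀ P' ∈ S, P' ≤ P → P = P') : Nat.card (irreducibleComponents X) = Nat.card S := by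
  let C (P : Ideal (MvPolynomial σ ℂ)) : Set X := {x | P ≤ pid (u x)}
  have hv : ∀ P ∈ S, ∀ p, (∀ x ∈ C P, aeval (u x) p = 0) → p ∈ P := fun P hP p h => by
    have := hp P hP
    rw [← IsPrime.vanishingIdeal_zeroLocus (K := ℂ) P]
    intro f hf
    obtain ⟨x, rfl⟩ := hr P hP f hf
    exact h x hf
  have hcl : ∀ P, IsClosed (C P) := fun P => by
    have : C P = ⋂ p ∈ P, {x | aeval (u x) p ≠ 0}ᶜ := by
      ext x; simp only [Set.mem_iInter, Set.mem_compl_iff, Set.mem_ofPred_eq, not_not]; rfl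
    rw [this]
    exact isClosed_biInter fun p _ => (hO p).isClosed_compl
  have hi : ∀ P ∈ S, IsIrreducible (C P) := fun P hP => by
    have := hp P hP
    have key : ∀ p ∉ P, ∃ x ∈ C P, aeval (u x) p ≠ 0 := fun p hp' => by
      by_contra! h; exact hp' (hv P hP p h)
    refine ⟨(key 1 fun h => this.ne_top ((Ideal.eq_top_iff_one _).2 h)).imp fun x h => h.1, ?_⟩
    rintro U V hU hV ⟨x, hx, hxU⟩ ⟨y, hy, hyV⟩
    obtain ⟨p, hp1, hp2⟩ := hB U hU x hxU
    obtain ⟨r, hr1, hr2⟩ := hB V hV y hyV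
    obtain ⟨z, hz, h⟩ := key (p * r) (this.mul_notMem (fun h => hp1 (hx h)) (fun h => hr1 (hy h)))
    rw [map_mul] at h
    exact ⟨z, hz, hp2 z (left_ne_zero_of_mul h), hr2 z (right_ne_zero_of_mul h)⟩
  have hm : ∀ P ∈ S, ∀ P' ∈ S, C P ⊆ C P' → P = P' := fun P hP P' hP' h => ha P hP P' hP' fun p hp' => hv P hP p fun x hx => h hx hp'
  have hin : ∀ A : Set X, IsIrreducible A → ∃ P ∈ S, A ⊆ C P := fun A hA => by
    classical
    obtain ⟨t, ht, h⟩ := isIrreducible_iff_sUnion_isClosed.1 hA (hf.toFinset.image C) (by simp only [Finset.mem_image]; rintro _ ⟨P, -, rfl⟩; exact hcl P)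
      (fun x _ => by obtain ⟨P, hP, h⟩ := hc x; exact ⟨C P, by simpa using ⟨P, hP, rfl⟩, h⟩)
    obtain ⟨P, hP, rfl⟩ := Finset.mem_image.1 ht
    exact ⟨P, hf.mem_toFinset.1 hP, h⟩
  have : irreducibleComponents X = C '' S := by
    ext A
    constructor
    · intro hA
      obtain ⟨P, hP, h⟩ := hin A hA.1
      exact ⟨P, hP, (hA.2 (hi P hP) h).antisymm h⟩
    · rintro ⟨P, hP, rfl⟩
      refine ⟨hi P hP, fun A hA h => ?_⟩
      obtain ⟨P', hP', h'⟩ := hin A hA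
      obtain rfl := hm P hP P' hP' (h.trans h')
      exact h'
  rw [this]
  exact Nat.card_image_of_injOn fun P hP P' hP' h => hm P hP P' hP' h.le
section
variable {I E0 : Type} [Fintype I] [DecidableEq I] [Fintype E0] (a b : E0 → I)

def gq (hn : ∀ x, a x ≠ b x) : Qv I (E0 × Bool) where
  src := dsrc a b
  tgt := dtgt a b
  bar := dbar
  sg := eps
  bb ρ := by simp [dbar]
  sb ρ := by rcases ρ with ⟨x, _ | _⟩ <;> rfl
  nl ρ := by rcases ρ with ⟨x, _ | _⟩; exacts [hn x, (hn x).symm]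
  sg0 ρ := by rcases ρ with ⟨x, _ | _⟩; exacts [.inl rfl, .inr rfl]
lemma gq_pr (hn : ∀ x, a x ≠ b x) (i : I) (β : I → ℤ) : pr (gCartan a b) i β = 2 * β i - ∑ ρ : E0 × Bool, if dtgt a b ρ = i then β (dsrc a b ρ) else 0 := by
  classical
  have h1 : ∀ j, (Nat.card {x : E0 // (a x = i ∧ b x = j) ∨ (a x = j ∧ b x = i)} : ℤ) * β j = ∑ x, ((if a x = i then if b x = j then β j else 0 else 0) + if b x = i then if a x = j then β j else 0 else 0) := fun j => by
    rw [Nat.card_eq_fintype_card, Fintype.card_subtype, Finset.card_filter]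
    push_cast
    rw [Finset.sum_mul]
    refine Finset.sum_congr rfl fun x _ => ?_
    have := hn x
    by_cases h1 : a x = i <;> by_cases h2 : b x = j <;> by_cases h3 : a x = j <;> by_cases h4 : b x = i <;> simp_all
  simp only [pr, gCartan, sub_mul, Finset.sum_sub_distrib, h1]
  congr 1
  · simp
  · rw [Finset.sum_comm, Fintype.sum_prod_type]
    refine Finset.sum_congr rfl fun x _ => ?_
    rw [Finset.sum_add_distrib, Fintype.sum_bool]
    congr 1 <;> simp [dtgt, dsrc]
variable {a b} {ν : I → ℕ}

def fl (ν : I → ℕ) : WT ν ≃ₗ[ℂ] (TT ν → ℂ) where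
  toFun w t := w t.1 t.2
  invFun v i k := v ⟨i, k⟩
  left_inv _ := rfl
  right_inv _ := rfl
  map_add' _ _ := rfl
  map_smul' _ _ := rfl

noncomputable def ma (ν : I → ℕ) : (WT ν →ₗ[ℂ] WT ν) ≃ₐ[ℂ] Matrix (TT ν) (TT ν) ℂ := ((fl ν).conjAlgEquiv ℂ).trans LinearMap.toMatrixAlgEquiv'

noncomputable def zz (x : EVs a b ν) : Pt (E0 × Bool) (TT ν) ℂ := fun ρ => ma ν (gmap a b ν x ρ)
lemma zz_ap (x : EVs a b ν) (ρ s t) : zz x ρ s t = (Pi.single (dtgt a b ρ) (x ρ *ᵥ fun k => (Pi.single t 1 : TT ν → ℂ) ⟨dsrc a b ρ, k⟩) : WT ν) s.1 s.2 := by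
  have : zz x ρ s t = LinearMap.toMatrix' ((fl ν).toLinearMap ∘ₗ gmap a b ν x ρ ∘ₗ (fl ν).symm.toLinearMap) s t := rfl
  rw [this, LinearMap.toMatrix'_apply]
  rfl
lemma zz_co (x : EVs a b ν) (ρ k l) : zz x ρ ⟨_, k⟩ ⟨_, l⟩ = x ρ k l := by
  rw [zz_ap, Pi.single_eq_same]
  have : (fun k => (Pi.single ⟨dsrc a b ρ, l⟩ 1 : TT ν → ℂ) ⟨dsrc a b ρ, k⟩) = Pi.single l 1 := by
    ext k; simp [Pi.single_apply]
  rw [this, mulVec_single_one]; rfl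
lemma zz_gr (x : EVs a b ν) (ρ s t) (h : zz x ρ s t ≠ 0) : s.1 = dtgt a b ρ ∧ t.1 = dsrc a b ρ := by
  rw [zz_ap] at h
  constructor
  · by_contra h1; rw [Pi.single_eq_of_ne h1] at h; exact h rfl
  · by_contra h1
    have : (fun k => (Pi.single t 1 : TT ν → ℂ) ⟨dsrc a b ρ, k⟩) = 0 := by
      ext k; exact Pi.single_eq_of_ne (fun e => h1 (by rw [← e])) _
    rw [this, mulVec_zero, Pi.single_zero] at h; exact h rfl
lemma zz_lam (hn : ∀ x, a x ≠ b x) (x : EVs a b ν) : Lam (gq a b hn) (sf ν) (zz x) ↔ NilEl a b ν x ∧ MomentZero a b ν x := by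
  have hl : ∀ l : List (E0 × Bool), (l.map (zz x)).prod = 0 ↔ (l.map (gmap a b ν x)).prod = 0 := fun l => by
    rw [← map_eq_zero_iff (ma ν) (ma ν).injective, map_list_prod, List.map_map]; rfl
  have hm : ∑ ρ, (gq a b hn).sg ρ • (zz x ρ * zz x ((gq a b hn).bar ρ)) = 0 ↔ MomentZero a b ν x := by
    rw [MomentZero, ← map_eq_zero_iff (ma ν) (ma ν).injective, map_sum]
    refine Eq.congr (Finset.sum_congr rfl fun ρ _ => ?_) rfl
    rw [map_smul, Int.cast_smul_eq_zsmul]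
    exact congrArg _ (map_mul (ma ν) _ _).symm
  constructor
  · rintro ⟨-, h2, N, h3⟩
    refine ⟨⟨N + 1, by omega, fun l hN => ?_⟩, hm.1 h2⟩
    cases l with
    | nil => simp at hN
    | cons r l => rw [List.map_cons, List.prod_cons, (hl l).1 (h3 l (by simpa using hN)), mul_zero]
  · rintro ⟨⟨N, -, h⟩, h2⟩
    exact ⟨zz_gr x, hm.2 h2, N, fun l hN => (hl l).2 (h l hN)⟩
lemma zz_surj (y : Pt (E0 × Bool) (TT ν) ℂ) (h : ∀ ρ s t, y ρ s t ≠ 0 → s.1 = dtgt a b ρ ∧ t.1 = dsrc a b ρ) : ∃ x : EVs a b ν, zz x = y := by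
  obtain ⟨x, hx⟩ : ∃ x : EVs a b ν, ∀ ρ k l, x ρ k l = y ρ ⟨_, k⟩ ⟨_, l⟩ := ⟨fun ρ => of fun k l => y ρ ⟨_, k⟩ ⟨_, l⟩, fun _ _ _ => rfl⟩
  refine ⟨x, funext fun ρ => ?_⟩
  ext s t
  by_cases h1 : s.1 = dtgt a b ρ ∧ t.1 = dsrc a b ρ
  · obtain ⟨i, s⟩ := s
    obtain ⟨j, t⟩ := t
    obtain ⟨rfl, rfl⟩ := h1
    rw [zz_co, hx]
  · rw [not_not.1 (mt (zz_gr _ ρ s t) h1), not_not.1 (mt (h ρ s t) h1)]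
lemma lam_poly (p : MvPolynomial ((E0 × Bool) × TT ν × TT ν) ℂ) : ∃ p' : MvPolynomial ((ρ : E0 × Bool) × (Fin (ν (dtgt a b ρ)) × Fin (ν (dsrc a b ρ)))) ℂ, ∀ x : EVs a b ν, aeval (co (zz x)) p = eval (fun c => x c.1 c.2.1 c.2.2) p' := by
  induction p using MvPolynomial.induction_on with
  | C c => exact ⟨C c, fun x => by simp⟩
  | add p r hp hr => obtain ⟨p', hp⟩ := hp; obtain ⟨r', hr⟩ := hr; exact ⟨p' + r', fun x => by rw [map_add, map_add, hp, hr]⟩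
  | mul_X p v hp =>
    obtain ⟨p', hp⟩ := hp
    obtain ⟨ρ, s, t⟩ := v
    by_cases h1 : s.1 = dtgt a b ρ ∧ t.1 = dsrc a b ρ
    · obtain ⟨i, s⟩ := s
      obtain ⟨j, t⟩ := t
      obtain ⟨rfl, rfl⟩ := h1
      exact ⟨p' * X ⟨ρ, s, t⟩, fun x => by rw [map_mul, map_mul, hp, aeval_X, eval_X, co, zz_co]⟩
    · exact ⟨0, fun x => by rw [map_mul, aeval_X, co, not_not.1 (mt (zz_gr _ ρ s t) h1), mul_zero, map_zero]⟩
lemma lam_open (p : MvPolynomial ((E0 × Bool) × TT ν × TT ν) ℂ) : IsOpen {x : LusztigLam a b ν | aeval (co (zz x.1)) p ≠ 0} := by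
  obtain ⟨p', h⟩ := lam_poly (a := a) (b := b) p
  exact ⟨{x | eval (fun c => x c.1 c.2.1 c.2.2) p' ≠ 0}, .basic _ ⟨p', rfl⟩, Set.ext fun x => not_congr (Eq.congr (h x.1).symm rfl)⟩
lemma lam_basis (U : Set (LusztigLam a b ν)) (hU : IsOpen U) (x) (hx : x ∈ U) :
    ∃ p : MvPolynomial ((E0 × Bool) × TT ν × TT ν) ℂ, aeval (co (zz x.1)) p ≠ 0 ∧ ∀ y : LusztigLam a b ν, aeval (co (zz y.1)) p ≠ 0 → y ∈ U := by
  obtain ⟨V, hV, rfl⟩ := hU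
  change x.1 ∈ V at hx
  suffices h : ∃ p : MvPolynomial ((E0 × Bool) × TT ν × TT ν) ℂ, aeval (co (zz x.1)) p ≠ 0 ∧ ∀ y : EVs a b ν, aeval (co (zz y)) p ≠ 0 → y ∈ V from h.imp fun p h => ⟨h.1, fun y => h.2 y.1⟩
  induction hV with
  | basic V h =>
    obtain ⟨p, rfl⟩ := h
    have : ∀ y : EVs a b ν, aeval (co (zz y)) (rename (fun c => (c.1, ⟨_, c.2.1⟩, ⟨_, c.2.2⟩) : _ → (E0 × Bool) × TT ν × TT ν) p) = eval (fun c => y c.1 c.2.1 c.2.2) p := fun y => by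
      rw [aeval_rename, ← coe_aeval_eq_eval]
      exact congrArg (fun f => aeval f p) (funext fun c => zz_co y _ _ _)
    exact ⟨_, (this _).trans_ne hx, fun y hy => (this y).symm.trans_ne hy⟩
  | univ => exact ⟨1, by simp, fun _ _ => trivial⟩
  | inter V V' _ _ h h' =>
    obtain ⟨p, h1, h2⟩ := h hx.1
    obtain ⟨r, h3, h4⟩ := h' hx.2
    refine ⟨p * r, by rw [map_mul]; exact mul_ne_zero h1 h3, fun y hy => ?_⟩
    rw [map_mul] at hy
    exact ⟨h2 y (left_ne_zero_of_mul hy), h4 y (right_ne_zero_of_mul hy)⟩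
  | sUnion s _ h =>
    obtain ⟨V, hV, hx⟩ := hx
    obtain ⟨p, h1, h2⟩ := h V hV hx
    exact ⟨p, h1, fun y hy => ⟨V, hV, h2 y hy⟩⟩
theorem partC (hn : ∀ x, a x ≠ b x) : Module.finrank ℚ (gradeQ a b ν) = Nat.card (irreducibleComponents (LusztigLam a b ν)) := by
  classical
  obtain ⟨K, hK⟩ := mkC (q := gq a b hn) (gCartan a b) (gq_pr a b hn)
  rw [partA a b hn K, hK]
  let S : Set (Ideal (MvPolynomial ((E0 × Bool) × TT ν × TT ν) ℂ)) := {P | ∃ (K : Type) (_ : Field K) (_ : Algebra ℂ K) (z : Pt (E0 × Bool) (TT ν) K), Gd (gq a b hn) (sf ν) z ∧ pd z = P}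
  let f : S → BB (gq a b hn) := fun P => ⟨ν, P.1, P.2⟩
  have hf : Function.Injective f := fun P P' h => Subtype.ext (by injection h)
  have hr : Set.range f = {c | c.1 = ν} := by
    ext c
    constructor
    · rintro ⟨P, rfl⟩; rfl
    · rintro rfl; exact ⟨⟨c.2, c.3⟩, rfl⟩
  have hfin : S.Finite := by
    have h1 : (Set.range f).Finite := hr ▸ finB _ ν rfl
    have := h1.to_subtype
    exact Finite.of_injective_finite_range hf
  rw [← hr, ← Nat.card_coe_set_eq, Nat.card_range_of_injective hf]
  refine (topo (fun x : LusztigLam a b ν => co (zz x.1)) lam_open lam_basis S hfin ?_ ?_ ?_ ?_).symm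
  · rintro _ ⟨K, _, _, z, -, rfl⟩; infer_instance
  · rintro _ ⟨K, _, _, z, hz, rfl⟩ f hf
    have h1 := hz.lam.of_le (y := (fun ρ => of fun s t => f (ρ, s, t) : Pt (E0 × Bool) (TT ν) ℂ)) hf
    obtain ⟨x, hx⟩ := zz_surj (a := a) (b := b) _ h1.gr
    exact ⟨⟨x, (zz_lam hn x).1 (hx ▸ h1)⟩, congrArg co hx⟩
  · intro x
    obtain ⟨K, _, _, y, hy, h⟩ := claim _ rfl ((zz_lam hn x.1).2 x.2)
    exact ⟨_, ⟨K, _, _, y, hy, rfl⟩, h⟩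
  · rintro _ ⟨K, _, _, z, hz, rfl⟩ _ ⟨K', _, _, z', hz', rfl⟩ h
    exact (hz.eq hz'.lam h).symm
end
end KS

theorem stmt19 (I E0 : Type) [Fintype I] [DecidableEq I] [Fintype E0] (a b : E0 → I)
    (hnoloop : ∀ x : E0, a x ≠ b x) (ν : I → ℕ) :
    Module.finrank ℚ (gradeQ a b ν) =
      Nat.card (irreducibleComponents (LusztigLam a b ν)) :=
  KS.partC hnoloop
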